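/- There exists a constant C>0 such that for every δ>0, every finite subgraph Ω_δ of δℤ², every k ≥ 1 and all pairwise distinct vertices x_1,…,x_k ∈ V(Ω_δ), the critical Ising model with plus boundary conditions satisfies E⁺[σ_{x_1}⋯σ_{x_k}] ≤ C^k δ^{k/8} ∏_{j=1}^k ( min( (1/2)L(x_j), d(x_j,∂Ω_δ) ) )^{−1/8}, where L(x_j) = min_{p≠j} |x_p − x_j| (with L(x_1) = +∞ when k = 1) and d(x_j,∂Ω_δ) is the Euclidean distance from x_j to ∂Ω_δ. -/

import Mathlib

open scoped Classical

noncomputable section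

/-- Vertices of the square lattice (the lattice `δℤ²` is represented by integer
coordinates, the point `p` standing for `δ·p ∈ ℝ²`). -/
abbrev V2 := ℤ × ℤ

/-- The four nearest neighbours of a lattice point. -/
def nbrs (p : V2) : Finset V2 :=
  {(p.1 + 1, p.2), (p.1 - 1, p.2), (p.1, p.2 + 1), (p.1, p.2 - 1)}

/-- The boundary `∂Ω` of a finite vertex set `V`. -/
def bdry (V : Finset V2) : Finset V2 := V.biUnion nbrs \ V

/-- `V ∪ ∂V`. -/
def fullSet (V : Finset V2) : Finset V2 := V ∪ bdry V

/-- Nearest-neighbour edges with at least one endpoint in `V`. -/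
def edgesV (V : Finset V2) : Finset (Sym2 V2) :=
  V.biUnion fun v => (nbrs v).image fun w => s(v, w)

/-- `σ_x σ_y` for an (unordered) edge `{x,y}`. -/
def pairProd (σ : V2 → ℝ) : Sym2 V2 → ℝ :=
  Sym2.lift ⟨fun a b => σ a * σ b, fun a b => mul_comm _ _⟩

/-- The critical inverse temperature `β_c = (1/2) log(√2+1)`. -/
def betaC : ℝ := Real.log (Real.sqrt 2 + 1) / 2

/-- The spin configuration (with values `±1`) determined by a boolean labelling of
`V ∪ ∂V`; spins outside of `V ∪ ∂V` are set to `+1`. -/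
def spin (V : Finset V2) (g : ↥(fullSet V) → Bool) : V2 → ℝ :=
  fun x => if h : x ∈ fullSet V then (if g ⟨x, h⟩ then 1 else -1) else 1

/-- Ising weight with plus boundary conditions at inverse temperature `β`. -/
def wPlus (β : ℝ) (V : Finset V2) (σ : V2 → ℝ) : ℝ :=
  Real.exp (β * ∑ e ∈ edgesV V, pairProd σ e) *
    (if ∀ w ∈ bdry V, σ w = 1 then 1 else 0)

/-- Expectation for the Ising model on `V` with plus boundary conditions. -/
def ePlus (β : ℝ) (V : Finset V2) (f : (V2 → ℝ) → ℝ) : ℝ :=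
  (∑ g : ↥(fullSet V) → Bool, wPlus β V (spin V g) * f (spin V g)) /
    (∑ g : ↥(fullSet V) → Bool, wPlus β V (spin V g))

/-- Euclidean distance between the points `δ·p` and `δ·q` of `δℤ² ⊂ ℝ²`. -/
def edist2 (δ : ℝ) (p q : V2) : ℝ :=
  Real.sqrt ((δ * (p.1 : ℝ) - δ * (q.1 : ℝ)) ^ 2 + (δ * (p.2 : ℝ) - δ * (q.2 : ℝ)) ^ 2)

/-- Euclidean distance from the point `δ·p` to the boundary `∂Ω` of `V` in `δℤ²`. -/
def distToBdry (δ : ℝ) (p : V2) (V : Finset V2) : ℝ :=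
  sInf ((fun w => edist2 δ p w) '' (bdry V : Set V2))

/-- `min((1/2)·L(x_j), d(x_j, ∂Ω))` where `L(x_j) = min_{p ≠ j} |x_p - x_j|` is `+∞`
when `k = 1` (so that the minimum is then `d(x_j, ∂Ω)`). -/
def mTerm (δ : ℝ) (V : Finset V2) (k : ℕ) (x : Fin k → V2) (j : Fin k) : ℝ :=
  if 2 ≤ k then
    min ((1 / 2) * ⨅ p : { p : Fin k // p ≠ j }, edist2 δ (x ↑p) (x j))
      (distToBdry δ (x j) V)
  else distToBdry δ (x j) V

set_option linter.unusedSectionVars false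

namespace Ising

section General
variable {α ι : Type*}

/-- The spin at `v` of the configuration whose set of minus spins is `A`. -/
def sg (A : Finset α) (v : α) : ℝ := if v ∈ A then -1 else 1

/-- The character `∏_{v ∈ B} σ_v`. -/
def chi (B A : Finset α) : ℝ := ∏ v ∈ B, sg A v

/-- The weight of the bond `uv`: `1` if it is satisfied and `t` otherwise. -/
def bond (t : ℝ) (A : Finset α) (u v : α) : ℝ := if (u ∈ A ↔ v ∈ A) then 1 else t

/-- The Ising weight, normalised so that a satisfied edge has weight `1` and an unsatisfied
one has weight `t`. -/
def wt (t : ℝ) (s : Finset ι) (a b : ι → α) (A : Finset α) : ℝ :=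
  ∏ i ∈ s, bond t A (a i) (b i)

/-- Unnormalised expectation with free vertices `U` and plus spins elsewhere. -/
def Zi (t : ℝ) (s : Finset ι) (a b : ι → α) (U : Finset α) (f : Finset α → ℝ) : ℝ :=
  ∑ A ∈ U.powerset, wt t s a b A * f A

/-- Expectation with free vertices `U` and plus spins elsewhere. -/
def Ei (t : ℝ) (s : Finset ι) (a b : ι → α) (U : Finset α) (f : Finset α → ℝ) : ℝ :=
  Zi t s a b U f / Zi t s a b U (fun _ => 1)

variable [DecidableEq α] [DecidableEq ι]

lemma sg_of_mem {A : Finset α} {v : α} (h : v ∈ A) : sg A v = -1 := if_pos h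

lemma sg_of_notMem {A : Finset α} {v : α} (h : v ∉ A) : sg A v = 1 := if_neg h

lemma bond_of_iff {t : ℝ} {A : Finset α} {u v : α} (h : u ∈ A ↔ v ∈ A) : bond t A u v = 1 :=
  if_pos h

lemma bond_congr {β : Type*} {t : ℝ} {A : Finset α} {u v : α} {A' : Finset β} {u' v' : β}
    (h : (u ∈ A ↔ v ∈ A) ↔ (u' ∈ A' ↔ v' ∈ A')) : bond t A u v = bond t A' u' v' := by
  unfold bond; split_ifs <;> tauto

lemma sg_symmDiff (A B : Finset α) (v : α) : sg (symmDiff A B) v = sg A v * sg B v := by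
  unfold sg
  by_cases h1 : v ∈ A <;> by_cases h2 : v ∈ B <;> simp [Finset.mem_symmDiff, h1, h2]

lemma sg_sq (A : Finset α) (v : α) : sg A v * sg A v = 1 := by
  unfold sg; split_ifs <;> norm_num

lemma sg_eq (A : Finset α) (v : α) : sg A v = 1 ∨ sg A v = -1 := by
  unfold sg; split_ifs <;> simp

lemma chi_symmDiff (B A T : Finset α) : chi B (symmDiff A T) = chi B A * chi B T := by
  simp [chi, sg_symmDiff, Finset.prod_mul_distrib]

lemma chi_eq (B A : Finset α) : chi B A = 1 ∨ chi B A = -1 := by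
  unfold chi
  induction B using Finset.induction_on with
  | empty => simp
  | insert v B hv ih =>
    rw [Finset.prod_insert hv]
    rcases sg_eq A v with h | h <;> rcases ih with h' | h' <;> simp [h, h']

lemma prod_sdiff_mul_prod_inter (B C : Finset α) (f : α → ℝ) :
    (∏ v ∈ B \ C, f v) * ∏ v ∈ B ∩ C, f v = ∏ v ∈ B, f v := by
  rw [← Finset.prod_union, Finset.sdiff_union_inter]
  exact Finset.disjoint_sdiff_inter B C

lemma chi_mul (B C A : Finset α) : chi B A * chi C A = chi (symmDiff B C) A := by
  have h1 : symmDiff B C = (B \ C) ∪ (C \ B) := rfl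
  have hd : Disjoint (B \ C) (C \ B) := by
    rw [Finset.disjoint_left]; intro v; simp; tauto
  unfold chi
  rw [h1, Finset.prod_union hd, ← prod_sdiff_mul_prod_inter B C,
    ← prod_sdiff_mul_prod_inter C B, Finset.inter_comm C B]
  have : (∏ v ∈ B ∩ C, sg A v) * (∏ v ∈ B ∩ C, sg A v) = 1 := by
    rw [← Finset.prod_mul_distrib]; simp [sg_sq]
  linear_combination ((∏ v ∈ B \ C, sg A v) * ∏ v ∈ C \ B, sg A v) * this

lemma chi_singleton (v : α) (A : Finset α) : chi {v} A = sg A v := by simp [chi]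

/-- Nonnegative combinations of characters. -/
inductive Pos : (Finset α → ℝ) → Prop
  | chi (B : Finset α) : Pos (chi B)
  | smul (c : ℝ) (f : Finset α → ℝ) : 0 ≤ c → Pos f → Pos (fun A => c * f A)
  | add (f g : Finset α → ℝ) : Pos f → Pos g → Pos (fun A => f A + g A)

lemma Pos.const {c : ℝ} (hc : 0 ≤ c) : Pos (fun _ : Finset α => c) := by
  have := Pos.smul c _ hc (Pos.chi (∅ : Finset α))
  simpa [Ising.chi] using this

lemma Pos.sg (v : α) : Pos (fun A => sg A v) := by
  have := Pos.chi ({v} : Finset α)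
  have h : Ising.chi ({v} : Finset α) = fun A => Ising.sg A v := by
    funext A; exact chi_singleton v A
  rwa [h] at this

lemma Pos.mul {f g : Finset α → ℝ} (hf : Pos f) (hg : Pos g) : Pos (fun A => f A * g A) := by
  induction hf with
  | chi B =>
    induction hg with
    | chi C =>
      have : (fun A => Ising.chi B A * Ising.chi C A) = Ising.chi (symmDiff B C) := by
        funext A; exact chi_mul B C A
      rw [this]; exact Pos.chi _
    | smul c g hc _ ih =>
      have := Pos.smul c _ hc ih
      convert this using 2; ring
    | add g g' _ _ ih ih' =>
      have := Pos.add _ _ ih ih'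
      convert this using 2; ring
  | smul c f hc _ ih =>
    have := Pos.smul c _ hc ih
    convert this using 2; ring
  | add f f' _ _ ih ih' =>
    have := Pos.add _ _ ih ih'
    convert this using 2; ring

lemma Pos.prod {κ : Type*} (s : Finset κ) (f : κ → Finset α → ℝ) (h : ∀ i ∈ s, Pos (f i)) :
    Pos (fun A => ∏ i ∈ s, f i A) := by
  induction s using Finset.induction_on with
  | empty => simpa using Pos.const (α := α) zero_le_one
  | insert i s hi ih =>
    simp only [Finset.prod_insert hi]
    exact (h i (by simp)).mul (ih fun j hj => h j (by simp [hj]))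

lemma Pos.sum {κ : Type*} (s : Finset κ) (f : κ → Finset α → ℝ) (h : ∀ i ∈ s, Pos (f i)) :
    Pos (fun A => ∑ i ∈ s, f i A) := by
  induction s using Finset.induction_on with
  | empty => simpa using Pos.const (α := α) le_rfl
  | insert i s hi ih =>
    simp only [Finset.sum_insert hi]
    exact (h i (by simp)).add _ _ (ih fun j hj => h j (by simp [hj]))

lemma sum_chi_nonneg (U B : Finset α) : 0 ≤ ∑ A ∈ U.powerset, chi B A := by
  have h : ∀ A ∈ U.powerset, chi B A =
      (∏ v ∈ A, if v ∈ B then (-1 : ℝ) else 1) * ∏ v ∈ U \ A, (1 : ℝ) := by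
    intro A _
    have hs : ∀ v, sg A v = if v ∈ A then -1 else 1 := fun v => by
      unfold sg; split_ifs <;> rfl
    simp only [chi, hs, Finset.prod_const_one, mul_one, ← Finset.prod_filter,
      Finset.filter_mem_eq_inter, Finset.inter_comm]
  rw [Finset.sum_congr rfl h, ← Finset.prod_add]
  refine Finset.prod_nonneg fun v _ => ?_
  split_ifs <;> norm_num

/-- First Griffiths inequality. -/
lemma Pos.sum_nonneg {f : Finset α → ℝ} (hf : Pos f) (U : Finset α) :
    0 ≤ ∑ A ∈ U.powerset, f A := by
  induction hf with
  | chi B => exact sum_chi_nonneg U B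
  | smul c f hc _ ih => rw [← Finset.mul_sum]; exact mul_nonneg hc ih
  | add f g _ _ ih ih' => rw [Finset.sum_add_distrib]; exact add_nonneg ih ih'

lemma bond_eq (t : ℝ) (u v : α) (A : Finset α) :
    bond t A u v = (1 + t) / 2 + (1 - t) / 2 * (sg A u * sg A v) := by
  unfold bond sg
  by_cases h1 : u ∈ A <;> by_cases h2 : v ∈ A <;> simp [h1, h2] <;> ring

lemma Pos.bond {t : ℝ} (h0 : 0 ≤ t) (h1 : t ≤ 1) (u v : α) :
    Pos (fun A : Finset α => Ising.bond t A u v) := by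
  simp only [bond_eq]
  exact (Pos.const (by linarith)).add _ _ (((Pos.sg u).mul (Pos.sg v)).smul _ _ (by linarith))

lemma Pos.wt {t : ℝ} (h0 : 0 ≤ t) (h1 : t ≤ 1) (s : Finset ι) (a b : ι → α) :
    Pos (wt t s a b) := Pos.prod s _ fun _ _ => Pos.bond h0 h1 _ _

lemma Pos.wt_mul_wt {t : ℝ} (h0 : 0 ≤ t) (h1 : t ≤ 1) (s : Finset ι) (a b : ι → α)
    (T : Finset α) : Pos (fun A => Ising.wt t s a b A * Ising.wt t s a b (symmDiff A T)) := by
  unfold Ising.wt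
  simp only [← Finset.prod_mul_distrib]
  refine Pos.prod s _ fun i _ => ?_
  by_cases h : (a i ∈ T ↔ b i ∈ T)
  · have : ∀ A : Finset α, Ising.bond t A (a i) (b i) * Ising.bond t (symmDiff A T) (a i) (b i)
        = Ising.bond (t * t) A (a i) (b i) := by
      intro A
      unfold Ising.bond
      by_cases h1 : a i ∈ A <;> by_cases h2 : b i ∈ A <;> by_cases h3 : b i ∈ T <;>
        simp [Finset.mem_symmDiff, h1, h2, h3, h]
    simp only [this]
    exact Pos.bond (by positivity) (by nlinarith) _ _
  · have : ∀ A : Finset α, Ising.bond t A (a i) (b i) * Ising.bond t (symmDiff A T) (a i) (b i)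
        = t := by
      intro A
      have h : (a i ∈ T ↔ b i ∉ T) := by tauto
      unfold Ising.bond
      by_cases h1 : a i ∈ A <;> by_cases h2 : b i ∈ A <;> by_cases h3 : b i ∈ T <;>
        simp [Finset.mem_symmDiff, h1, h2, h3, h]
    simp only [this]
    exact Pos.const h0

lemma symmDiff_mem_powerset {U A T : Finset α} (hA : A ∈ U.powerset) (hT : T ∈ U.powerset) :
    symmDiff A T ∈ U.powerset := by
  rw [Finset.mem_powerset] at *
  intro v hv
  rw [Finset.mem_symmDiff] at hv
  rcases hv with h | h
  · exact hA h.1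
  · exact hT h.1

lemma sum_powerset_symmDiff (U T : Finset α) (hT : T ∈ U.powerset) (f : Finset α → ℝ) :
    ∑ A ∈ U.powerset, f A = ∑ A ∈ U.powerset, f (symmDiff A T) := by
  symm
  refine Finset.sum_nbij' (fun A => symmDiff A T) (fun A => symmDiff A T) ?_ ?_ ?_ ?_ ?_
  · exact fun A hA => symmDiff_mem_powerset hA hT
  · exact fun A hA => symmDiff_mem_powerset hA hT
  · intro A _; simp
  · intro A _; simp
  · intro A _; rfl

/-- Second Griffiths inequality. -/
lemma griffiths {t : ℝ} (h0 : 0 ≤ t) (h1 : t ≤ 1) (s : Finset ι) (a b : ι → α)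
    (U : Finset α) {f g : Finset α → ℝ} (hf : Pos f) (hg : Pos g) :
    Zi t s a b U f * Zi t s a b U g ≤
      Zi t s a b U (fun A => f A * g A) * Zi t s a b U (fun _ => 1) := by
  induction hg with
  | smul c g hc _ ih =>
    have e1 : Zi t s a b U (fun A => c * g A) = c * Zi t s a b U g := by
      simp only [Zi, Finset.mul_sum]; exact Finset.sum_congr rfl fun _ _ => by ring
    have e2 : Zi t s a b U (fun A => f A * (c * g A)) = c * Zi t s a b U (fun A => f A * g A) := by
      simp only [Zi, Finset.mul_sum]; exact Finset.sum_congr rfl fun _ _ => by ring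
    rw [e1, e2]
    calc _ = c * (Zi t s a b U f * Zi t s a b U g) := by ring
      _ ≤ c * _ := mul_le_mul_of_nonneg_left ih hc
      _ = _ := by ring
  | add g g' _ _ ih ih' =>
    have e1 : Zi t s a b U (fun A => g A + g' A) = Zi t s a b U g + Zi t s a b U g' := by
      simp only [Zi, ← Finset.sum_add_distrib]; exact Finset.sum_congr rfl fun _ _ => by ring
    have e2 : Zi t s a b U (fun A => f A * (g A + g' A)) =
        Zi t s a b U (fun A => f A * g A) + Zi t s a b U (fun A => f A * g' A) := by
      simp only [Zi, ← Finset.sum_add_distrib]; exact Finset.sum_congr rfl fun _ _ => by ring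
    rw [e1, e2]
    linarith
  | chi B =>
    have key : Zi t s a b U (fun A => f A * chi B A) * Zi t s a b U (fun _ => 1) -
        Zi t s a b U f * Zi t s a b U (chi B) =
        ∑ T ∈ U.powerset, (1 - chi B T) *
          ∑ A ∈ U.powerset, (wt t s a b A * wt t s a b (symmDiff A T)) * (f A * chi B A) := by
      unfold Zi
      rw [Finset.sum_mul_sum, Finset.sum_mul_sum, ← Finset.sum_sub_distrib]
      simp only [Finset.mul_sum, ← Finset.sum_sub_distrib]
      rw [Finset.sum_comm (s := U.powerset) (t := U.powerset)
        (f := fun T A => (1 - chi B T) * (wt t s a b A * wt t s a b (symmDiff A T) * (f A * chi B A)))]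
      refine Finset.sum_congr rfl fun A hA => ?_
      rw [sum_powerset_symmDiff U A hA]
      refine Finset.sum_congr rfl fun T _ => ?_
      rw [symmDiff_comm T A, chi_symmDiff]
      ring
    have : 0 ≤ ∑ T ∈ U.powerset, (1 - chi B T) *
          ∑ A ∈ U.powerset, (wt t s a b A * wt t s a b (symmDiff A T)) * (f A * chi B A) := by
      refine Finset.sum_nonneg fun T _ => mul_nonneg ?_ ?_
      · rcases chi_eq B T with h | h <;> rw [h] <;> norm_num
      · exact Pos.sum_nonneg ((Pos.wt_mul_wt h0 h1 s a b T).mul (hf.mul (Pos.chi B))) U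
    linarith

lemma wt_pos {t : ℝ} (h0 : 0 < t) (s : Finset ι) (a b : ι → α) (A : Finset α) :
    0 < wt t s a b A := Finset.prod_pos fun i _ => by
  unfold bond; split_ifs <;> [norm_num; exact h0]

lemma Zi_one_pos {t : ℝ} (h0 : 0 < t) (s : Finset ι) (a b : ι → α) (U : Finset α) :
    0 < Zi t s a b U (fun _ => 1) :=
  Finset.sum_pos (fun A _ => by simpa using wt_pos h0 s a b A) ⟨∅, by simp⟩

lemma plus_indicator (P A : Finset α) :
    ∏ v ∈ P, ((1 / 2 : ℝ) + 1 / 2 * sg A v) = if Disjoint A P then 1 else 0 := by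
  split_ifs with h
  · refine Finset.prod_eq_one fun v hv => ?_
    have : v ∉ A := fun h' => Finset.disjoint_left.mp h h' hv
    simp [sg, this]; norm_num
  · rw [Finset.not_disjoint_iff] at h
    obtain ⟨v, hvA, hvP⟩ := h
    exact Finset.prod_eq_zero hvP (by simp [sg, hvA])

/-- The plus boundary expectation of a positive function decreases when the domain grows. -/
lemma Ei_mono {t : ℝ} (h0 : 0 < t) (h1 : t ≤ 1) (s : Finset ι) (a b : ι → α)
    {U' U : Finset α} (hU : U' ⊆ U) {f : Finset α → ℝ} (hf : Pos f) :
    Ei t s a b U f ≤ Ei t s a b U' f := by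
  have hg : Pos (fun A : Finset α => ∏ v ∈ U \ U', ((1 / 2 : ℝ) + 1 / 2 * sg A v)) :=
    Pos.prod _ _ fun v _ => (Pos.const (by norm_num)).add _ _ ((Pos.sg v).smul _ _ (by norm_num))
  have hr : ∀ f : Finset α → ℝ, Zi t s a b U (fun A => f A *
      ∏ v ∈ U \ U', ((1 / 2 : ℝ) + 1 / 2 * sg A v)) = Zi t s a b U' f := by
    intro f
    simp only [plus_indicator, Zi]
    symm
    refine Finset.sum_subset_zero_on_sdiff (Finset.powerset_mono.mpr hU) ?_ ?_
    · intro A hA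
      simp only [Finset.mem_sdiff, Finset.mem_powerset] at hA
      rw [if_neg]; · simp
      intro hd
      apply hA.2
      intro v hv
      by_contra hv'
      exact Finset.disjoint_left.mp hd hv (by simp [hA.1 hv, hv'])
    · intro A hA
      rw [Finset.mem_powerset] at hA
      rw [if_pos]; · simp
      rw [Finset.disjoint_left]
      intro v hv; simp [hA hv]
  have := griffiths h0.le h1 s a b U hf hg
  rw [hr f] at this
  have h2 := hr (fun _ => 1)
  simp only [one_mul] at h2
  rw [h2] at this
  unfold Ei
  rw [div_le_div_iff₀ (Zi_one_pos h0 ..) (Zi_one_pos h0 ..)]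
  exact this

lemma Pos.zi_nonneg {t : ℝ} (h0 : 0 ≤ t) (h1 : t ≤ 1) (s : Finset ι) (a b : ι → α)
    (U : Finset α) {f : Finset α → ℝ} (hf : Pos f) : 0 ≤ Zi t s a b U f :=
  Pos.sum_nonneg ((Pos.wt h0 h1 s a b).mul hf) U

lemma Pos.ei_nonneg {t : ℝ} (h0 : 0 < t) (h1 : t ≤ 1) (s : Finset ι) (a b : ι → α)
    (U : Finset α) {f : Finset α → ℝ} (hf : Pos f) : 0 ≤ Ei t s a b U f :=
  div_nonneg (hf.zi_nonneg h0.le h1 s a b U) (Zi_one_pos h0 ..).le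

end General

section Locality
variable {α ι α' ι' : Type*} [DecidableEq α] [DecidableEq ι] [DecidableEq α'] [DecidableEq ι']

lemma wt_filter_touching {t : ℝ} (s : Finset ι) (a b : ι → α) {U A : Finset α} (hA : A ⊆ U) :
    wt t s a b A = wt t (s.filter fun i => a i ∈ U ∨ b i ∈ U) a b A := by
  unfold wt
  rw [Finset.prod_filter]
  refine Finset.prod_congr rfl fun i _ => ?_
  split_ifs with h
  · rfl
  · exact bond_of_iff ⟨fun h' => absurd (Or.inl (hA h')) h, fun h' => absurd (Or.inr (hA h')) h⟩

/-- Invariance of the unnormalised expectation under isomorphisms of the part of the graph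
that touches the free vertices. -/
lemma Zi_iso {t : ℝ} (s : Finset ι) (a b : ι → α) (U : Finset α)
    (s' : Finset ι') (a' b' : ι' → α') (U' : Finset α') (φ : α → α') (ψ : ι → ι')
    (hφ : Function.Injective φ) (hU : U' = U.image φ)
    (hψ : ∀ i ∈ s, (a i ∈ U ∨ b i ∈ U) → ∀ j ∈ s, (a j ∈ U ∨ b j ∈ U) → ψ i = ψ j → i = j)
    (hs : ∀ i ∈ s, (a i ∈ U ∨ b i ∈ U) → ψ i ∈ s')
    (hs' : ∀ i' ∈ s', (a' i' ∈ U' ∨ b' i' ∈ U') → ∃ i ∈ s, (a i ∈ U ∨ b i ∈ U) ∧ ψ i = i')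
    (he : ∀ i ∈ s, (a i ∈ U ∨ b i ∈ U) → (a' (ψ i) = φ (a i) ∧ b' (ψ i) = φ (b i)) ∨
      (a' (ψ i) = φ (b i) ∧ b' (ψ i) = φ (a i)))
    (f : Finset α → ℝ) (f' : Finset α' → ℝ) (hf : ∀ A ⊆ U, f' (A.image φ) = f A) :
    Zi t s' a' b' U' f' = Zi t s a b U f := by
  have hmem : ∀ (A : Finset α) (v : α), φ v ∈ A.image φ ↔ v ∈ A := fun A v => by
    simp [hφ.eq_iff]
  subst hU
  symm
  unfold Zi
  refine Finset.sum_bij (fun A _ => A.image φ) ?_ ?_ ?_ ?_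
  · intro A hA
    rw [Finset.mem_powerset] at *
    exact Finset.image_subset_image hA
  · intro A _ B _ h
    exact Finset.image_injective hφ h
  · intro B hB
    rw [Finset.mem_powerset] at hB
    obtain ⟨A, hA, rfl⟩ := Finset.subset_image_iff.mp hB
    exact ⟨A, by simpa using hA, rfl⟩
  · intro A hA
    rw [Finset.mem_powerset] at hA
    rw [hf A hA, wt_filter_touching s a b hA,
      wt_filter_touching s' a' b' (Finset.image_subset_image (f := φ) hA)]
    congr 1
    unfold wt
    refine Finset.prod_bij (fun i _ => ψ i) ?_ ?_ ?_ ?_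
    · intro i hi
      rw [Finset.mem_filter] at hi ⊢
      refine ⟨hs i hi.1 hi.2, ?_⟩
      rcases he i hi.1 hi.2 with h | h <;> rw [h.1, h.2, hmem, hmem]
      · exact hi.2
      · exact hi.2.symm
    · intro i hi j hj h
      rw [Finset.mem_filter] at hi hj
      exact hψ i hi.1 hi.2 j hj.1 hj.2 h
    · intro i' hi'
      rw [Finset.mem_filter] at hi'
      obtain ⟨i, h1, h2, h3⟩ := hs' i' hi'.1 hi'.2
      exact ⟨i, Finset.mem_filter.mpr ⟨h1, h2⟩, h3⟩
    · intro i hi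
      rw [Finset.mem_filter] at hi
      apply bond_congr
      rcases he i hi.1 hi.2 with h | h <;> rw [h.1, h.2, hmem, hmem]
      exact Iff.comm

lemma Ei_sg_iso {t : ℝ} (s : Finset ι) (a b : ι → α) (U : Finset α)
    (s' : Finset ι') (a' b' : ι' → α') (U' : Finset α') (φ : α → α') (ψ : ι → ι')
    (hφ : Function.Injective φ) (hU : U' = U.image φ)
    (hψ : ∀ i ∈ s, (a i ∈ U ∨ b i ∈ U) → ∀ j ∈ s, (a j ∈ U ∨ b j ∈ U) → ψ i = ψ j → i = j)
    (hs : ∀ i ∈ s, (a i ∈ U ∨ b i ∈ U) → ψ i ∈ s')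
    (hs' : ∀ i' ∈ s', (a' i' ∈ U' ∨ b' i' ∈ U') → ∃ i ∈ s, (a i ∈ U ∨ b i ∈ U) ∧ ψ i = i')
    (he : ∀ i ∈ s, (a i ∈ U ∨ b i ∈ U) → (a' (ψ i) = φ (a i) ∧ b' (ψ i) = φ (b i)) ∨
      (a' (ψ i) = φ (b i) ∧ b' (ψ i) = φ (a i))) (v : α) :
    Ei t s' a' b' U' (fun A => sg A (φ v)) = Ei t s a b U (fun A => sg A v) := by
  unfold Ei
  rw [Zi_iso s a b U s' a' b' U' φ ψ hφ hU hψ hs hs' he (fun A => sg A v) _ fun A _ => ?_,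
    Zi_iso s a b U s' a' b' U' φ ψ hφ hU hψ hs hs' he (fun _ => 1) _ fun A _ => rfl]
  simp [sg, hφ.eq_iff]

/-- The unnormalised expectation factorises over non-adjacent domains. -/
lemma Zi_union {t : ℝ} (s : Finset ι) (a b : ι → α) (U₁ U₂ : Finset α) (hd : Disjoint U₁ U₂)
    (h12 : ∀ i ∈ s, ¬ (a i ∈ U₁ ∧ b i ∈ U₂)) (h21 : ∀ i ∈ s, ¬ (a i ∈ U₂ ∧ b i ∈ U₁))
    (f g : Finset α → ℝ) (hf : ∀ A₁ ⊆ U₁, ∀ A₂ ⊆ U₂, f (A₁ ∪ A₂) = f A₁)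
    (hg : ∀ A₁ ⊆ U₁, ∀ A₂ ⊆ U₂, g (A₁ ∪ A₂) = g A₂) :
    Zi t s a b (U₁ ∪ U₂) (fun A => f A * g A) = Zi t s a b U₁ f * Zi t s a b U₂ g := by
  have hdd := Finset.disjoint_left.mp hd
  unfold Zi
  rw [Finset.sum_mul_sum, ← Finset.sum_product']
  symm
  refine Finset.sum_nbij' (fun A => A.1 ∪ A.2) (fun A => (A ∩ U₁, A ∩ U₂)) ?_ ?_ ?_ ?_ ?_
  · rintro ⟨A₁, A₂⟩ h
    simp only [Finset.mem_product, Finset.mem_powerset] at h ⊢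
    exact Finset.union_subset_union h.1 h.2
  · intro A _
    simp only [Finset.mem_product, Finset.mem_powerset]
    exact ⟨Finset.inter_subset_right, Finset.inter_subset_right⟩
  · rintro ⟨A₁, A₂⟩ h
    simp only [Finset.mem_product, Finset.mem_powerset] at h
    ext v
    · simp only [Finset.mem_inter, Finset.mem_union]
      exact ⟨fun h' => h'.1.resolve_right fun h'' => hdd h'.2 (h.2 h''), fun h' => ⟨Or.inl h', h.1 h'⟩⟩
    · simp only [Finset.mem_inter, Finset.mem_union]
      exact ⟨fun h' => h'.1.resolve_left fun h'' => hdd (h.1 h'') h'.2, fun h' => ⟨Or.inr h', h.2 h'⟩⟩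
  · intro A h
    rw [Finset.mem_powerset] at h
    simp only
    rw [← Finset.inter_union_distrib_left]
    exact Finset.inter_eq_left.mpr h
  · rintro ⟨A₁, A₂⟩ h
    simp only [Finset.mem_product, Finset.mem_powerset] at h
    simp only
    rw [hf _ h.1 _ h.2, hg _ h.1 _ h.2]
    have : wt t s a b (A₁ ∪ A₂) = wt t s a b A₁ * wt t s a b A₂ := by
      unfold wt
      rw [← Finset.prod_mul_distrib]
      refine Finset.prod_congr rfl fun i hi => ?_
      have key : ∀ (B₁ B₂ : Finset α) (u v : α), u ∉ B₂ → v ∉ B₂ →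
          bond t (B₁ ∪ B₂) u v = bond t B₁ u v * bond t B₂ u v := by
        intro B₁ B₂ u v h1 h2
        rw [bond_of_iff (A := B₂) (by tauto), mul_one]
        exact bond_congr (by simp [h1, h2])
      have f1 := @h.1 (a i)
      have f2 := @h.1 (b i)
      have f3 := @h.2 (a i)
      have f4 := @h.2 (b i)
      have f5 := @hdd (a i)
      have f6 := @hdd (b i)
      by_cases g : a i ∈ A₁ ∨ b i ∈ A₁
      · exact key A₁ A₂ _ _ (by tauto) (by tauto)
      · rw [Finset.union_comm, mul_comm]
        exact key A₂ A₁ _ _ (by tauto) (by tauto)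
    rw [this]; ring

lemma sg_union_left {A B : Finset α} {v : α} (h : v ∉ B) : sg (A ∪ B) v = sg A v := by
  simp [sg, h]

lemma sg_union_right {A B : Finset α} {v : α} (h : v ∉ A) : sg (A ∪ B) v = sg B v := by
  simp [sg, h]

lemma Ei_biUnion {t : ℝ} {κ : Type*} (s : Finset ι) (a b : ι → α) (J : Finset κ)
    (U : κ → Finset α) (x : κ → α)
    (hd : ∀ i ∈ J, ∀ j ∈ J, i ≠ j → Disjoint (U i) (U j))
    (he : ∀ e ∈ s, ∀ i ∈ J, ∀ j ∈ J, i ≠ j → ¬ (a e ∈ U i ∧ b e ∈ U j))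
    (hx : ∀ i ∈ J, ∀ j ∈ J, i ≠ j → x i ∉ U j) :
    Ei t s a b (J.biUnion U) (fun A => ∏ j ∈ J, sg A (x j)) =
      ∏ j ∈ J, Ei t s a b (U j) (fun A => sg A (x j)) := by
  have main : ∀ F : κ → Finset α → ℝ, ((∀ i, F i = fun A => sg A (x i)) ∨ (∀ i, F i = fun _ => 1)) →
      Zi t s a b (J.biUnion U) (fun A => ∏ j ∈ J, F j A) = ∏ j ∈ J, Zi t s a b (U j) (F j) := by
    intro F hF
    induction J using Finset.induction_on with
    | empty => simp [Zi, wt, bond]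
    | insert i J hi ih =>
      have hne : ∀ j ∈ J, i ≠ j := fun j hj h => hi (h ▸ hj)
      rw [Finset.biUnion_insert, Finset.prod_insert hi]
      simp only [Finset.prod_insert hi]
      rw [Zi_union s a b (U i) (J.biUnion U) _ _ _ (F i) (fun A => ∏ j ∈ J, F j A), ih]
      · exact fun i hi j hj => hd i (by simp [hi]) j (by simp [hj])
      · exact fun e h i hi j hj => he e h i (by simp [hi]) j (by simp [hj])
      · exact fun i hi j hj => hx i (by simp [hi]) j (by simp [hj])
      · intro A₁ _ A₂ h2
        rcases hF with h | h <;> simp only [h]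
        refine sg_union_left fun h' => ?_
        obtain ⟨j, hj, h''⟩ := Finset.mem_biUnion.mp (h2 h')
        exact hx i (by simp) j (by simp [hj]) (hne j hj) h''
      · intro A₁ h1 A₂ _
        rcases hF with h | h <;> simp only [h]
        refine Finset.prod_congr rfl fun j hj => sg_union_right fun h' => ?_
        exact hx j (by simp [hj]) i (by simp) (hne j hj).symm (h1 h')
      · rw [Finset.disjoint_biUnion_right]
        exact fun j hj => hd i (by simp) j (by simp [hj]) (hne j hj)
      · rintro e h ⟨h1, h2⟩
        obtain ⟨j, hj, h''⟩ := Finset.mem_biUnion.mp h2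
        exact he e h i (by simp) j (by simp [hj]) (hne j hj) ⟨h1, h''⟩
      · rintro e h ⟨h1, h2⟩
        obtain ⟨j, hj, h''⟩ := Finset.mem_biUnion.mp h1
        exact he e h j (by simp [hj]) i (by simp) (hne j hj).symm ⟨h'', h2⟩
  unfold Ei
  rw [Finset.prod_div_distrib, ← main _ (Or.inl fun _ => rfl), ← main _ (Or.inr fun _ => rfl)]
  simp

end Locality

section FK
variable {α ι : Type*} [DecidableEq α] [DecidableEq ι]

lemma sum_powerset_union {β M : Type*} [DecidableEq β] [AddCommMonoid M] {U₁ U₂ : Finset β}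
    (hd : Disjoint U₁ U₂) (F : Finset β → M) :
    ∑ A ∈ (U₁ ∪ U₂).powerset, F A = ∑ A₁ ∈ U₁.powerset, ∑ A₂ ∈ U₂.powerset, F (A₁ ∪ A₂) := by
  have hdd := Finset.disjoint_left.mp hd
  rw [← Finset.sum_product']
  symm
  refine Finset.sum_nbij' (fun A => A.1 ∪ A.2) (fun A => (A ∩ U₁, A ∩ U₂)) ?_ ?_ ?_ ?_ ?_
  · rintro ⟨A₁, A₂⟩ h
    simp only [Finset.mem_product, Finset.mem_powerset] at h ⊢
    exact Finset.union_subset_union h.1 h.2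
  · intro A _
    simp only [Finset.mem_product, Finset.mem_powerset]
    exact ⟨Finset.inter_subset_right, Finset.inter_subset_right⟩
  · rintro ⟨A₁, A₂⟩ h
    simp only [Finset.mem_product, Finset.mem_powerset] at h
    ext v
    · simp only [Finset.mem_inter, Finset.mem_union]
      exact ⟨fun h' => h'.1.resolve_right fun h'' => hdd h'.2 (h.2 h''), fun h' => ⟨Or.inl h', h.1 h'⟩⟩
    · simp only [Finset.mem_inter, Finset.mem_union]
      exact ⟨fun h' => h'.1.resolve_left fun h'' => hdd (h.1 h'') h'.2, fun h' => ⟨Or.inr h', h.2 h'⟩⟩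
  · intro A h
    rw [Finset.mem_powerset] at h
    simp only
    rw [← Finset.inter_union_distrib_left]
    exact Finset.inter_eq_left.mpr h
  · intro _ _; rfl

/-- The configuration `A` is constant along the edges of `ω`. -/
def Compat (a b : ι → α) (ω : Finset ι) (A : Finset α) : Prop := ∀ i ∈ ω, (a i ∈ A ↔ b i ∈ A)

/-- The number of configurations in `U` compatible with `ω`. -/
def Nf (a b : ι → α) (U : Finset α) (ω : Finset ι) : ℕ :=
  (U.powerset.filter (Compat a b ω)).card

/-- The vertices that are plus in every configuration in `U` compatible with `ω`. -/
def Wf (a b : ι → α) (U : Finset α) (ω : Finset ι) : Set α :=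
  {v | ∀ A ⊆ U, Compat a b ω A → v ∉ A}

/-- The unnormalised random-cluster weight. -/
def muf (y : ℝ) (a b : ι → α) (U : Finset α) (ω : Finset ι) : ℝ := y ^ ω.card * Nf a b U ω

lemma Compat.empty (a b : ι → α) (ω : Finset ι) : Compat a b ω ∅ := fun i _ => by simp

lemma Compat.mono {a b : ι → α} {ω ω' : Finset ι} (h : ω ⊆ ω') {A : Finset α}
    (hA : Compat a b ω' A) : Compat a b ω A := fun i hi => hA i (h hi)

lemma Compat.symmDiff {a b : ι → α} {ω : Finset ι} {A A' : Finset α}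
    (hA : Compat a b ω A) (hA' : Compat a b ω A') : Compat a b ω (symmDiff A A') := fun i hi => by
  have := hA i hi
  have := hA' i hi
  simp only [Finset.mem_symmDiff]; tauto

lemma Compat.union {a b : ι → α} {ω ω' : Finset ι} {A : Finset α} (h : Compat a b ω A)
    (h' : Compat a b ω' A) : Compat a b (ω ∪ ω') A := fun i hi =>
  (Finset.mem_union.mp hi).elim (h i) (h' i)

lemma Wf_mono (a b : ι → α) (U : Finset α) {ω ω' : Finset ι} (h : ω ⊆ ω') :
    Wf a b U ω ⊆ Wf a b U ω' := fun _ hv A hA hc => hv A hA (hc.mono h)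

lemma mem_Wf_of_notMem (a b : ι → α) {U : Finset α} (ω : Finset ι) {v : α} (h : v ∉ U) :
    v ∈ Wf a b U ω := fun _ hA _ hv => h (hA hv)

lemma mem_Wf_iff_of_edge {a b : ι → α} {U : Finset α} {ω : Finset ι} {i : ι} (h : i ∈ ω) :
    a i ∈ Wf a b U ω ↔ b i ∈ Wf a b U ω :=
  ⟨fun hv A hA hc hb => hv A hA hc ((hc i h).mpr hb),
    fun hv A hA hc hb => hv A hA hc ((hc i h).mp hb)⟩

lemma muf_nonneg {y : ℝ} (hy : 0 ≤ y) (a b : ι → α) (U : Finset α) (ω : Finset ι) :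
    0 ≤ muf y a b U ω := by unfold muf; positivity

lemma wt_eq_sum {t : ℝ} (h0 : 0 < t) (s : Finset ι) (a b : ι → α) (A : Finset α) :
    wt t s a b A = t ^ s.card * ∑ ω ∈ s.powerset,
      if Compat a b ω A then ((1 - t) / t) ^ ω.card else 0 := by
  have h : ∀ i, bond t A (a i) (b i) = (t * if (a i ∈ A ↔ b i ∈ A) then (1 - t) / t else 0) + t := by
    intro i
    unfold bond
    split_ifs
    · rw [mul_div_cancel₀ _ h0.ne']; ring
    · ring
  unfold wt
  simp only [h]
  rw [Finset.prod_add, Finset.mul_sum]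
  refine Finset.sum_congr rfl fun ω hω => ?_
  rw [Finset.mem_powerset] at hω
  rw [Finset.prod_mul_distrib, Finset.prod_const, Finset.prod_const, Finset.prod_ite_zero,
    Finset.card_sdiff_of_subset hω, ← Nat.sub_add_cancel (Finset.card_le_card hω), pow_add]
  simp only [Nat.sub_add_cancel (Finset.card_le_card hω), Finset.prod_const, Compat]
  ring_nf

lemma sum_sg_compat (a b : ι → α) (U : Finset α) (ω : Finset ι) (v : α) :
    ∑ A ∈ U.powerset, (if Compat a b ω A then sg A v else 0) =
      if v ∈ Wf a b U ω then (Nf a b U ω : ℝ) else 0 := by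
  rw [← Finset.sum_filter]
  split_ifs with h
  · unfold Nf
    rw [Finset.card_eq_sum_ones, Nat.cast_sum]
    refine Finset.sum_congr rfl fun A hA => ?_
    simp only [Finset.mem_filter, Finset.mem_powerset] at hA
    rw [sg_of_notMem (h A hA.1 hA.2)]; simp
  · simp only [Wf, Set.mem_ofPred_eq, not_forall, not_not] at h
    obtain ⟨T, hT, hc, hv⟩ := h
    have : ∑ A ∈ U.powerset.filter (Compat a b ω), sg A v =
        ∑ A ∈ U.powerset.filter (Compat a b ω), - sg A v := by
      refine Finset.sum_nbij' (fun A => symmDiff A T) (fun A => symmDiff A T) ?_ ?_ ?_ ?_ ?_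
      · intro A hA
        rw [Finset.mem_filter] at hA ⊢
        exact ⟨symmDiff_mem_powerset hA.1 (by simpa using hT), hA.2.symmDiff hc⟩
      · intro A hA
        rw [Finset.mem_filter] at hA ⊢
        exact ⟨symmDiff_mem_powerset hA.1 (by simpa using hT), hA.2.symmDiff hc⟩
      · intro A _; simp
      · intro A _; simp
      · intro A _
        rw [sg_symmDiff, sg_of_mem hv]; ring
    rw [Finset.sum_neg_distrib] at this
    linarith

/-- Edwards–Sokal representation of the magnetisation. -/
lemma Zi_sg_eq {t : ℝ} (h0 : 0 < t) (s : Finset ι) (a b : ι → α) (U : Finset α) (v : α) :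
    Zi t s a b U (fun A => sg A v) = t ^ s.card *
      ∑ ω ∈ s.powerset, if v ∈ Wf a b U ω then muf ((1 - t) / t) a b U ω else 0 := by
  unfold Zi
  simp only [wt_eq_sum h0, mul_assoc, ← Finset.mul_sum, Finset.sum_mul]
  rw [Finset.sum_comm]
  congr 1
  refine Finset.sum_congr rfl fun ω _ => ?_
  have := sum_sg_compat a b U ω v
  calc _ = ((1 - t) / t) ^ ω.card * ∑ A ∈ U.powerset, (if Compat a b ω A then sg A v else 0) := by
        rw [Finset.mul_sum]
        refine Finset.sum_congr rfl fun A _ => ?_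
        split_ifs <;> ring
    _ = _ := by
        rw [this]; unfold muf; split_ifs <;> ring

lemma Zi_one_eq {t : ℝ} (h0 : 0 < t) (s : Finset ι) (a b : ι → α) (U : Finset α) :
    Zi t s a b U (fun _ => 1) = t ^ s.card *
      ∑ ω ∈ s.powerset, muf ((1 - t) / t) a b U ω := by
  unfold Zi
  simp only [wt_eq_sum h0, mul_assoc, ← Finset.mul_sum, Finset.sum_mul]
  rw [Finset.sum_comm]
  congr 1
  refine Finset.sum_congr rfl fun ω _ => ?_
  simp only [mul_one]
  rw [← Finset.sum_filter, Finset.sum_const, nsmul_eq_mul, muf, mul_comm]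
  rfl

lemma Nf_mul_le (a b : ι → α) (U : Finset α) (ω ω' : Finset ι) :
    Nf a b U ω * Nf a b U ω' ≤ Nf a b U (ω ∩ ω') * Nf a b U (ω ∪ ω') := by
  rw [mul_comm (Nf a b U (ω ∩ ω'))]
  unfold Nf
  rw [← Finset.card_product]
  refine Finset.card_le_mul_card_image_of_maps_to (f := fun p => symmDiff p.1 p.2) ?_ _ ?_
  · rintro ⟨A, A'⟩ h
    simp only [Finset.mem_product, Finset.mem_filter] at h ⊢
    exact ⟨symmDiff_mem_powerset h.1.1 h.2.1, (h.1.2.mono Finset.inter_subset_left).symmDiff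
      (h.2.2.mono Finset.inter_subset_right)⟩
  · intro T _
    rcases Finset.eq_empty_or_nonempty ((U.powerset.filter (Compat a b ω) ×ˢ
      U.powerset.filter (Compat a b ω')).filter fun p => symmDiff p.1 p.2 = T) with h | ⟨⟨B, B'⟩, hB⟩
    · rw [h]; simp
    · simp only [Finset.mem_product, Finset.mem_filter] at hB
      refine Finset.card_le_card_of_injOn (fun p => symmDiff p.1 B) ?_ ?_
      · rintro ⟨A, A'⟩ h
        simp only [Finset.coe_filter, Finset.mem_product, Finset.mem_filter, Set.mem_ofPred_eq] at h ⊢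
        refine ⟨symmDiff_mem_powerset h.1.1.1 hB.1.1.1, (h.1.1.2.symmDiff hB.1.1.2).union ?_⟩
        have e : symmDiff A B = symmDiff A' B' := by
          have := h.2.trans hB.2.symm
          calc symmDiff A B = symmDiff A' (symmDiff (symmDiff A A') B) := by
                rw [symmDiff_comm A A', symmDiff_assoc, symmDiff_symmDiff_cancel_left]
            _ = symmDiff A' B' := by
                rw [this, symmDiff_comm B B', symmDiff_assoc, symmDiff_self]; simp
        rw [e]
        exact h.1.2.2.symmDiff hB.1.2.2
      · rintro ⟨A, A'⟩ h ⟨D, D'⟩ h' hE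
        simp only [Finset.coe_filter, Finset.mem_product, Finset.mem_filter, Set.mem_ofPred_eq] at h h'
        have e : A = D := symmDiff_left_injective B hE
        subst e
        have := h.2.trans h'.2.symm
        rw [symmDiff_right_injective A this]

lemma muf_mul_le {y : ℝ} (hy : 0 ≤ y) (a b : ι → α) (U : Finset α) (ω ω' : Finset ι) :
    muf y a b U ω * muf y a b U ω' ≤ muf y a b U (ω ∩ ω') * muf y a b U (ω ∪ ω') := by
  unfold muf
  have h1 : y ^ ω.card * y ^ ω'.card = y ^ (ω ∩ ω').card * y ^ (ω ∪ ω').card := by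
    rw [← pow_add, ← pow_add, add_comm (ω ∩ ω').card, Finset.card_union_add_card_inter]
  have h2 : (Nf a b U ω : ℝ) * Nf a b U ω' ≤ Nf a b U (ω ∩ ω') * Nf a b U (ω ∪ ω') := by
    exact_mod_cast Nf_mul_le a b U ω ω'
  calc _ = (y ^ ω.card * y ^ ω'.card) * ((Nf a b U ω : ℝ) * Nf a b U ω') := by ring
    _ ≤ (y ^ ω.card * y ^ ω'.card) * (Nf a b U (ω ∩ ω') * Nf a b U (ω ∪ ω')) := by gcongr
    _ = _ := by rw [h1]; ring

/-- Positive association for increasing events. -/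
lemma fkg_increasing {y : ℝ} (hy : 0 ≤ y) (s : Finset ι) (a b : ι → α) (U : Finset α)
    (P Q : Finset ι → Prop) (hP : ∀ ω ω', ω ⊆ ω' → P ω → P ω')
    (hQ : ∀ ω ω', ω ⊆ ω' → Q ω → Q ω') :
    (∑ ω ∈ s.powerset, if P ω then muf y a b U ω else 0) *
      (∑ ω ∈ s.powerset, if Q ω then muf y a b U ω else 0) ≤
    (∑ ω ∈ s.powerset, muf y a b U ω) *
      ∑ ω ∈ s.powerset, if P ω ∧ Q ω then muf y a b U ω else 0 := by
  have n : ∀ P : Finset ι → Prop, 0 ≤ fun ω => if P ω then muf y a b U ω else 0 := fun P ω => by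
    show (0 : ℝ) ≤ ite _ _ _
    split_ifs <;> [exact muf_nonneg hy a b U ω; rfl]
  have := Finset.four_functions_theorem s (n P) (n Q) (f₃ := fun ω => muf y a b U ω)
    (fun ω => muf_nonneg hy a b U ω) (n fun ω => P ω ∧ Q ω) ?_ (Finset.Subset.refl _)
    (Finset.Subset.refl _)
  · simp only [Finset.powerset_sups_powerset_self, Finset.powerset_infs_powerset_self] at this
    exact this.trans (le_of_eq (by congr!))
  · intro ω _ ω' _
    have h := muf_mul_le hy a b U ω ω'
    have h' := mul_nonneg (muf_nonneg hy a b U (ω ∩ ω')) (muf_nonneg hy a b U (ω ∪ ω'))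
    have e1 := hP ω (ω ∪ ω') Finset.subset_union_left
    have e2 := hQ ω' (ω ∪ ω') Finset.subset_union_right
    have h'' := muf_nonneg hy a b U (ω ∩ ω')
    split_ifs with c1 c2 c3 c3 <;> simp <;> first | exact h | exact h' | tauto

/-- Positive association for decreasing events. -/
lemma fkg_decreasing {y : ℝ} (hy : 0 ≤ y) (s : Finset ι) (a b : ι → α) (U : Finset α)
    (P Q : Finset ι → Prop) (hP : ∀ ω ω', ω ⊆ ω' → P ω' → P ω)
    (hQ : ∀ ω ω', ω ⊆ ω' → Q ω' → Q ω) :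
    (∑ ω ∈ s.powerset, if P ω then muf y a b U ω else 0) *
      (∑ ω ∈ s.powerset, if Q ω then muf y a b U ω else 0) ≤
    (∑ ω ∈ s.powerset, if P ω ∧ Q ω then muf y a b U ω else 0) *
      (∑ ω ∈ s.powerset, muf y a b U ω) := by
  have n : ∀ P : Finset ι → Prop, 0 ≤ fun ω => if P ω then muf y a b U ω else 0 := fun P ω => by
    show (0 : ℝ) ≤ ite _ _ _
    split_ifs <;> [exact muf_nonneg hy a b U ω; rfl]
  have := Finset.four_functions_theorem s (n P) (n Q) (f₄ := fun ω => muf y a b U ω)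
    (n fun ω => P ω ∧ Q ω) (fun ω => muf_nonneg hy a b U ω) ?_ (Finset.Subset.refl _)
    (Finset.Subset.refl _)
  · simp only [Finset.powerset_sups_powerset_self, Finset.powerset_infs_powerset_self] at this
    exact this.trans (le_of_eq (by congr!))
  · intro ω _ ω' _
    have h := muf_mul_le hy a b U ω ω'
    have h' := mul_nonneg (muf_nonneg hy a b U (ω ∩ ω')) (muf_nonneg hy a b U (ω ∪ ω'))
    have e1 := hP (ω ∩ ω') ω Finset.inter_subset_left
    have e2 := hQ (ω ∩ ω') ω' Finset.inter_subset_right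
    have h'' := muf_nonneg hy a b U (ω ∪ ω')
    split_ifs with c1 c2 c3 c3 <;> simp <;> first | exact h | exact h' | tauto

end FK

section Cluster
variable {α ι : Type*} [DecidableEq α] [DecidableEq ι]

/-- Adjacency in the graph with edge set `s`. -/
def Adjf (s : Finset ι) (a b : ι → α) (u v : α) : Prop :=
  ∃ i ∈ s, (a i = u ∧ b i = v) ∨ (a i = v ∧ b i = u)

/-- Reachability from `B` inside `X`. -/
inductive Rch (s : Finset ι) (a b : ι → α) (B : Finset α) (X : α → Prop) : α → Prop
  | base (v : α) : v ∈ B → X v → Rch s a b B X v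
  | step (u v : α) : Rch s a b B X u → Adjf s a b u v → X v → Rch s a b B X v

lemma Rch.prop {s : Finset ι} {a b : ι → α} {B : Finset α} {X : α → Prop} {v : α}
    (h : Rch s a b B X v) : X v := by cases h <;> assumption

lemma Rch.mono {s : Finset ι} {a b : ι → α} {B : Finset α} {X Y : α → Prop}
    (hXY : ∀ v, X v → Y v) {v : α} (h : Rch s a b B X v) : Rch s a b B Y v := by
  induction h with
  | base v h h' => exact .base v h (hXY v h')
  | step u v _ h h' ih => exact .step u v ih h (hXY v h')

/-- The part of the complement of the plus clusters that is connected to `B`. -/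
def Cf (s : Finset ι) (a b : ι → α) (B U : Finset α) (ω : Finset ι) : Finset α :=
  U.filter (Rch s a b B fun v => v ∈ U ∧ v ∉ Wf a b U ω)

lemma mem_Cf {s : Finset ι} {a b : ι → α} {B U : Finset α} {ω : Finset ι} {v : α} :
    v ∈ Cf s a b B U ω ↔ Rch s a b B (fun v => v ∈ U ∧ v ∉ Wf a b U ω) v := by
  unfold Cf
  rw [Finset.mem_filter]
  exact ⟨fun h => h.2, fun h => ⟨h.prop.1, h⟩⟩

variable (s : Finset ι) (a b : ι → α) (B U C₀ : Finset α)

/-- The vertices of `U` that bound `C₀` or lie in `B`, outside `C₀`. -/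
def Kf : Finset α := (U \ C₀).filter fun v => v ∈ B ∨ ∃ u ∈ C₀, Adjf s a b u v

/-- Edges inside `C₀`. -/
def sIn : Finset ι := s.filter fun i => a i ∈ C₀ ∧ b i ∈ C₀

/-- Edges away from `C₀`. -/
def sOut : Finset ι := s.filter fun i => a i ∉ C₀ ∧ b i ∉ C₀

lemma disjoint_sIn_sOut : Disjoint (sIn s a b C₀) (sOut s a b C₀) := by
  rw [Finset.disjoint_left]; intro i; simp only [sIn, sOut, Finset.mem_filter]; tauto

variable {s a b B U C₀}

lemma compat_union_iff {ω₁ ω₂ : Finset ι} (h₁ : ω₁ ⊆ sIn s a b C₀) (h₂ : ω₂ ⊆ sOut s a b C₀)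
    {A₁ A₂ : Finset α} (hA₁ : A₁ ⊆ C₀) (hA₂ : A₂ ⊆ U \ C₀) :
    Compat a b (ω₁ ∪ ω₂) (A₁ ∪ A₂) ↔ Compat a b ω₁ A₁ ∧ Compat a b ω₂ A₂ := by
  have n1 : ∀ v, v ∈ C₀ → v ∉ A₂ := fun v hv h => (Finset.mem_sdiff.mp (hA₂ h)).2 hv
  have n2 : ∀ v, v ∉ C₀ → v ∉ A₁ := fun v hv h => hv (hA₁ h)
  have e1 : ∀ i ∈ ω₁, ((a i ∈ A₁ ∪ A₂ ↔ b i ∈ A₁ ∪ A₂) ↔ (a i ∈ A₁ ↔ b i ∈ A₁)) := by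
    intro i hi
    have := h₁ hi
    simp only [sIn, Finset.mem_filter] at this
    simp [n1 _ this.2.1, n1 _ this.2.2]
  have e2 : ∀ i ∈ ω₂, ((a i ∈ A₁ ∪ A₂ ↔ b i ∈ A₁ ∪ A₂) ↔ (a i ∈ A₂ ↔ b i ∈ A₂)) := by
    intro i hi
    have := h₂ hi
    simp only [sOut, Finset.mem_filter] at this
    simp [n2 _ this.2.1, n2 _ this.2.2]
  unfold Compat
  constructor
  · exact fun h => ⟨fun i hi => (e1 i hi).mp (h i (Finset.mem_union_left _ hi)),
      fun i hi => (e2 i hi).mp (h i (Finset.mem_union_right _ hi))⟩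
  · rintro ⟨h, h'⟩ i hi
    rcases Finset.mem_union.mp hi with hi | hi
    · exact (e1 i hi).mpr (h i hi)
    · exact (e2 i hi).mpr (h' i hi)

lemma Nf_union {ω₁ ω₂ : Finset ι} (h₁ : ω₁ ⊆ sIn s a b C₀) (h₂ : ω₂ ⊆ sOut s a b C₀)
    (hC : C₀ ⊆ U) : Nf a b U (ω₁ ∪ ω₂) = Nf a b C₀ ω₁ * Nf a b (U \ C₀) ω₂ := by
  unfold Nf
  simp only [Finset.card_filter]
  rw [Finset.sum_mul_sum]
  conv_lhs => rw [← Finset.union_sdiff_of_subset hC]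
  rw [sum_powerset_union Finset.disjoint_sdiff]
  refine Finset.sum_congr rfl fun A₁ hA₁ => Finset.sum_congr rfl fun A₂ hA₂ => ?_
  rw [Finset.mem_powerset] at hA₁ hA₂
  simp only [compat_union_iff h₁ h₂ hA₁ hA₂]
  by_cases p : Compat a b ω₁ A₁ <;> by_cases q : Compat a b ω₂ A₂ <;> simp [p, q]

lemma mem_Wf_union_iff {ω₁ ω₂ : Finset ι} (h₁ : ω₁ ⊆ sIn s a b C₀) (h₂ : ω₂ ⊆ sOut s a b C₀)
    (hC : C₀ ⊆ U) {v : α} (hv : v ∉ C₀) :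
    v ∈ Wf a b U (ω₁ ∪ ω₂) ↔ v ∈ Wf a b (U \ C₀) ω₂ := by
  constructor
  · intro h A hA hc hvA
    refine h (∅ ∪ A) ?_ ((compat_union_iff h₁ h₂ (by simp) hA).mpr ⟨Compat.empty a b ω₁, hc⟩)
      (by simp [hvA])
    simp only [Finset.empty_union]
    exact hA.trans Finset.sdiff_subset
  · intro h A hA hc hvA
    have e : A = (A ∩ C₀) ∪ (A ∩ (U \ C₀)) := by
      rw [← Finset.inter_union_distrib_left, Finset.union_sdiff_of_subset hC,
        Finset.inter_eq_left.mpr hA]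
    rw [e, compat_union_iff h₁ h₂ Finset.inter_subset_right Finset.inter_subset_right] at hc
    exact h _ Finset.inter_subset_right hc.2 (by simp [hvA, hv, hA hvA])

lemma notMem_Wf_union {ω₁ ω₂ : Finset ι} (h₁ : ω₁ ⊆ sIn s a b C₀) (h₂ : ω₂ ⊆ sOut s a b C₀)
    (hC : C₀ ⊆ U) {v : α} (hv : v ∈ C₀) : v ∉ Wf a b U (ω₁ ∪ ω₂) := by
  intro h
  refine h (C₀ ∪ ∅) (by simpa using hC) ((compat_union_iff (U := U) h₁ h₂ (Finset.Subset.refl _)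
    (by simp)).mpr ⟨fun i hi => ?_, Compat.empty a b ω₂⟩) (by simp [hv])
  have := h₁ hi
  simp only [sIn, Finset.mem_filter] at this
  tauto

/-- Explicit description of the event `Cf ω = C₀`. -/
lemma Cf_eq_iff (hC : C₀ ⊆ U) {ω : Finset ι} (hω : ω ⊆ s) :
    Cf s a b B U ω = C₀ ↔
      (∀ v ∈ C₀, Rch s a b B (· ∈ C₀) v) ∧ ω ⊆ sIn s a b C₀ ∪ sOut s a b C₀ ∧
      ∀ v ∈ Kf s a b B U C₀, v ∈ Wf a b (U \ C₀) (ω ∩ sOut s a b C₀) := by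
  have split : ω ⊆ sIn s a b C₀ ∪ sOut s a b C₀ →
      ω = (ω ∩ sIn s a b C₀) ∪ (ω ∩ sOut s a b C₀) := fun h => by
    rw [← Finset.inter_union_distrib_left, Finset.inter_eq_left.mpr h]
  constructor
  · rintro rfl
    have hK : ∀ v ∈ Kf s a b B U (Cf s a b B U ω), v ∈ Wf a b U ω := by
      intro v hv
      simp only [Kf, Finset.mem_filter, Finset.mem_sdiff] at hv
      by_contra hW
      apply hv.1.2
      rw [mem_Cf]
      rcases hv.2 with h | ⟨u, hu, huv⟩
      · exact .base v h ⟨hv.1.1, hW⟩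
      · exact .step u v (mem_Cf.mp hu) huv ⟨hv.1.1, hW⟩
    have hCW : ∀ v ∈ Cf s a b B U ω, v ∉ Wf a b U ω := fun v hv => (mem_Cf.mp hv).prop.2
    have hbd : ∀ u ∈ Cf s a b B U ω, ∀ v ∉ Cf s a b B U ω, Adjf s a b u v → v ∈ Wf a b U ω := by
      intro u hu v hv huv
      by_cases hvU : v ∈ U
      · exact hK v (by simp only [Kf, Finset.mem_filter, Finset.mem_sdiff]
                       exact ⟨⟨hvU, hv⟩, Or.inr ⟨u, hu, huv⟩⟩)
      · exact mem_Wf_of_notMem a b ω hvU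
    have hsub : ω ⊆ sIn s a b (Cf s a b B U ω) ∪ sOut s a b (Cf s a b B U ω) := by
      intro i hi
      simp only [sIn, sOut, Finset.mem_union, Finset.mem_filter]
      have hs := hω hi
      have hW := mem_Wf_iff_of_edge (a := a) (b := b) (U := U) hi
      by_cases ha : a i ∈ Cf s a b B U ω <;> by_cases hb : b i ∈ Cf s a b B U ω
      · tauto
      · exact absurd (hW.mpr (hbd _ ha _ hb ⟨i, hs, Or.inl ⟨rfl, rfl⟩⟩)) (hCW _ ha)
      · exact absurd (hW.mp (hbd _ hb _ ha ⟨i, hs, Or.inr ⟨rfl, rfl⟩⟩)) (hCW _ hb)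
      · tauto
    refine ⟨?_, hsub, ?_⟩
    · intro v hv
      have h := mem_Cf.mp hv
      clear hv
      induction h with
      | base v h h' => exact .base v h (mem_Cf.mpr (.base v h h'))
      | step u v h1 h h' ih => exact .step u v ih h (mem_Cf.mpr (.step u v h1 h h'))
    · intro v hv
      have h := hK v hv
      rw [split hsub] at h
      simp only [Kf, Finset.mem_filter, Finset.mem_sdiff] at hv
      exact (mem_Wf_union_iff Finset.inter_subset_right Finset.inter_subset_right hC hv.1.2).mp h
  · rintro ⟨hadm, hsub, hK⟩
    have hCW : ∀ v ∈ C₀, v ∉ Wf a b U ω := by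
      intro v hv
      rw [split hsub]
      exact notMem_Wf_union Finset.inter_subset_right Finset.inter_subset_right hC hv
    have hKW : ∀ v ∈ Kf s a b B U C₀, v ∈ Wf a b U ω := by
      intro v hv
      have h := hK v hv
      simp only [Kf, Finset.mem_filter, Finset.mem_sdiff] at hv
      rw [split hsub]
      exact (mem_Wf_union_iff Finset.inter_subset_right Finset.inter_subset_right hC hv.1.2).mpr h
    ext v
    constructor
    · intro hv
      have h := mem_Cf.mp hv
      clear hv
      induction h with
      | base v h h' =>
        by_contra hc
        exact h'.2 (hKW v (by simp only [Kf, Finset.mem_filter, Finset.mem_sdiff]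
                              exact ⟨⟨h'.1, hc⟩, Or.inl h⟩))
      | step u v _ h h' ih =>
        by_contra hc
        exact h'.2 (hKW v (by simp only [Kf, Finset.mem_filter, Finset.mem_sdiff]
                              exact ⟨⟨h'.1, hc⟩, Or.inr ⟨u, ih, h⟩⟩))
    · intro hv
      exact mem_Cf.mpr ((hadm v hv).mono fun u hu => ⟨hC hu, hCW u hu⟩)

lemma Nf_of_subset_Wf {U K : Finset α} {ω : Finset ι} (hK : ∀ v ∈ K, v ∈ Wf a b U ω) :
    Nf a b U ω = Nf a b (U \ K) ω := by
  unfold Nf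
  congr 1
  ext A
  simp only [Finset.mem_filter, Finset.mem_powerset]
  constructor
  · rintro ⟨h, h'⟩
    exact ⟨fun v hv => Finset.mem_sdiff.mpr ⟨h hv, fun hvK => hK v hvK A h h' hv⟩, h'⟩
  · rintro ⟨h, h'⟩
    exact ⟨h.trans Finset.sdiff_subset, h'⟩

lemma mem_Wf_iff_of_subset_Wf {U K : Finset α} {ω : Finset ι} (hK : ∀ v ∈ K, v ∈ Wf a b U ω)
    (v : α) : v ∈ Wf a b U ω ↔ v ∈ Wf a b (U \ K) ω := by
  constructor
  · intro h A hA hc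
    exact h A (hA.trans Finset.sdiff_subset) hc
  · intro h A hA hc hv
    refine h A (fun u hu => Finset.mem_sdiff.mpr ⟨hA hu, fun huK => hK u huK A hA hc hu⟩) hc hv

lemma Ei_sOut_Kf {t : ℝ} (f : Finset α → ℝ) :
    Zi t (sOut s a b C₀) a b ((U \ C₀) \ Kf s a b B U C₀) f =
      Zi t s a b ((U \ C₀) \ Kf s a b B U C₀) f := by
  unfold Zi
  refine Finset.sum_congr rfl fun A hA => ?_
  rw [Finset.mem_powerset] at hA
  rw [wt_filter_touching s a b hA, wt_filter_touching (sOut s a b C₀) a b hA]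
  congr 2
  ext i
  simp only [sOut, Finset.mem_filter, Finset.mem_sdiff, Kf, not_and, not_or, not_exists]
  constructor
  · tauto
  · rintro ⟨hi, h⟩
    refine ⟨⟨hi, ?_⟩, h⟩
    rcases h with ⟨h1, h2⟩ | ⟨h1, h2⟩
    · exact ⟨h1.2, fun hb => (h2 h1).2 _ hb ⟨i, hi, Or.inr ⟨rfl, rfl⟩⟩⟩
    · exact ⟨fun ha => (h2 h1).2 _ ha ⟨i, hi, Or.inl ⟨rfl, rfl⟩⟩, h1.2⟩

/-- Conditionally on the cluster `C₀`, the magnetisation dominates that of `U \ B`. -/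
lemma sum_Cf_eq_ge {t : ℝ} (h0 : 0 < t) (h1 : t ≤ 1) (hC : C₀ ⊆ U) {o : α}
    (ho : o ∉ C₀) :
    Ei t s a b (U \ B) (fun A => sg A o) * ∑ ω ∈ s.powerset,
        (if Cf s a b B U ω = C₀ then muf ((1 - t) / t) a b U ω else 0) ≤
      ∑ ω ∈ s.powerset, (if Cf s a b B U ω = C₀ ∧ o ∈ Wf a b U ω then
        muf ((1 - t) / t) a b U ω else 0) := by
  set y := (1 - t) / t with hy
  have hy0 : 0 ≤ y := div_nonneg (by linarith) h0.le
  set s₁ := sIn s a b C₀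
  set s₂ := sOut s a b C₀
  set K := Kf s a b B U C₀
  set U' := (U \ C₀) \ K
  by_cases hadm : ∀ v ∈ C₀, Rch s a b B (· ∈ C₀) v
  swap
  · have : ∀ ω ∈ s.powerset, Cf s a b B U ω ≠ C₀ := fun ω hω h =>
      hadm ((Cf_eq_iff hC (Finset.mem_powerset.mp hω)).mp h).1
    rw [Finset.sum_eq_zero fun ω hω => if_neg (this ω hω), mul_zero]
    exact Finset.sum_nonneg fun ω _ => by split_ifs <;> [exact muf_nonneg hy0 ..; rfl]
  have hs12 : s₁ ∪ s₂ ⊆ s := Finset.union_subset (Finset.filter_subset _ _) (Finset.filter_subset _ _)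
  have hsum : ∀ P : Finset ι → Prop, ∀ P' : Finset ι → Prop,
      (∀ ω₁ ⊆ s₁, ∀ ω₂ ⊆ s₂, (∀ v ∈ K, v ∈ Wf a b (U \ C₀) ω₂) → (P (ω₁ ∪ ω₂) ↔ P' ω₂)) →
      ∑ ω ∈ s.powerset, (if Cf s a b B U ω = C₀ ∧ P ω then muf y a b U ω else 0) =
      (∑ ω₁ ∈ s₁.powerset, muf y a b C₀ ω₁) * ∑ ω₂ ∈ s₂.powerset,
        if (∀ v ∈ K, v ∈ Wf a b (U \ C₀) ω₂) ∧ P' ω₂ then muf y a b U' ω₂ else 0 := by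
    intro P P' hP
    rw [← Finset.sum_subset (Finset.powerset_mono.mpr hs12), sum_powerset_union
      (disjoint_sIn_sOut s a b C₀), Finset.sum_mul_sum]
    · refine Finset.sum_congr rfl fun ω₁ hω₁ => Finset.sum_congr rfl fun ω₂ hω₂ => ?_
      rw [Finset.mem_powerset] at hω₁ hω₂
      have e2 : (ω₁ ∪ ω₂) ∩ s₂ = ω₂ := by
        rw [Finset.union_inter_distrib_right, Finset.inter_eq_left.mpr hω₂,
          Finset.disjoint_iff_inter_eq_empty.mp
            (Finset.disjoint_of_subset_left hω₁ (disjoint_sIn_sOut s a b C₀)), Finset.empty_union]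
      have hiff : Cf s a b B U (ω₁ ∪ ω₂) = C₀ ↔ ∀ v ∈ K, v ∈ Wf a b (U \ C₀) ω₂ := by
        rw [Cf_eq_iff hC ((Finset.union_subset_union hω₁ hω₂).trans hs12), e2]
        exact ⟨fun h => h.2.2, fun h => ⟨hadm, Finset.union_subset_union hω₁ hω₂, h⟩⟩
      by_cases hK : ∀ v ∈ K, v ∈ Wf a b (U \ C₀) ω₂
      · have hPP := hP ω₁ hω₁ ω₂ hω₂ hK
        by_cases hP' : P' ω₂
        · rw [if_pos ⟨hiff.mpr hK, hPP.mpr hP'⟩, if_pos ⟨hK, hP'⟩]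
          unfold muf
          rw [Nf_union hω₁ hω₂ hC, Nf_of_subset_Wf hK, Finset.card_union_of_disjoint
            (Finset.disjoint_of_subset_left hω₁ (Finset.disjoint_of_subset_right hω₂
              (disjoint_sIn_sOut s a b C₀))), pow_add]
          push_cast
          ring
        · rw [if_neg fun h => hP' (hPP.mp h.2), if_neg fun h => hP' h.2, mul_zero]
      · rw [if_neg fun h => hK (hiff.mp h.1), if_neg fun h => hK h.1, mul_zero]
    · intro ω hω hω'
      rw [Finset.mem_powerset] at hω hω'
      exact if_neg fun h => hω' ((Cf_eq_iff hC hω).mp h.1).2.1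
  have e1 := hsum (fun _ => True) (fun _ => True) fun _ _ _ _ _ => Iff.rfl
  have e2 := hsum (fun ω => o ∈ Wf a b U ω) (fun ω => o ∈ Wf a b U' ω) fun ω₁ h1 ω₂ h2 h => by
    rw [mem_Wf_union_iff h1 h2 hC ho, mem_Wf_iff_of_subset_Wf h]
  simp only [and_true] at e1
  rw [e1, e2]
  have hfkg := fkg_increasing hy0 s₂ a b U' (fun ω => ∀ v ∈ K, v ∈ Wf a b (U \ C₀) ω)
    (fun ω => o ∈ Wf a b U' ω) (fun ω ω' h h' v hv => Wf_mono a b _ h (h' v hv))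
    (fun ω ω' h h' => Wf_mono a b _ h h')
  have hU' : U' ⊆ U \ B := by
    intro v hv
    simp only [U', K, Kf, Finset.mem_sdiff, Finset.mem_filter] at hv ⊢
    tauto
  have hE := Ei_mono h0 h1 s a b hU' (Pos.sg o)
  have hE' : Ei t s a b U' (fun A => sg A o) * (∑ ω ∈ s₂.powerset, muf y a b U' ω) =
      ∑ ω ∈ s₂.powerset, if o ∈ Wf a b U' ω then muf y a b U' ω else 0 := by
    unfold Ei
    rw [← Ei_sOut_Kf, ← Ei_sOut_Kf, Zi_sg_eq h0, div_mul_eq_mul_div]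
    have hp := Zi_one_pos h0 s₂ a b U'
    rw [Zi_one_eq h0] at hp ⊢
    rw [div_eq_iff hp.ne']
    ring
  have hQ : 0 < ∑ ω ∈ s₂.powerset, muf y a b U' ω := by
    have hp := Zi_one_pos h0 s₂ a b U'
    rw [Zi_one_eq h0] at hp
    exact (mul_pos_iff_of_pos_left (by positivity)).mp hp
  have n1 : 0 ≤ ∑ ω₁ ∈ s₁.powerset, muf y a b C₀ ω₁ :=
    Finset.sum_nonneg fun ω _ => muf_nonneg hy0 ..
  have n2 : 0 ≤ ∑ ω₂ ∈ s₂.powerset,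
      if (∀ v ∈ K, v ∈ Wf a b (U \ C₀) ω₂) then muf y a b U' ω₂ else 0 :=
    Finset.sum_nonneg fun ω _ => by split_ifs <;> [exact muf_nonneg hy0 ..; rfl]
  rw [← hE', mul_comm, mul_assoc, mul_comm] at hfkg
  have h3 : Ei t s a b U' (fun A => sg A o) * (∑ ω₂ ∈ s₂.powerset,
      if (∀ v ∈ K, v ∈ Wf a b (U \ C₀) ω₂) then muf y a b U' ω₂ else 0) ≤
      ∑ ω₂ ∈ s₂.powerset, if (∀ v ∈ K, v ∈ Wf a b (U \ C₀) ω₂) ∧ o ∈ Wf a b U' ω₂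
        then muf y a b U' ω₂ else 0 := by
    refine le_of_mul_le_mul_left ?_ hQ
    have h4 : ∀ q e x z : ℝ, q * x * e ≤ q * z → q * (e * x) ≤ q * z := fun q e x z h => by
      linarith
    apply h4
    convert hfkg
  calc _ = (∑ ω₁ ∈ s₁.powerset, muf y a b C₀ ω₁) * (Ei t s a b (U \ B) (fun A => sg A o) *
        ∑ ω₂ ∈ s₂.powerset, if (∀ v ∈ K, v ∈ Wf a b (U \ C₀) ω₂) then muf y a b U' ω₂ else 0) := by
        ring
    _ ≤ _ := mul_le_mul_of_nonneg_left ((mul_le_mul_of_nonneg_right hE n2).trans h3) n1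

/-- Comparison of the magnetisations in `U` and `U \ B` through the probability that `o` is
connected to `B` off the plus clusters. -/
lemma Ei_ge_of_cluster {t κ : ℝ} (h0 : 0 < t) (h1 : t ≤ 1) (o : α)
    (hκ : ∑ ω ∈ s.powerset, (if o ∈ Cf s a b B U ω then muf ((1 - t) / t) a b U ω else 0) ≤
      κ * ∑ ω ∈ s.powerset, muf ((1 - t) / t) a b U ω) :
    (1 - κ) * Ei t s a b (U \ B) (fun A => sg A o) ≤ Ei t s a b U (fun A => sg A o) := by
  set y := (1 - t) / t with hy
  have hy0 : 0 ≤ y := div_nonneg (by linarith) h0.le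
  have hp := Zi_one_pos h0 s a b U
  rw [Zi_one_eq h0] at hp
  have hQ : 0 < ∑ ω ∈ s.powerset, muf y a b U ω := (mul_pos_iff_of_pos_left (by positivity)).mp hp
  have hE := (Pos.sg o).ei_nonneg h0 h1 s a b (U \ B)
  set E := Ei t s a b (U \ B) (fun A => sg A o)
  have hU : Ei t s a b U (fun A => sg A o) = (∑ ω ∈ s.powerset,
      if o ∈ Wf a b U ω then muf y a b U ω else 0) / ∑ ω ∈ s.powerset, muf y a b U ω := by
    unfold Ei
    rw [Zi_sg_eq h0, Zi_one_eq h0, mul_div_mul_left _ _ (by positivity)]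
  rw [hU, le_div_iff₀ hQ]
  have hdec : ∀ P : Finset ι → Prop, ∑ ω ∈ s.powerset,
      (if o ∉ Cf s a b B U ω ∧ P ω then muf y a b U ω else 0) =
      ∑ C₀ ∈ U.powerset.filter (fun C₀ => o ∉ C₀), ∑ ω ∈ s.powerset,
        (if Cf s a b B U ω = C₀ ∧ P ω then muf y a b U ω else 0) := by
    intro P
    rw [Finset.sum_comm]
    refine Finset.sum_congr rfl fun ω _ => ?_
    by_cases hP : P ω
    · simp only [hP, and_true]
      rw [Finset.sum_ite_eq]
      have : Cf s a b B U ω ⊆ U := Finset.filter_subset _ _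
      simp [this]
    · simp [hP]
  have k1 : E * ∑ ω ∈ s.powerset, (if o ∉ Cf s a b B U ω then muf y a b U ω else 0) ≤
      ∑ ω ∈ s.powerset, (if o ∉ Cf s a b B U ω ∧ o ∈ Wf a b U ω then muf y a b U ω else 0) := by
    have e := hdec fun _ => True
    simp only [and_true] at e
    rw [e, hdec fun ω => o ∈ Wf a b U ω, Finset.mul_sum]
    refine Finset.sum_le_sum fun C₀ hC₀ => ?_
    simp only [Finset.mem_filter, Finset.mem_powerset] at hC₀
    exact sum_Cf_eq_ge h0 h1 hC₀.1 hC₀.2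
  have k2 : ∑ ω ∈ s.powerset, (if o ∉ Cf s a b B U ω ∧ o ∈ Wf a b U ω then muf y a b U ω else 0) ≤
      ∑ ω ∈ s.powerset, (if o ∈ Wf a b U ω then muf y a b U ω else 0) := by
    refine Finset.sum_le_sum fun ω _ => ?_
    have := muf_nonneg hy0 a b U ω
    split_ifs <;> first | rfl | exact this | tauto
  have k3 : ∑ ω ∈ s.powerset, (if o ∉ Cf s a b B U ω then muf y a b U ω else 0) =
      ∑ ω ∈ s.powerset, muf y a b U ω -
      ∑ ω ∈ s.powerset, (if o ∈ Cf s a b B U ω then muf y a b U ω else 0) := by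
    rw [← Finset.sum_sub_distrib]
    refine Finset.sum_congr rfl fun ω _ => ?_
    split_ifs <;> simp
  rw [k3] at k1
  have k4 : E * ((1 - κ) * ∑ ω ∈ s.powerset, muf y a b U ω) ≤
      E * (∑ ω ∈ s.powerset, muf y a b U ω -
      ∑ ω ∈ s.powerset, (if o ∈ Cf s a b B U ω then muf y a b U ω else 0)) :=
    mul_le_mul_of_nonneg_left (by linarith) hE
  linarith

end Cluster

section Dual
variable {α ι : Type*} [DecidableEq α] [DecidableEq ι]

/-- The product of the spin pairs over the edges of `ω`. -/
def pp (a b : ι → α) (ω : Finset ι) (A : Finset α) : ℝ := ∏ i ∈ ω, sg A (a i) * sg A (b i)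

lemma sg_union_mul {A R : Finset α} (h : Disjoint A R) (v : α) :
    sg (A ∪ R) v = sg A v * sg R v := by
  rw [← sg_symmDiff, h.symmDiff_eq_sup, Finset.sup_eq_union]

lemma pp_union (a b : ι → α) (ω : Finset ι) {A R : Finset α} (h : Disjoint A R) :
    pp a b ω (A ∪ R) = pp a b ω A * pp a b ω R := by
  unfold pp
  rw [← Finset.prod_mul_distrib]
  refine Finset.prod_congr rfl fun i _ => ?_
  rw [sg_union_mul h, sg_union_mul h]; ring

lemma pp_eq_one (a b : ι → α) (ω : Finset ι) (A : Finset α) (h : ∀ w ∈ A, pp a b ω {w} = 1) :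
    pp a b ω A = 1 := by
  induction A using Finset.induction_on with
  | empty => simp [pp, sg]
  | insert w A hw ih =>
    rw [Finset.insert_eq, pp_union a b ω (by simpa using hw), h w (by simp),
      ih fun v hv => h v (by simp [hv]), one_mul]

lemma pp_eq (a b : ι → α) (ω : Finset ι) (A : Finset α) : pp a b ω A = 1 ∨ pp a b ω A = -1 := by
  unfold pp
  induction ω using Finset.induction_on with
  | empty => simp
  | insert w ω hw ih =>
    rw [Finset.prod_insert hw]
    rcases ih with h | h <;> rcases sg_eq A (a w) with h' | h' <;>
      rcases sg_eq A (b w) with h'' | h'' <;> simp [h, h', h'']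

lemma bond_dual {t : ℝ} (ht : t ^ 2 + 2 * t = 1) (A : Finset α) (u v : α) :
    bond t A u v = (1 + t) / 2 * (1 + t * (sg A u * sg A v)) := by
  unfold bond sg
  by_cases h : u ∈ A <;> by_cases h' : v ∈ A <;> simp [h, h'] <;> linarith

lemma wt_dual {t : ℝ} (ht : t ^ 2 + 2 * t = 1) (s : Finset ι) (a b : ι → α) (A : Finset α) :
    wt t s a b A = ((1 + t) / 2) ^ s.card * ∑ ω ∈ s.powerset, t ^ ω.card * pp a b ω A := by
  unfold wt pp
  simp only [bond_dual ht]
  rw [Finset.prod_mul_distrib, Finset.prod_const, Finset.prod_one_add]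
  congr 1
  refine Finset.sum_congr rfl fun ω _ => ?_
  rw [Finset.prod_mul_distrib, Finset.prod_const]

lemma sum_pp_nonneg (a b : ι → α) (U : Finset α) (ω : Finset ι) :
    0 ≤ ∑ A ∈ U.powerset, pp a b ω A :=
  Pos.sum_nonneg (Pos.prod ω _ fun i _ => (Pos.sg (a i)).mul (Pos.sg (b i))) U

/-- A lower bound for the difference of two partition functions by means of dual contours. -/
lemma sum_wt_sub_ge {t : ℝ} (h0 : 0 < t) (ht : t ^ 2 + 2 * t = 1) (s : Finset ι) (a b : ι → α)
    (U R : Finset α) (hUR : Disjoint U R) (D : Finset α → Finset ι)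
    (hD : ∀ A ⊆ U, D A ⊆ s) (hinj : ∀ A ⊆ U, ∀ A' ⊆ U, D A = D A' → A = A')
    (hwt : ∀ A ⊆ U, t ^ (D A).card = wt t s a b (A ∪ R))
    (h1 : ∀ A ⊆ U, ∀ w ∈ U, pp a b (D A) {w} = 1) (h2 : ∀ A ⊆ U, pp a b (D A) R = -1) :
    ((1 + t) / 2) ^ s.card * (2 * 2 ^ U.card) * ∑ A ∈ U.powerset, wt t s a b (A ∪ R) ≤
      (∑ A ∈ U.powerset, wt t s a b A) - ∑ A ∈ U.powerset, wt t s a b (A ∪ R) := by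
  rw [← Finset.sum_sub_distrib]
  have e : ∀ A ∈ U.powerset, wt t s a b A - wt t s a b (A ∪ R) = ((1 + t) / 2) ^ s.card *
      ∑ ω ∈ s.powerset, t ^ ω.card * (1 - pp a b ω R) * pp a b ω A := by
    intro A hA
    rw [wt_dual ht, wt_dual ht, ← mul_sub, ← Finset.sum_sub_distrib]
    congr 1
    refine Finset.sum_congr rfl fun ω _ => ?_
    rw [pp_union _ _ _ (Finset.disjoint_of_subset_left (Finset.mem_powerset.mp hA) hUR)]; ring
  rw [Finset.sum_congr rfl e, ← Finset.mul_sum, mul_assoc, Finset.sum_comm]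
  refine mul_le_mul_of_nonneg_left ?_ (by positivity)
  have hinj' : Set.InjOn D (U.powerset : Set (Finset α)) := fun A hA A' hA' h =>
    hinj A (by simpa using hA) A' (by simpa using hA') h
  calc _ = ∑ ω ∈ U.powerset.image D, ∑ A ∈ U.powerset, t ^ ω.card * (1 - pp a b ω R) * pp a b ω A := by
        rw [Finset.sum_image hinj', Finset.mul_sum]
        refine Finset.sum_congr rfl fun A hA => ?_
        rw [Finset.mem_powerset] at hA
        rw [← Finset.mul_sum, h2 A hA, hwt A hA, Finset.sum_congr rfl (g := fun _ => (1 : ℝ))]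
        · simp; ring
        · exact fun A' hA' => pp_eq_one _ _ _ _ fun w hw =>
            h1 A hA w (Finset.mem_powerset.mp hA' hw)
    _ ≤ _ := by
        refine Finset.sum_le_sum_of_subset_of_nonneg ?_ ?_
        · intro ω hω
          simp only [Finset.mem_image, Finset.mem_powerset] at hω ⊢
          obtain ⟨A, hA, rfl⟩ := hω
          exact hD A hA
        · intro ω _ _
          rw [← Finset.mul_sum]
          refine mul_nonneg (mul_nonneg (by positivity) ?_) (sum_pp_nonneg a b U ω)
          rcases pp_eq a b ω R with h | h <;> rw [h] <;> norm_num

end Dual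

/-- The end in the lower row of the bond that crosses the unit square with lower left corner `i`. -/
def ea (i : ℤ × ℤ) : ℤ × ℤ := if Even (i.1 + i.2) then i else (i.1 + 1, i.2)

/-- The end in the upper row of the bond that crosses the unit square with lower left corner
`i`. -/
def eb (i : ℤ × ℤ) : ℤ × ℤ := if Even (i.1 + i.2) then (i.1 + 1, i.2 + 1) else (i.1, i.2 + 1)

/-- The even sites of the strip `0 < u < N` with rows between `lo` and `hi`. -/
def stripF (N lo hi : ℤ) : Finset (ℤ × ℤ) :=
  (Finset.Ioo 0 N ×ˢ Finset.Icc lo hi).filter fun p => Even (p.1 + p.2)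

/-- The unit squares of the strip, with rows between `lo` and `hi`. -/
def sqF (N lo hi : ℤ) : Finset (ℤ × ℤ) := Finset.Ico 0 N ×ˢ Finset.Ico lo hi

/-- The sites of the right wall. -/
def wallF (N lo hi : ℤ) : Finset (ℤ × ℤ) :=
  (({N} : Finset ℤ) ×ˢ Finset.Icc lo hi).filter fun p => Even (p.1 + p.2)

lemma mem_stripF {N lo hi : ℤ} {p : ℤ × ℤ} : p ∈ stripF N lo hi ↔
    (0 < p.1 ∧ p.1 < N) ∧ (lo ≤ p.2 ∧ p.2 ≤ hi) ∧ Even (p.1 + p.2) := by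
  simp [stripF, and_assoc]

lemma mem_sqF {N lo hi : ℤ} {p : ℤ × ℤ} : p ∈ sqF N lo hi ↔
    (0 ≤ p.1 ∧ p.1 < N) ∧ (lo ≤ p.2 ∧ p.2 < hi) := by
  simp [sqF]

lemma mem_wallF {N lo hi : ℤ} {p : ℤ × ℤ} : p ∈ wallF N lo hi ↔
    p.1 = N ∧ (lo ≤ p.2 ∧ p.2 ≤ hi) ∧ Even (p.1 + p.2) := by
  obtain ⟨u, v⟩ := p
  simp only [wallF, Finset.mem_filter, Finset.mem_product, Finset.mem_singleton, Finset.mem_Icc]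
  tauto

lemma ea_of_even {u v : ℤ} (h : Even (u + v)) : ea (u, v) = (u, v) := if_pos h

lemma eb_of_even {u v : ℤ} (h : Even (u + v)) : eb (u, v) = (u + 1, v + 1) := if_pos h

lemma ea_of_not_even {u v : ℤ} (h : ¬ Even (u + v)) : ea (u, v) = (u + 1, v) := if_neg h

lemma eb_of_not_even {u v : ℤ} (h : ¬ Even (u + v)) : eb (u, v) = (u, v + 1) := if_neg h

lemma ea_snd (i : ℤ × ℤ) : (ea i).2 = i.2 := by unfold ea; split_ifs <;> rfl

lemma eb_snd (i : ℤ × ℤ) : (eb i).2 = i.2 + 1 := by unfold eb; split_ifs <;> rfl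

lemma ea_even (i : ℤ × ℤ) : Even ((ea i).1 + (ea i).2) := by
  unfold ea; split_ifs with h <;> grind

lemma eb_even (i : ℤ × ℤ) : Even ((eb i).1 + (eb i).2) := by
  unfold eb; split_ifs with h <;> grind

lemma ea_eq_iff {i p : ℤ × ℤ} (hp : Even (p.1 + p.2)) :
    ea i = p ↔ i.2 = p.2 ∧ (i.1 = p.1 ∨ i.1 = p.1 - 1) := by
  obtain ⟨u, v⟩ := i
  obtain ⟨x, y⟩ := p
  by_cases h : Even (u + v)
  · rw [ea_of_even h]; simp only [Prod.mk.injEq] at hp ⊢; grind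
  · rw [ea_of_not_even h]; simp only [Prod.mk.injEq] at hp ⊢; grind

lemma eb_eq_iff {i p : ℤ × ℤ} (hp : Even (p.1 + p.2)) :
    eb i = p ↔ i.2 = p.2 - 1 ∧ (i.1 = p.1 ∨ i.1 = p.1 - 1) := by
  obtain ⟨u, v⟩ := i
  obtain ⟨x, y⟩ := p
  by_cases h : Even (u + v)
  · rw [eb_of_even h]; simp only [Prod.mk.injEq] at hp ⊢; grind
  · rw [eb_of_not_even h]; simp only [Prod.mk.injEq] at hp ⊢; grind

section Block
variable {N v0 : ℤ}

/-- The quarter turn of the block on unit squares. -/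
def rot (N v0 : ℤ) (i : ℤ × ℤ) : ℤ × ℤ := (i.2 - v0, v0 + N - 1 - i.1)

lemma rot_injective : Function.Injective (rot N v0) := by
  rintro ⟨u, v⟩ ⟨u', v'⟩ h
  simp only [rot, Prod.mk.injEq] at h ⊢
  omega

lemma rot_mem {i : ℤ × ℤ} (hi : i ∈ sqF N v0 (v0 + N)) : rot N v0 i ∈ sqF N v0 (v0 + N) := by
  rw [mem_sqF] at hi ⊢
  simp only [rot]
  omega

/-- The squares whose bond is not satisfied by `A`. -/
def unsat (s : Finset (ℤ × ℤ)) (A : Finset (ℤ × ℤ)) : Finset (ℤ × ℤ) :=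
  s.filter fun i => ¬ (ea i ∈ A ↔ eb i ∈ A)

lemma wt_eq_pow_unsat (t : ℝ) (s A : Finset (ℤ × ℤ)) :
    wt t s ea eb A = t ^ (unsat s A).card := by
  unfold wt unsat bond
  rw [← Finset.prod_const, Finset.prod_filter]
  refine Finset.prod_congr rfl fun i _ => ?_
  split_ifs <;> tauto

lemma pp_image_rot (s A X : Finset (ℤ × ℤ)) :
    pp ea eb ((unsat s A).image (rot N v0)) X =
      ∏ i ∈ s, if ea (rot N v0 i) ∈ X ↔ eb (rot N v0 i) ∈ X then 1 else sg A (ea i) * sg A (eb i) := by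
  unfold pp unsat
  rw [Finset.prod_image fun _ _ _ _ h => rot_injective h, Finset.prod_filter]
  refine Finset.prod_congr rfl fun i _ => ?_
  unfold sg
  split_ifs <;> simp_all

lemma unsat_inj {A A' : Finset (ℤ × ℤ)}
    (hA : A ⊆ stripF N v0 (v0 + N)) (hA' : A' ⊆ stripF N v0 (v0 + N))
    (h : unsat (sqF N v0 (v0 + N)) (A ∪ wallF N v0 (v0 + N)) =
      unsat (sqF N v0 (v0 + N)) (A' ∪ wallF N v0 (v0 + N))) : A = A' := by
  have key : ∀ i ∈ sqF N v0 (v0 + N), (ea i ∈ A ∪ wallF N v0 (v0 + N) ↔ ea i ∈ A' ∪ wallF N v0 (v0 + N)) ↔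
      (eb i ∈ A ∪ wallF N v0 (v0 + N) ↔ eb i ∈ A' ∪ wallF N v0 (v0 + N)) := by
    intro i hi
    have := Finset.ext_iff.mp h i
    simp only [unsat, Finset.mem_filter, hi, true_and] at this
    tauto
  have main : ∀ k : ℕ, ∀ u v : ℤ, u = k → u < N → v0 ≤ v → v ≤ v0 + N → Even (u + v) →
      ((u, v) ∈ A ∪ wallF N v0 (v0 + N) ↔ (u, v) ∈ A' ∪ wallF N v0 (v0 + N)) := by
    intro k
    induction k with
    | zero =>
      intro u v hu _ _ _ _
      have e1 : (u, v) ∉ A := fun h => by have := mem_stripF.mp (hA h); simp_all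
      have e2 : (u, v) ∉ A' := fun h => by have := mem_stripF.mp (hA' h); simp_all
      simp [e1, e2]
    | succ k ih =>
      intro u v hu hu' hv1 hv2 he
      push_cast at hu
      by_cases hlast : v < v0 + N
      · have e : ¬ Even ((u - 1) + v) := by grind
        have := key (u - 1, v) (by rw [mem_sqF]; simp only; omega)
        rw [ea_of_not_even e, eb_of_not_even e, sub_add_cancel] at this
        rw [this]
        exact ih _ _ (by omega) (by omega) (by omega) (by omega) (by grind)
      · have e : Even ((u - 1) + (v - 1)) := by grind
        have := key (u - 1, v - 1) (by rw [mem_sqF]; simp only; omega)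
        rw [ea_of_even e, eb_of_even e, sub_add_cancel, sub_add_cancel] at this
        rw [← this]
        exact ih _ _ (by omega) (by omega) (by omega) (by omega) (by grind)
  ext ⟨u, v⟩
  have hw : (u, v) ∈ stripF N v0 (v0 + N) → (u, v) ∉ wallF N v0 (v0 + N) := by
    rw [mem_stripF, mem_wallF]; simp only; omega
  constructor
  · intro hp
    have hs := mem_stripF.mp (hA hp)
    simp only at hs
    have := (main u.toNat u v (by omega) (by omega) (by omega) (by omega) hs.2.2).mp (by simp [hp])
    rcases Finset.mem_union.mp this with h | h
    · exact h
    · exact absurd h (hw (hA hp))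
  · intro hp
    have hs := mem_stripF.mp (hA' hp)
    simp only at hs
    have := (main u.toNat u v (by omega) (by omega) (by omega) (by omega) hs.2.2).mpr (by simp [hp])
    rcases Finset.mem_union.mp this with h | h
    · exact h
    · exact absurd h (hw (hA' hp))

end Block

section Block
variable {N v0 : ℤ}

lemma pp_dual_singleton (hN : Odd N) (hv : Even v0) (hN0 : 0 < N) {A : Finset (ℤ × ℤ)}
    (hA : A ⊆ stripF N v0 (v0 + N)) {w : ℤ × ℤ} (hw : w ∈ stripF N v0 (v0 + N)) :
    pp ea eb ((unsat (sqF N v0 (v0 + N)) (A ∪ wallF N v0 (v0 + N))).image (rot N v0)) {w} = 1 := by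
  rw [pp_image_rot]
  set B := A ∪ wallF N v0 (v0 + N) with hB
  obtain ⟨w1, w2⟩ := w
  rw [mem_stripF] at hw
  simp only at hw
  obtain ⟨f1, hf1⟩ : ∃ f1, f1 = v0 + N - w2 := ⟨_, rfl⟩
  obtain ⟨f2, hf2⟩ : ∃ f2, f2 = w1 + v0 := ⟨_, rfl⟩
  have hodd : ¬ Even (f1 + f2) := by grind
  have hcond : ∀ i : ℤ × ℤ, ¬ (ea (rot N v0 i) ∈ ({(w1, w2)} : Finset (ℤ × ℤ)) ↔
      eb (rot N v0 i) ∈ ({(w1, w2)} : Finset (ℤ × ℤ))) ↔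
      (i.1 = f1 ∨ i.1 = f1 - 1) ∧ (i.2 = f2 ∨ i.2 = f2 - 1) := by
    rintro ⟨u, v⟩
    rw [Finset.mem_singleton, Finset.mem_singleton, ea_eq_iff hw.2.2, eb_eq_iff hw.2.2]
    simp only [rot]
    omega
  have e1 : ∀ i ∈ sqF N v0 (v0 + N), (if ea (rot N v0 i) ∈ ({(w1, w2)} : Finset (ℤ × ℤ)) ↔
      eb (rot N v0 i) ∈ ({(w1, w2)} : Finset (ℤ × ℤ)) then (1 : ℝ) else sg B (ea i) * sg B (eb i)) =
      if (i.1 = f1 ∨ i.1 = f1 - 1) ∧ (i.2 = f2 ∨ i.2 = f2 - 1) then sg B (ea i) * sg B (eb i)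
        else 1 := by
    intro i _
    by_cases h : (i.1 = f1 ∨ i.1 = f1 - 1) ∧ (i.2 = f2 ∨ i.2 = f2 - 1)
    · rw [if_pos h, if_neg ((hcond i).mpr h)]
    · rw [if_neg h, if_pos (not_not.mp (mt (hcond i).mp h))]
  rw [Finset.prod_congr rfl e1, ← Finset.prod_filter]
  have q1 : ea (f1, f2) = (f1 + 1, f2) := ea_of_not_even hodd
  have q2 : eb (f1, f2) = (f1, f2 + 1) := eb_of_not_even hodd
  have q3 : ea (f1 - 1, f2 - 1) = (f1, f2 - 1) := by
    rw [ea_of_not_even (by grind), sub_add_cancel]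
  have q4 : eb (f1 - 1, f2 - 1) = (f1 - 1, f2) := by
    rw [eb_of_not_even (by grind), sub_add_cancel]
  have q5 : ea (f1 - 1, f2) = (f1 - 1, f2) := ea_of_even (by grind)
  have q6 : eb (f1 - 1, f2) = (f1, f2 + 1) := by rw [eb_of_even (by grind), sub_add_cancel]
  have q7 : ea (f1, f2 - 1) = (f1, f2 - 1) := ea_of_even (by grind)
  have q8 : eb (f1, f2 - 1) = (f1 + 1, f2) := by rw [eb_of_even (by grind), sub_add_cancel]
  have wall0 : ∀ v, sg B (0, v) = 1 := fun v => by
    apply sg_of_notMem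
    rw [hB, Finset.mem_union, not_or]
    refine ⟨fun h => ?_, fun h => ?_⟩
    · have := mem_stripF.mp (hA h); simp at this
    · have := mem_wallF.mp h; simp only at this; omega
  by_cases c0 : f1 = 0
  · have : (sqF N v0 (v0 + N)).filter (fun i => (i.1 = f1 ∨ i.1 = f1 - 1) ∧ (i.2 = f2 ∨ i.2 = f2 - 1)) =
        {(f1, f2), (f1, f2 - 1)} := by
      ext ⟨u, v⟩
      simp only [Finset.mem_filter, mem_sqF, Finset.mem_insert, Finset.mem_singleton, Prod.mk.injEq]
      omega
    rw [this, Finset.prod_pair (by simp; omega), q1, q2, q7, q8, c0, wall0, wall0]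
    simp [sg_sq]
  by_cases c1 : f1 = N
  · have : (sqF N v0 (v0 + N)).filter (fun i => (i.1 = f1 ∨ i.1 = f1 - 1) ∧ (i.2 = f2 ∨ i.2 = f2 - 1)) =
        {(f1 - 1, f2), (f1 - 1, f2 - 1)} := by
      ext ⟨u, v⟩
      simp only [Finset.mem_filter, mem_sqF, Finset.mem_insert, Finset.mem_singleton, Prod.mk.injEq]
      omega
    have e : sg B (f1, f2 - 1) = sg B (f1, f2 + 1) := by
      have h1 : (f1, f2 - 1) ∈ B := Finset.mem_union_right _ (mem_wallF.mpr (by grind))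
      have h2 : (f1, f2 + 1) ∈ B := Finset.mem_union_right _ (mem_wallF.mpr (by grind))
      rw [sg_of_mem h1, sg_of_mem h2]
    rw [this, Finset.prod_pair (by simp; omega), q3, q4, q5, q6, e]
    calc _ = (sg B (f1 - 1, f2) * sg B (f1 - 1, f2)) * (sg B (f1, f2 + 1) * sg B (f1, f2 + 1)) := by
          ring
      _ = 1 := by rw [sg_sq, sg_sq, one_mul]
  · have : (sqF N v0 (v0 + N)).filter (fun i => (i.1 = f1 ∨ i.1 = f1 - 1) ∧ (i.2 = f2 ∨ i.2 = f2 - 1)) =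
        {(f1, f2), (f1, f2 - 1), (f1 - 1, f2), (f1 - 1, f2 - 1)} := by
      ext ⟨u, v⟩
      simp only [Finset.mem_filter, mem_sqF, Finset.mem_insert, Finset.mem_singleton, Prod.mk.injEq]
      omega
    rw [this, Finset.prod_insert (by simp; omega), Finset.prod_insert (by simp; omega),
      Finset.prod_pair (by simp; omega), q1, q2, q3, q4, q5, q6, q7, q8]
    calc _ = (sg B (f1 - 1, f2) * sg B (f1 - 1, f2)) * (sg B (f1, f2 + 1) * sg B (f1, f2 + 1)) *
          ((sg B (f1, f2 - 1) * sg B (f1, f2 - 1)) * (sg B (f1 + 1, f2) * sg B (f1 + 1, f2))) := by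
          ring
      _ = 1 := by simp only [sg_sq, one_mul]

/-- The product of the spin pairs along the zigzag path in a band telescopes. -/
lemma prod_band (B : Finset (ℤ × ℤ)) {v : ℤ} (hv : Even v) (k : ℕ) :
    ∏ u ∈ Finset.range k, sg B (ea ((u : ℤ), v)) * sg B (eb ((u : ℤ), v)) =
      sg B (0, v) * sg B ((k : ℤ), if Even (k : ℤ) then v else v + 1) := by
  induction k with
  | zero => simp [sg_sq]
  | succ k ih =>
    rw [Finset.prod_range_succ, ih]
    push_cast
    by_cases h : Even (k : ℤ)
    · have h' : ¬ Even ((k : ℤ) + 1) := by grind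
      rw [if_pos h, if_neg h', ea_of_even (h.add hv), eb_of_even (h.add hv)]
      calc _ = sg B (0, v) * (sg B ((k : ℤ), v) * sg B ((k : ℤ), v)) * sg B ((k : ℤ) + 1, v + 1) := by
            ring
        _ = _ := by rw [sg_sq, mul_one]
    · have h' : Even ((k : ℤ) + 1) := by grind
      have h'' : ¬ Even ((k : ℤ) + v) := by grind
      rw [if_neg h, if_pos h', ea_of_not_even h'', eb_of_not_even h'']
      calc _ = sg B (0, v) * (sg B ((k : ℤ), v + 1) * sg B ((k : ℤ), v + 1)) *
            sg B ((k : ℤ) + 1, v) := by ring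
        _ = _ := by rw [sg_sq, mul_one]

lemma pp_dual_wall (hN : Odd N) (hv : Even v0) (hN0 : 0 < N) {A : Finset (ℤ × ℤ)}
    (hA : A ⊆ stripF N v0 (v0 + N)) :
    pp ea eb ((unsat (sqF N v0 (v0 + N)) (A ∪ wallF N v0 (v0 + N))).image (rot N v0))
      (wallF N v0 (v0 + N)) = -1 := by
  rw [pp_image_rot]
  set B := A ∪ wallF N v0 (v0 + N) with hB
  have hcond : ∀ i ∈ sqF N v0 (v0 + N), (ea (rot N v0 i) ∈ wallF N v0 (v0 + N) ↔
      eb (rot N v0 i) ∈ wallF N v0 (v0 + N)) ↔ ¬ i.2 = v0 + N - 1 := by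
    rintro ⟨u, v⟩ hi
    rw [mem_sqF] at hi
    simp only at hi
    rw [mem_wallF, mem_wallF]
    unfold rot
    by_cases h : Even (v - v0 + (v0 + N - 1 - u))
    · rw [ea_of_even h, eb_of_even h]; simp only; grind
    · rw [ea_of_not_even h, eb_of_not_even h]; simp only; grind
  have e1 : ∀ i ∈ sqF N v0 (v0 + N), (if ea (rot N v0 i) ∈ wallF N v0 (v0 + N) ↔
      eb (rot N v0 i) ∈ wallF N v0 (v0 + N) then (1 : ℝ) else sg B (ea i) * sg B (eb i)) =
      if i.2 = v0 + N - 1 then sg B (ea i) * sg B (eb i) else 1 := by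
    intro i hi
    have := hcond i hi
    split_ifs <;> tauto
  rw [Finset.prod_congr rfl e1, ← Finset.prod_filter]
  obtain ⟨n, rfl⟩ : ∃ n : ℕ, N = n := ⟨N.toNat, by omega⟩
  have : (sqF n v0 (v0 + n)).filter (fun i => i.2 = v0 + n - 1) =
      (Finset.range n).image fun u : ℕ => ((u : ℤ), v0 + n - 1) := by
    ext ⟨u, v⟩
    simp only [Finset.mem_filter, mem_sqF, Finset.mem_image, Finset.mem_range, Prod.mk.injEq]
    constructor
    · exact fun h => ⟨u.toNat, by omega, by omega, by omega⟩
    · rintro ⟨u', h⟩; omega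
  rw [this, Finset.prod_image (fun x _ y _ h => by simpa using h), prod_band B (by grind),
    if_neg (by grind), sub_add_cancel, sg_of_notMem, sg_of_mem, one_mul]
  · exact Finset.mem_union_right _ (mem_wallF.mpr (by grind))
  · rw [hB, Finset.mem_union, not_or]
    refine ⟨fun h => ?_, fun h => ?_⟩
    · have := mem_stripF.mp (hA h); simp at this
    · have := mem_wallF.mp h; simp only at this; omega

lemma card_sqF (n : ℕ) (v0 : ℤ) : (sqF n v0 (v0 + n)).card = n * n := by
  simp [sqF]

lemma card_stripF (n : ℕ) (v0 : ℤ) :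
    (stripF (2 * n + 1) v0 (v0 + (2 * n + 1))).card = (2 * n + 2) * n := by
  have : (stripF (2 * n + 1) v0 (v0 + (2 * n + 1))).card =
      ((Finset.range (2 * n + 2)) ×ˢ Finset.range n).card := by
    symm
    refine Finset.card_bij (fun p _ => ((2 * p.2 + 1 + if Even (v0 + p.1) then 1 else 0 : ℤ),
      v0 + p.1)) ?_ ?_ ?_
    · rintro ⟨a, b⟩ h
      simp only [Finset.mem_product, Finset.mem_range] at h
      rw [mem_stripF]
      simp only
      split_ifs <;> refine ⟨by omega, by omega, by grind⟩
    · rintro ⟨a, b⟩ _ ⟨a', b'⟩ _ h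
      simp only [Prod.mk.injEq] at h ⊢
      obtain ⟨h1, h2⟩ := h
      have : a = a' := by omega
      subst this
      omega
    · rintro ⟨u, v⟩ h
      rw [mem_stripF] at h
      simp only at h
      refine ⟨((v - v0).toNat, ((u - 1) / 2).toNat), ?_, ?_⟩
      · simp only [Finset.mem_product, Finset.mem_range]; omega
      · simp only [Prod.mk.injEq]
        rw [show v0 + ((v - v0).toNat : ℤ) = v by omega]
        refine ⟨?_, rfl⟩
        split_ifs with h' <;> grind
  rw [this]; simp

/-- At the critical point a square block with plus/minus walls costs a factor `√2 - 1`. -/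
lemma block_ratio {t : ℝ} (h0 : 0 < t) (ht : t ^ 2 + 2 * t = 1) (n : ℕ) {v0 : ℤ} (hv : Even v0)
    {N : ℤ} (hN : N = 2 * n + 1) :
    ∑ A ∈ (stripF N v0 (v0 + N)).powerset, wt t (sqF N v0 (v0 + N)) ea eb (A ∪ wallF N v0 (v0 + N)) ≤
      t * ∑ A ∈ (stripF N v0 (v0 + N)).powerset, wt t (sqF N v0 (v0 + N)) ea eb A := by
  have hodd : Odd N := ⟨n, hN⟩
  have hpos : 0 < N := by omega
  have := sum_wt_sub_ge h0 ht (sqF N v0 (v0 + N)) ea eb (stripF N v0 (v0 + N))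
    (wallF N v0 (v0 + N)) ?_
    (fun A => (unsat (sqF N v0 (v0 + N)) (A ∪ wallF N v0 (v0 + N))).image (rot N v0)) ?_ ?_ ?_ ?_ ?_
  · have e1 : (sqF N v0 (v0 + N)).card = (2 * n + 1) * (2 * n + 1) := by
      rw [← card_sqF (2 * n + 1) v0, hN]; push_cast; rfl
    have e2 : (stripF N v0 (v0 + N)).card = (2 * n + 2) * n := by rw [← card_stripF n v0, hN]
    rw [e1, e2] at this
    have e3 : ((1 + t) / 2) ^ ((2 * n + 1) * (2 * n + 1)) * (2 * 2 ^ ((2 * n + 2) * n)) =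
        1 + t := by
      have : (2 * n + 1) * (2 * n + 1) = 2 * ((2 * n + 2) * n) + 1 := by ring
      rw [this, pow_succ, pow_mul]
      calc _ = (((1 + t) / 2) ^ 2 * 2) ^ ((2 * n + 2) * n) * (1 + t) := by rw [mul_pow]; ring
        _ = _ := by
          rw [show ((1 + t) / 2) ^ 2 * 2 = 1 by linarith, one_pow, one_mul]
    rw [e3] at this
    set X := ∑ A ∈ (stripF N v0 (v0 + N)).powerset,
      wt t (sqF N v0 (v0 + N)) ea eb (A ∪ wallF N v0 (v0 + N))
    set Y := ∑ A ∈ (stripF N v0 (v0 + N)).powerset, wt t (sqF N v0 (v0 + N)) ea eb A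
    have h : (2 + t) * X ≤ Y := by linarith
    have := mul_le_mul_of_nonneg_left h h0.le
    linarith [(by linear_combination (-X) * ht : X = t * ((2 + t) * X))]
  · rw [Finset.disjoint_left]
    intro p h h'
    have := mem_stripF.mp h
    have := mem_wallF.mp h'
    omega
  · intro A _ i hi
    simp only [Finset.mem_image] at hi
    obtain ⟨j, hj, rfl⟩ := hi
    exact rot_mem (Finset.filter_subset _ _ hj)
  · intro A hA A' hA' h
    exact unsat_inj hA hA' (Finset.image_injective rot_injective h)
  · intro A _
    rw [Finset.card_image_of_injective _ rot_injective, wt_eq_pow_unsat]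
  · exact fun A hA w hw => pp_dual_singleton hodd hv hpos hA hw
  · exact fun A hA => pp_dual_wall hodd hv hpos hA

end Block

section Block
variable {α ι : Type*} [DecidableEq α] [DecidableEq ι]

lemma Nf_of_touching (a b : ι → α) {U U' : Finset α} (hU : U' ⊆ U) {ω : Finset ι}
    (h : ∀ i ∈ ω, (a i ∈ U → a i ∈ U') ∧ (b i ∈ U → b i ∈ U')) :
    (Nf a b U ω : ℝ) = 2 ^ (U \ U').card * Nf a b U' ω := by
  have : Nf a b U ω = Nf a b U' ω * 2 ^ (U \ U').card := by
    unfold Nf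
    simp only [Finset.card_filter]
    conv_lhs => rw [← Finset.union_sdiff_of_subset hU]
    rw [sum_powerset_union Finset.disjoint_sdiff, Finset.sum_mul]
    refine Finset.sum_congr rfl fun A₁ hA₁ => ?_
    rw [← Finset.card_powerset, Finset.card_eq_sum_ones, Finset.mul_sum]
    refine Finset.sum_congr rfl fun A₂ hA₂ => ?_
    rw [Finset.mem_powerset] at hA₁ hA₂
    rw [mul_one]
    congr 1
    rw [eq_iff_iff]
    refine forall₂_congr fun i hi => ?_
    obtain ⟨h1, h2⟩ := h i hi
    have k1 : a i ∉ A₂ := fun h => by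
      have := Finset.mem_sdiff.mp (hA₂ h); exact this.2 (h1 this.1)
    have k2 : b i ∉ A₂ := fun h => by
      have := Finset.mem_sdiff.mp (hA₂ h); exact this.2 (h2 this.1)
    simp [k1, k2]
  rw [this]; push_cast; ring

/-- The probability of a plus/minus disconnection in a block is at most the ratio of the partition
functions of that block. -/
lemma prob_block_le {t κ : ℝ} (h0 : 0 < t) (h1 : t ≤ 1) (s : Finset ι) (a b : ι → α)
    (U R : Finset α) (s' : Finset ι) (hs : s' ⊆ s) (U' : Finset α) (hU : U' ⊆ U)
    (hend : ∀ i ∈ s', (a i ∈ U → a i ∈ U') ∧ (b i ∈ U → b i ∈ U')) (hR : Disjoint U' R)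
    (hr : ∑ A ∈ U'.powerset, wt t s' a b (A ∪ R) ≤ κ * ∑ A ∈ U'.powerset, wt t s' a b A)
    (E : Finset ι → Prop) (hE : ∀ ω, E ω ↔ ∃ A ⊆ U', Compat a b (ω ∩ s') (A ∪ R)) :
    ∑ ω ∈ s.powerset, (if E ω then muf ((1 - t) / t) a b U ω
      else 0) ≤ κ * ∑ ω ∈ s.powerset, muf ((1 - t) / t) a b U ω := by
  set y := (1 - t) / t with hy
  have hy0 : 0 ≤ y := div_nonneg (by linarith) h0.le
  obtain ⟨S, hS⟩ : ∃ S : Finset ι → Prop, ∀ ω, S ω ↔ ω ⊆ s' := ⟨fun ω => ω ⊆ s', fun _ => Iff.rfl⟩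
  have hfkg := fkg_decreasing hy0 s a b U E
    S (fun ω ω' h h' => by
      obtain ⟨A, hA, hc⟩ := (hE ω').mp h'
      exact (hE ω).mpr ⟨A, hA, hc.mono (Finset.inter_subset_inter_right h)⟩)
    (fun ω ω' h h' => (hS ω).mpr (h.trans ((hS ω').mp h')))
  have hsub : ∀ P : Finset ι → Prop, ∑ ω ∈ s.powerset, (if P ω ∧ S ω then muf y a b U ω else 0) =
      ∑ ω ∈ s'.powerset, if P ω then muf y a b U ω else 0 := by
    intro P
    rw [← Finset.sum_filter, ← Finset.sum_filter]
    refine Finset.sum_congr ?_ fun _ _ => rfl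
    ext ω
    simp only [Finset.mem_filter, Finset.mem_powerset, hS]
    constructor
    · tauto
    · exact fun h => ⟨h.1.trans hs, h.2, h.1⟩
  have hQ := hsub fun _ => True
  simp only [true_and, if_true] at hQ
  have hN : ∀ ω ∈ s'.powerset, muf y a b U ω = 2 ^ (U \ U').card * muf y a b U' ω := by
    intro ω hω
    unfold muf
    rw [Nf_of_touching a b hU fun i hi => hend i (Finset.mem_powerset.mp hω hi)]; ring
  rw [hsub, hQ] at hfkg
  rw [Finset.sum_congr rfl hN, ← Finset.mul_sum] at hfkg
  set X := ∑ ω ∈ s.powerset, (if E ω then muf y a b U ω else 0)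
  set Z := ∑ ω ∈ s.powerset, muf y a b U ω
  set Q := ∑ ω ∈ s'.powerset, muf y a b U' ω with hQdef
  have hZ1 := Zi_one_eq h0 s' a b U'
  rw [← hy, ← hQdef] at hZ1
  have hp := Zi_one_pos h0 s' a b U'
  have hQ0 : 0 < Q := by
    rw [hZ1] at hp
    exact (mul_pos_iff_of_pos_left (by positivity)).mp hp
  have hZ0 : 0 ≤ Z := Finset.sum_nonneg fun ω _ => muf_nonneg hy0 ..
  have hY : ∑ ω ∈ s'.powerset, (if E ω then muf y a b U ω else 0) ≤
      2 ^ (U \ U').card * (κ * Q) := by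
    have e : ∀ ω ∈ s'.powerset,
        (if E ω then muf y a b U ω else 0) ≤
        2 ^ (U \ U').card * (y ^ ω.card *
          ∑ A ∈ U'.powerset, if Compat a b ω (A ∪ R) then (1 : ℝ) else 0) := by
      intro ω hω
      have hω' := Finset.mem_powerset.mp hω
      split_ifs with h
      · obtain ⟨A₀, hA₀, hc⟩ := (hE ω).mp h
        rw [Finset.inter_eq_left.mpr hω'] at hc
        rw [hN ω hω]
        unfold muf Nf
        gcongr
        rw [Finset.card_filter, Nat.cast_sum,
          sum_powerset_symmDiff U' A₀ (Finset.mem_powerset.mpr hA₀)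
            (fun A => (((if Compat a b ω A then 1 else 0) : ℕ) : ℝ))]
        refine Finset.sum_le_sum fun A hA => ?_
        have hAU := Finset.mem_powerset.mp hA
        have e3 : symmDiff A A₀ = symmDiff (A ∪ R) (A₀ ∪ R) := by
          ext v
          simp only [Finset.mem_symmDiff, Finset.mem_union]
          have : v ∈ U' → v ∉ R := fun h h' => Finset.disjoint_left.mp hR h h'
          have := @hAU v
          have := @hA₀ v
          tauto
        have e4 : Compat a b ω (symmDiff A A₀) → Compat a b ω (A ∪ R) := fun h => by
          have := h.symmDiff hc
          rwa [e3, symmDiff_symmDiff_cancel_right] at this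
        split_ifs <;> first | tauto | norm_num
      · exact mul_nonneg (by positivity) (mul_nonneg (by positivity)
          (Finset.sum_nonneg fun A _ => by split_ifs <;> norm_num))
    refine (Finset.sum_le_sum e).trans ?_
    rw [← Finset.mul_sum]
    refine mul_le_mul_of_nonneg_left ?_ (by positivity)
    have hr' : t ^ s'.card * ∑ ω ∈ s'.powerset, (y ^ ω.card *
        ∑ A ∈ U'.powerset, if Compat a b ω (A ∪ R) then (1 : ℝ) else 0) ≤
        t ^ s'.card * (κ * Q) := by
      have : Zi t s' a b U' (fun _ => 1) = ∑ A ∈ U'.powerset, wt t s' a b A := by simp [Zi]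
      calc _ = ∑ A ∈ U'.powerset, wt t s' a b (A ∪ R) := by
            simp only [wt_eq_sum h0, ← hy, ← Finset.mul_sum]
            congr 1
            simp only [Finset.mul_sum]
            rw [Finset.sum_comm]
            refine Finset.sum_congr rfl fun A _ => Finset.sum_congr rfl fun ω _ => ?_
            split_ifs <;> simp
        _ ≤ _ := hr
        _ = _ := by rw [← this, hZ1]; ring
    exact le_of_mul_le_mul_left hr' (by positivity)
  have h2 := hfkg.trans (mul_le_mul_of_nonneg_right hY hZ0)
  have hc : (0 : ℝ) < 2 ^ (U \ U').card := by positivity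
  generalize (2 : ℝ) ^ (U \ U').card = c at h2 hc
  refine le_of_mul_le_mul_left ?_ (mul_pos hc hQ0)
  linarith

end Block

/-- The parity of the number of squares of `l` in the band `v` to the left of `u`. -/
def cnt (l : List (ℤ × ℤ)) (u v : ℤ) : ZMod 2 :=
  (l.map fun i => if i.2 = v ∧ i.1 < u then (1 : ZMod 2) else 0).sum

/-- The parity of the number of squares of `l` in the band `v`. -/
def tot (l : List (ℤ × ℤ)) (v : ℤ) : ZMod 2 :=
  (l.map fun i => if i.2 = v then (1 : ZMod 2) else 0).sum

/-- Indicator of lying to the left of `p` in its row. -/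
def el (p q : ℤ × ℤ) : ZMod 2 := if q.2 = p.2 ∧ q.1 < p.1 then 1 else 0

/-- Indicator of lying in a row at most `v`. -/
def hh (v : ℤ) (q : ℤ × ℤ) : ZMod 2 := if q.2 ≤ v then 1 else 0

lemma zmod2_add_self (x : ZMod 2) : x + x = 0 := CharTwo.add_self_eq_zero x

lemma el_edge {i p : ℤ × ℤ} (h1 : ea i ≠ p) (h2 : eb i ≠ p) :
    ((if i.2 = p.2 ∧ i.1 < p.1 then (1 : ZMod 2) else 0) +
      if i.2 = p.2 - 1 ∧ i.1 < p.1 then (1 : ZMod 2) else 0) = el p (ea i) + el p (eb i) := by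
  obtain ⟨x, y⟩ := p
  obtain ⟨u, v⟩ := i
  unfold el
  by_cases h : Even (u + v)
  · rw [ea_of_even h] at h1 ⊢
    rw [eb_of_even h] at h2 ⊢
    simp only [ne_eq, Prod.mk.injEq] at h1 h2 ⊢
    congr 1 <;> (congr 1; rw [eq_iff_iff]; omega)
  · rw [ea_of_not_even h] at h1 ⊢
    rw [eb_of_not_even h] at h2 ⊢
    simp only [ne_eq, Prod.mk.injEq] at h1 h2 ⊢
    congr 1 <;> (congr 1; rw [eq_iff_iff]; omega)

lemma hh_edge (i : ℤ × ℤ) (v : ℤ) :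
    (if i.2 = v then (1 : ZMod 2) else 0) = hh v (ea i) + hh v (eb i) := by
  unfold hh
  rw [ea_snd, eb_snd]
  split_ifs <;> first | omega | rfl

lemma Rch.exists_path {s : Finset (ℤ × ℤ)} {B : Finset (ℤ × ℤ)} {X : ℤ × ℤ → Prop} {o : ℤ × ℤ}
    (h : Rch s ea eb B X o) : ∃ st ∈ B, ∃ l : List (ℤ × ℤ),
      (∀ i ∈ l, i ∈ s ∧ X (ea i) ∧ X (eb i)) ∧
      (∀ p : ℤ × ℤ, (∀ i ∈ l, ea i ≠ p ∧ eb i ≠ p) →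
        cnt l p.1 p.2 + cnt l p.1 (p.2 - 1) = el p st + el p o) ∧
      ∀ v, tot l v = hh v st + hh v o := by
  induction h with
  | base v hv hX =>
    refine ⟨v, hv, [], by simp, ?_, ?_⟩
    · intro p _
      simp [cnt, zmod2_add_self]
    · intro w
      simp [tot, zmod2_add_self]
  | step u v hu hadj hX ih =>
    obtain ⟨st, hst, l, h1, h2, h3⟩ := ih
    obtain ⟨i, hi, hi'⟩ := hadj
    have hXu := hu.prop
    refine ⟨st, hst, i :: l, ?_, ?_, ?_⟩
    · intro j hj
      rw [List.mem_cons] at hj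
      rcases hj with rfl | hj
      · rcases hi' with ⟨e, e'⟩ | ⟨e, e'⟩ <;> rw [e, e'] <;> exact ⟨hi, by assumption, by assumption⟩
      · exact h1 j hj
    · intro p hp
      simp only [List.mem_cons, forall_eq_or_imp] at hp
      have e1 := h2 p hp.2
      have e2 := el_edge hp.1.1 hp.1.2
      have e3 : el p (ea i) + el p (eb i) = el p u + el p v := by
        rcases hi' with ⟨e, e'⟩ | ⟨e, e'⟩ <;> rw [e, e']; rw [add_comm]
      unfold cnt at e1 ⊢
      simp only [List.map_cons, List.sum_cons]
      linear_combination e1 + e2 + e3 + zmod2_add_self (el p u)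
    · intro w
      have e1 := h3 w
      have e2 := hh_edge i w
      have e3 : hh w (ea i) + hh w (eb i) = hh w u + hh w v := by
        rcases hi' with ⟨e, e'⟩ | ⟨e, e'⟩ <;> rw [e, e']; rw [add_comm]
      unfold tot at e1 ⊢
      simp only [List.map_cons, List.sum_cons]
      linear_combination e1 + e2 + e3 + zmod2_add_self (hh w u)

lemma cnt_eq_tot {l : List (ℤ × ℤ)} {N : ℤ} (h : ∀ i ∈ l, i.1 < N) (v : ℤ) :
    cnt l N v = tot l v := by
  unfold cnt tot
  congr 1
  refine List.map_congr_left fun i hi => ?_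
  simp [h i hi]

lemma cnt_zero {l : List (ℤ × ℤ)} (h : ∀ i ∈ l, 0 ≤ i.1) (v : ℤ) : cnt l 0 v = 0 := by
  have : cnt l 0 v = (l.map fun _ => (0 : ZMod 2)).sum := by
    unfold cnt
    congr 1
    refine List.map_congr_left fun i hi => ?_
    have := h i hi
    rw [if_neg]; omega
  rw [this]; simp

lemma cnt_succ {l : List (ℤ × ℤ)} {u v : ℤ} (h : (u, v) ∉ l) : cnt l (u + 1) v = cnt l u v := by
  unfold cnt
  congr 1
  refine List.map_congr_left fun i hi => ?_
  have : i ≠ (u, v) := fun e => h (e ▸ hi)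
  obtain ⟨x, y⟩ := i
  simp only [ne_eq, Prod.mk.injEq] at this ⊢
  congr 1
  rw [eq_iff_iff]
  omega

lemma ea_mem_range (i : ℤ × ℤ) : (ea i).1 = i.1 ∨ (ea i).1 = i.1 + 1 := by
  unfold ea; split_ifs <;> simp

lemma eb_mem_range (i : ℤ × ℤ) : (eb i).1 = i.1 ∨ (eb i).1 = i.1 + 1 := by
  unfold eb; split_ifs <;> simp

/-- A vertical crossing of a block off the plus clusters forces a separating sign assignment. -/
lemma exists_separating {N H v0 : ℤ} (hN : 0 < N) {ω : Finset (ℤ × ℤ)} {st o : ℤ × ℤ}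
    {l : List (ℤ × ℤ)}
    (h1 : ∀ i ∈ l, i ∈ sqF N (-H) H ∧
      (ea i ∈ stripF N (-H) H ∧ ea i ∉ Wf ea eb (stripF N (-H) H) ω) ∧
      (eb i ∈ stripF N (-H) H ∧ eb i ∉ Wf ea eb (stripF N (-H) H) ω))
    (h2 : ∀ p : ℤ × ℤ, (∀ i ∈ l, ea i ≠ p ∧ eb i ≠ p) →
        cnt l p.1 p.2 + cnt l p.1 (p.2 - 1) = el p st + el p o)
    (h3 : ∀ v, tot l v = hh v st + hh v o)
    (hso : (v0 + N ≤ st.2 ∧ o.2 ≤ v0) ∨ (st.2 ≤ v0 ∧ v0 + N ≤ o.2)) :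
    ∃ A ⊆ stripF N v0 (v0 + N),
      Compat ea eb (ω ∩ sqF N v0 (v0 + N)) (A ∪ wallF N v0 (v0 + N)) := by
  set W := Wf ea eb (stripF N (-H) H) ω with hW
  obtain ⟨S, hS⟩ : ∃ S : ℤ × ℤ → ZMod 2,
    ∀ p, S p = cnt l p.1 (if p.2 < v0 + N then p.2 else p.2 - 1) := ⟨_, fun _ => rfl⟩
  have hl : ∀ i ∈ l, 0 ≤ i.1 ∧ i.1 < N := fun i hi => (mem_sqF.mp (h1 i hi).1).1
  have hSW : ∀ p ∈ W, ∀ v, v = p.2 ∨ v = p.2 - 1 → v0 ≤ v → v < v0 + N → S p = cnt l p.1 v := by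
    intro p hp v hv hv1 hv2
    rw [hS]
    split_ifs with hlt
    · rcases hv with rfl | rfl
      · rfl
      · have := h2 p fun i hi => ⟨fun e => (h1 i hi).2.1.2 (e ▸ hp), fun e => (h1 i hi).2.2.2 (e ▸ hp)⟩
        have e1 : el p st = 0 := if_neg (by omega)
        have e2 : el p o = 0 := if_neg (by omega)
        rw [e1, e2, add_zero] at this
        exact CharTwo.add_eq_zero.mp this
    · rcases hv with rfl | rfl
      · omega
      · rfl
  have hnotU : ∀ p : ℤ × ℤ, p.1 = 0 ∨ p.1 = N → p ∈ W := fun p hp =>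
    mem_Wf_of_notMem _ _ _ fun h => by have := mem_stripF.mp h; omega
  refine ⟨(stripF N v0 (v0 + N)).filter fun p => p ∈ W ∧ S p = 1, Finset.filter_subset _ _, ?_⟩
  set A := (stripF N v0 (v0 + N)).filter fun p => p ∈ W ∧ S p = 1 with hA
  have hmem : ∀ p : ℤ × ℤ, 0 ≤ p.1 → p.1 ≤ N → v0 ≤ p.2 → p.2 ≤ v0 + N → Even (p.1 + p.2) →
      (p ∈ A ∪ wallF N v0 (v0 + N) ↔ p ∈ W ∧ S p = 1) := by
    intro p hp1 hp2 hp3 hp4 he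
    rw [Finset.mem_union, hA, Finset.mem_filter, mem_stripF, mem_wallF]
    rcases hp1.eq_or_lt with h | h
    · have : S p = 0 := by rw [hS, ← h, cnt_zero fun i hi => (hl i hi).1]
      rw [this]
      have : p.1 ≠ N := by omega
      simp [this]
    rcases hp2.eq_or_lt with h' | h'
    · have : S p = 1 := by
        rw [hS, h', cnt_eq_tot fun i hi => (hl i hi).2, h3]
        unfold hh
        split_ifs <;> first | omega | simp
      have h'' := hnotU p (Or.inr h')
      tauto
    · have : p.1 ≠ N := by omega
      tauto
  intro i hi
  rw [Finset.mem_inter, mem_sqF] at hi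
  obtain ⟨hiω, ⟨hi1, hi2⟩, hi3, hi4⟩ := hi
  have ra := ea_mem_range i
  have rb := eb_mem_range i
  have sa := ea_snd i
  have sb := eb_snd i
  rw [hmem _ (by omega) (by omega) (by omega) (by omega) (ea_even i),
    hmem _ (by omega) (by omega) (by omega) (by omega) (eb_even i)]
  have hiff : ea i ∈ W ↔ eb i ∈ W := mem_Wf_iff_of_edge hiω
  rw [hiff]
  refine and_congr_right fun hbW => ?_
  have haW := hiff.mpr hbW
  rw [hSW _ haW i.2 (by omega) hi3 hi4, hSW _ hbW i.2 (by omega) hi3 hi4]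
  have hil : (i.1, i.2) ∉ l := fun h => (h1 i h).2.1.2 haW
  have := cnt_succ hil
  rcases ra with ra | ra <;> rcases rb with rb | rb <;> rw [ra, rb] <;> simp [this]

/-- The magnetisation in a long strip dominates a fixed fraction of that in the square block. -/
lemma strip_compare {t : ℝ} (h0 : 0 < t) (h1 : t ≤ 1) (ht : t ^ 2 + 2 * t = 1) (n : ℕ) {N H : ℤ}
    (hN : N = 2 * n + 1) (hH : N + 1 ≤ H) {o : ℤ × ℤ} (ho : o.2 = 0) :
    (1 - 2 * t) * Ei t (sqF N (-H) H) ea eb (stripF N (-N) (N - 1)) (fun A => sg A o) ≤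
      Ei t (sqF N (-H) H) ea eb (stripF N (-H) H) (fun A => sg A o) := by
  set U := stripF N (-H) H with hU
  set D := stripF N (-N) (N - 1) with hD
  set s := sqF N (-H) H with hs
  have hDU : D ⊆ U := fun p hp => by
    rw [hU, mem_stripF]; rw [hD, mem_stripF] at hp; refine ⟨hp.1, by omega, hp.2.2⟩
  have hUD : U \ (U \ D) = D := Finset.sdiff_sdiff_eq_self hDU
  have := Ei_ge_of_cluster (s := s) (a := ea) (b := eb) (B := U \ D) (U := U) (κ := 2 * t) h0 h1 o ?_
  · rwa [hUD] at this
  have hblock : ∀ v0 : ℤ, Even v0 → -H ≤ v0 → v0 + N ≤ H → ∀ E : Finset (ℤ × ℤ) → Prop,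
      (∀ ω, E ω ↔ ∃ A ⊆ stripF N v0 (v0 + N),
        Compat ea eb (ω ∩ sqF N v0 (v0 + N)) (A ∪ wallF N v0 (v0 + N))) →
      ∑ ω ∈ s.powerset, (if E ω then muf ((1 - t) / t) ea eb U ω else 0) ≤
        t * ∑ ω ∈ s.powerset, muf ((1 - t) / t) ea eb U ω := by
    intro v0 hv h h' E hE
    refine prob_block_le h0 h1 s ea eb U (wallF N v0 (v0 + N)) (sqF N v0 (v0 + N)) ?_
      (stripF N v0 (v0 + N)) ?_ ?_ ?_ (block_ratio h0 ht n hv hN) E hE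
    · intro i hi
      rw [hs, mem_sqF]; rw [mem_sqF] at hi; omega
    · intro p hp
      rw [hU, mem_stripF]; rw [mem_stripF] at hp; exact ⟨hp.1, by omega, hp.2.2⟩
    · intro i hi
      rw [mem_sqF] at hi
      rw [hU, mem_stripF, mem_stripF, mem_stripF, mem_stripF, ea_snd, eb_snd]
      exact ⟨fun h => ⟨h.1, by omega, h.2.2⟩, fun h => ⟨h.1, by omega, h.2.2⟩⟩
    · rw [Finset.disjoint_left]
      intro p h h'
      have := mem_stripF.mp h
      have := mem_wallF.mp h'
      omega
  obtain ⟨E₁, hE₁⟩ : ∃ E : Finset (ℤ × ℤ) → Prop, ∀ ω, E ω ↔ ∃ A ⊆ stripF N 0 (0 + N),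
        Compat ea eb (ω ∩ sqF N 0 (0 + N)) (A ∪ wallF N 0 (0 + N)) := ⟨_, fun _ => Iff.rfl⟩
  obtain ⟨E₂, hE₂⟩ : ∃ E : Finset (ℤ × ℤ) → Prop, ∀ ω, E ω ↔
      ∃ A ⊆ stripF N (-N - 1) (-N - 1 + N),
        Compat ea eb (ω ∩ sqF N (-N - 1) (-N - 1 + N)) (A ∪ wallF N (-N - 1) (-N - 1 + N)) :=
    ⟨_, fun _ => Iff.rfl⟩
  have b1 := hblock 0 (by simp) (by omega) (by omega) E₁ hE₁
  have b2 := hblock (-N - 1) (by grind) (by omega) (by omega) E₂ hE₂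
  have hy0 : 0 ≤ (1 - t) / t := div_nonneg (by linarith) h0.le
  have hle : ∑ ω ∈ s.powerset, (if o ∈ Cf s ea eb (U \ D) U ω then muf ((1 - t) / t) ea eb U ω
      else 0) ≤ ∑ ω ∈ s.powerset, ((if E₁ ω then muf ((1 - t) / t) ea eb U ω else 0) +
        if E₂ ω then muf ((1 - t) / t) ea eb U ω else 0) := by
    refine Finset.sum_le_sum fun ω _ => ?_
    have hm := muf_nonneg hy0 ea eb U ω
    by_cases hC : o ∈ Cf s ea eb (U \ D) U ω
    · rw [if_pos hC]
      obtain ⟨st, hst, l, p1, p2, p3⟩ := (mem_Cf.mp hC).exists_path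
      rw [Finset.mem_sdiff, hU, hD, mem_stripF, mem_stripF] at hst
      have hst' : N ≤ st.2 ∨ st.2 ≤ -N - 1 := by
        by_contra hcon
        exact hst.2 ⟨hst.1.1, by omega, hst.1.2.2⟩
      rcases hst' with h | h
      · have : E₁ ω := (hE₁ ω).mpr (exists_separating (H := H) (by omega) p1 p2 p3 (by omega))
        rw [if_pos this]
        split_ifs <;> linarith
      · have : E₂ ω := (hE₂ ω).mpr (exists_separating (H := H) (by omega) p1 p2 p3 (by omega))
        rw [if_pos this]
        split_ifs <;> linarith
    · rw [if_neg hC]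
      split_ifs <;> linarith
  rw [Finset.sum_add_distrib] at hle
  linarith

/-- The bond weight as a function of the product `z` of the two spins. -/
def lk (t z : ℝ) : ℝ := ((1 + t) + (1 - t) * z) / 2

/-- The kernel between neighbouring rows: index `0` is the wall site of the row itself and `n + 1`
the wall site of the other kind. -/
def tk (t : ℝ) (n : ℕ) (y x : Finset ℕ) : ℝ :=
  lk 0 (sg x 0 * sg y (n + 1)) * lk 0 (sg x (n + 1) * sg y 0) *
    ((∏ i ∈ Finset.range (n + 1), lk t (sg x i * sg y (n - i))) *
      ∏ i ∈ Finset.range n, lk t (sg x (i + 1) * sg y (n - i)))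

/-- The row transfer operator. -/
def tr (t : ℝ) (n : ℕ) (f : Finset ℕ → ℝ) (y : Finset ℕ) : ℝ :=
  ∑ x ∈ (Finset.range (n + 2)).powerset, tk t n y x * f x

/-- The tail `{i, …, n + 1}`. -/
def tl (n i : ℕ) : Finset ℕ := Finset.Ico i (n + 2)

lemma lk_sg {t z : ℝ} (hz : z = 1 ∨ z = -1) : (z = 1 ∧ lk t z = 1 ∧ lk t (-z) = t) ∨
    (z = -1 ∧ lk t z = t ∧ lk t (-z) = 1) := by
  unfold lk
  rcases hz with rfl | rfl
  · left; refine ⟨rfl, ?_, ?_⟩ <;> ring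
  · right; refine ⟨rfl, ?_, ?_⟩ <;> ring

lemma sg_mul_eq (x y : Finset ℕ) (i j : ℕ) : sg x i * sg y j = 1 ∨ sg x i * sg y j = -1 := by
  rcases sg_eq x i with h | h <;> rcases sg_eq y j with h' | h' <;> simp [h, h']

lemma sg_symmDiff_of_mem {B : Finset ℕ} {i : ℕ} (x : Finset ℕ) (h : i ∈ B) :
    sg (symmDiff x B) i = - sg x i := by rw [sg_symmDiff, sg_of_mem h]; ring

lemma sg_symmDiff_of_notMem {B : Finset ℕ} {i : ℕ} (x : Finset ℕ) (h : i ∉ B) :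
    sg (symmDiff x B) i = sg x i := by rw [sg_symmDiff, sg_of_notMem h]; ring

lemma mem_tl {n i j : ℕ} : j ∈ tl n i ↔ i ≤ j ∧ j < n + 2 := Finset.mem_Ico

lemma tl_subset (n i : ℕ) : tl n i ⊆ Finset.range (n + 2) := fun j hj => by
  rw [mem_tl] at hj; exact Finset.mem_range.mpr hj.2

lemma symmDiff_range_tl {n i : ℕ} (hi : i ≤ n + 1) :
    symmDiff (Finset.range (n + 2)) (tl n i) = Finset.range i := by
  ext j; simp only [Finset.mem_symmDiff, Finset.mem_range, mem_tl]; omega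

lemma tr_reindex {n : ℕ} {B : Finset ℕ} (hB : B ⊆ Finset.range (n + 2)) (F : Finset ℕ → ℝ) :
    ∑ x ∈ (Finset.range (n + 2)).powerset, F (symmDiff x B) =
      ∑ x ∈ (Finset.range (n + 2)).powerset, F x :=
  (sum_powerset_symmDiff _ B (Finset.mem_powerset.mpr hB) F).symm

lemma tk_flip_even (t : ℝ) {n i : ℕ} (hi : i ≤ n) (y x : Finset ℕ) :
    lk t (sg x i * sg y (n - i)) * tk t n (symmDiff y (Finset.range (n - i + 1))) x =
      lk t (-(sg x i * sg y (n - i))) * tk t n y (symmDiff x (tl n (i + 1))) := by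
  have key : ∀ j j' : ℕ, (j ∈ tl n (i + 1) ↔ j' ∈ Finset.range (n - i + 1)) →
      sg x j * sg (symmDiff y (Finset.range (n - i + 1))) j' =
        sg (symmDiff x (tl n (i + 1))) j * sg y j' := by
    intro j j' h
    rw [sg_symmDiff, sg_symmDiff]
    by_cases hj : j ∈ tl n (i + 1)
    · rw [sg_of_mem hj, sg_of_mem (h.mp hj)]; ring
    · rw [sg_of_notMem hj, sg_of_notMem fun h' => hj (h.mpr h')]; ring
  unfold tk
  have hm : i ∈ Finset.range (n + 1) := by simp; omega
  rw [key 0 (n + 1) (by simp [mem_tl]), key (n + 1) 0 (by simp [mem_tl, hi]),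
    ← Finset.mul_prod_erase _ _ hm, ← Finset.mul_prod_erase _ _ hm]
  rw [sg_symmDiff_of_mem y (by simp : n - i ∈ Finset.range (n - i + 1)),
    sg_symmDiff_of_notMem x (by simp [mem_tl] : i ∉ tl n (i + 1)), mul_neg]
  rw [Finset.prod_congr (g := fun j => lk t (sg (symmDiff x (tl n (i + 1))) j *
      sg y (n - j))) (rfl : (Finset.range (n + 1)).erase i = (Finset.range (n + 1)).erase i) fun j hj => by
    rw [Finset.mem_erase, Finset.mem_range] at hj
    rw [key j (n - j) (by rw [mem_tl, Finset.mem_range]; omega)],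
    Finset.prod_congr (g := fun j => lk t (sg (symmDiff x (tl n (i + 1))) (j + 1) *
      sg y (n - j))) (rfl : Finset.range n = Finset.range n) fun j hj => by
    rw [Finset.mem_range] at hj
    rw [key (j + 1) (n - j) (by rw [mem_tl, Finset.mem_range]; omega)]]
  ring

lemma tk_flip_odd (t : ℝ) {n i : ℕ} (hi : i < n) (y x : Finset ℕ) :
    lk t (-(sg x (i + 1) * sg y (n - i))) * tk t n (symmDiff y (Finset.range (n - i))) x =
      lk t (sg x (i + 1) * sg y (n - i)) * tk t n y (symmDiff x (tl n (i + 1))) := by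
  have key : ∀ j j' : ℕ, (j ∈ tl n (i + 1) ↔ j' ∈ Finset.range (n - i)) →
      sg x j * sg (symmDiff y (Finset.range (n - i))) j' =
        sg (symmDiff x (tl n (i + 1))) j * sg y j' := by
    intro j j' h
    rw [sg_symmDiff, sg_symmDiff]
    by_cases hj : j ∈ tl n (i + 1)
    · rw [sg_of_mem hj, sg_of_mem (h.mp hj)]; ring
    · rw [sg_of_notMem hj, sg_of_notMem fun h' => hj (h.mpr h')]; ring
  unfold tk
  have hm : i ∈ Finset.range n := by simpa using hi
  rw [key 0 (n + 1) (by rw [mem_tl, Finset.mem_range]; omega), key (n + 1) 0 (by rw [mem_tl, Finset.mem_range]; omega),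
    ← Finset.mul_prod_erase _ _ hm, ← Finset.mul_prod_erase _ _ hm]
  rw [sg_symmDiff_of_notMem y (by simp : n - i ∉ Finset.range (n - i)),
    sg_symmDiff_of_mem x (by rw [mem_tl]; omega : i + 1 ∈ tl n (i + 1)), neg_mul]
  rw [Finset.prod_congr (g := fun j => lk t (sg (symmDiff x (tl n (i + 1))) (j + 1) *
      sg y (n - j))) (rfl : (Finset.range n).erase i = (Finset.range n).erase i) fun j hj => by
    rw [Finset.mem_erase, Finset.mem_range] at hj
    rw [key (j + 1) (n - j) (by rw [mem_tl, Finset.mem_range]; omega)],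
    Finset.prod_congr (g := fun j => lk t (sg (symmDiff x (tl n (i + 1))) j *
      sg y (n - j))) (rfl : Finset.range (n + 1) = Finset.range (n + 1)) fun j hj => by
    rw [Finset.mem_range] at hj
    rw [key j (n - j) (by rw [mem_tl, Finset.mem_range]; omega)]]
  ring

lemma tk_flip_all (t : ℝ) (n : ℕ) (y x : Finset ℕ) :
    tk t n (symmDiff y (Finset.range (n + 2))) (symmDiff x (Finset.range (n + 2))) =
      tk t n y x := by
  have key : ∀ j j' : ℕ, j < n + 2 → j' < n + 2 →
      sg (symmDiff x (Finset.range (n + 2))) j * sg (symmDiff y (Finset.range (n + 2))) j' =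
        sg x j * sg y j' := by
    intro j j' h h'
    rw [sg_symmDiff_of_mem _ (by simpa using h), sg_symmDiff_of_mem _ (by simpa using h')]
    ring
  unfold tk
  rw [key _ _ (by omega) (by omega), key _ _ (by omega) (by omega)]
  congr 2
  · refine Finset.prod_congr rfl fun j hj => ?_
    rw [Finset.mem_range] at hj
    rw [key _ _ (by omega) (by omega)]
  · refine Finset.prod_congr rfl fun j hj => ?_
    rw [Finset.mem_range] at hj
    rw [key _ _ (by omega) (by omega)]

lemma tk_comm (t : ℝ) (n : ℕ) (y x : Finset ℕ) : tk t n y x = tk t n x y := by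
  unfold tk
  congr 1
  · rw [mul_comm (sg x 0), mul_comm (sg x (n + 1)), mul_comm]
  · congr 1
    · rw [← Finset.prod_range_reflect]
      refine Finset.prod_congr rfl fun j hj => ?_
      rw [Finset.mem_range] at hj
      rw [mul_comm, show n + 1 - 1 - j = n - j by omega, show n - (n - j) = j by omega]
    · rw [← Finset.prod_range_reflect]
      refine Finset.prod_congr rfl fun j hj => ?_
      rw [Finset.mem_range] at hj
      rw [mul_comm, show n - 1 - j + 1 = n - j by omega, show n - (n - 1 - j) = j + 1 by omega]

/-- Invariance under the global spin flip. -/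
def Even' (n : ℕ) (f : Finset ℕ → ℝ) : Prop := ∀ x, f (symmDiff x (Finset.range (n + 2))) = f x

lemma Even'.tr {t : ℝ} {n : ℕ} {f : Finset ℕ → ℝ} (hf : Even' n f) : Even' n (tr t n f) := by
  intro y
  unfold Ising.tr
  rw [← tr_reindex (n := n) subset_rfl (fun x => tk t n (symmDiff y _) x * f x)]
  exact Finset.sum_congr rfl fun x _ => by rw [tk_flip_all, hf]

lemma Even'.apply_tl {n : ℕ} {f : Finset ℕ → ℝ} (hf : Even' n f) {i : ℕ} (hi : i ≤ n + 1)
    (y : Finset ℕ) : f (symmDiff y (tl n i)) = f (symmDiff y (Finset.range i)) := by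
  rw [← hf, symmDiff_assoc, symmDiff_comm (tl n i), symmDiff_range_tl hi]

/-- The even fermions. -/
def fb (n i : ℕ) (f : Finset ℕ → ℝ) (x : Finset ℕ) : ℝ := sg x i * f (symmDiff x (tl n (i + 1)))

/-- The odd fermions. -/
def fa (n i : ℕ) (f : Finset ℕ → ℝ) (x : Finset ℕ) : ℝ :=
  sg x (i + 1) * f (symmDiff x (tl n (i + 1)))

/-- Intermediate fermions. -/
def de (t : ℝ) (n i : ℕ) (f : Finset ℕ → ℝ) (y : Finset ℕ) : ℝ :=
  tr t n (fun x => sg x i * f x) (symmDiff y (Finset.range (n + 1 - i)))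

/-- Intermediate fermions. -/
def dd (t : ℝ) (n i : ℕ) (f : Finset ℕ → ℝ) (y : Finset ℕ) : ℝ :=
  sg y (n - i) * tr t n (fun x => f (symmDiff x (tl n (i + 1)))) y

lemma tr_shift (t : ℝ) (n i : ℕ) (f : Finset ℕ → ℝ) (y : Finset ℕ) (c : Finset ℕ → ℝ) :
    tr t n (fun x => c x * f (symmDiff x (tl n i))) y =
      ∑ x ∈ (Finset.range (n + 2)).powerset,
        tk t n y (symmDiff x (tl n i)) * (c (symmDiff x (tl n i)) * f x) := by
  unfold tr
  rw [← tr_reindex (n := n) (tl_subset n i)]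
  simp only [symmDiff_symmDiff_cancel_right]

lemma flip_algebra {t a b k k' : ℝ} (ht : t ^ 2 + 2 * t = 1) (hab : a * b = 1 ∨ a * b = -1)
    (hb : b = 1 ∨ b = -1) (h : lk t (a * b) * k = lk t (-(a * b)) * k') :
    (1 + t) * (k' * a) = b * k' + k * a ∧ (1 + t) * (b * k) = b * k' - k * a := by
  have hb2 : b * b = 1 := by rcases hb with rfl | rfl <;> norm_num
  rcases lk_sg (t := t) hab with ⟨hz, e1, e2⟩ | ⟨hz, e1, e2⟩ <;> rw [e1, e2] at h
  · have ha : a = b := by linear_combination b * hz - a * hb2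
    subst ha
    constructor
    · linear_combination -a * h
    · linear_combination (2 + t) * a * h + a * k' * ht
  · have ha : a = -b := by linear_combination b * hz - a * hb2
    subst ha
    constructor
    · linear_combination (2 + t) * b * h - b * k * ht
    · linear_combination b * h

section Relations
variable {t : ℝ} {n i : ℕ} {f : Finset ℕ → ℝ}

lemma tr_fb (ht : t ^ 2 + 2 * t = 1) (hi : i ≤ n) (f : Finset ℕ → ℝ) (y : Finset ℕ) :
    (1 + t) * tr t n (fb n i f) y = dd t n i f y + de t n i f y := by
  unfold fb dd de
  have h1 := tr_shift t n (i + 1) f y (fun x => sg x i)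
  have h2 := tr_shift t n (i + 1) f y (fun _ => 1)
  simp only [one_mul] at h2
  rw [h1, h2]
  unfold tr
  rw [Finset.mul_sum, Finset.mul_sum, ← Finset.sum_add_distrib]
  refine Finset.sum_congr rfl fun x _ => ?_
  have h := tk_flip_even t hi y x
  rw [sg_symmDiff_of_notMem x (by simp [mem_tl] : i ∉ tl n (i + 1)),
    show n + 1 - i = n - i + 1 by omega]
  have := (flip_algebra ht (sg_mul_eq x y i (n - i)) (sg_eq _ _) h).1
  linear_combination f x * this

lemma fb_tr (ht : t ^ 2 + 2 * t = 1) (hf : Even' n f) (hi : i ≤ n) (y : Finset ℕ) :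
    (1 + t) * fb n (n - i) (tr t n f) y = dd t n i f y - de t n i f y := by
  unfold fb dd de
  have h2 := tr_shift t n (i + 1) f y (fun _ => 1)
  simp only [one_mul] at h2
  rw [hf.tr.apply_tl (by omega), h2, show n + 1 - i = n - i + 1 by omega]
  unfold tr
  rw [Finset.mul_sum, Finset.mul_sum, Finset.mul_sum, ← Finset.sum_sub_distrib]
  refine Finset.sum_congr rfl fun x _ => ?_
  have h := tk_flip_even t hi y x
  have := (flip_algebra ht (sg_mul_eq x y i (n - i)) (sg_eq _ _) h).2
  linear_combination f x * this

lemma tr_fa (ht : t ^ 2 + 2 * t = 1) (hi : i < n) (f : Finset ℕ → ℝ) (y : Finset ℕ) :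
    (1 + t) * tr t n (fa n i f) y = dd t n i f y - de t n (i + 1) f y := by
  unfold fa dd de
  have h1 := tr_shift t n (i + 1) f y (fun x => sg x (i + 1))
  have h2 := tr_shift t n (i + 1) f y (fun _ => 1)
  simp only [one_mul] at h2
  rw [h1, h2]
  unfold tr
  rw [Finset.mul_sum, Finset.mul_sum, ← Finset.sum_sub_distrib]
  refine Finset.sum_congr rfl fun x _ => ?_
  have h := tk_flip_odd t hi y x
  rw [sg_symmDiff_of_mem x (by rw [mem_tl]; omega : i + 1 ∈ tl n (i + 1)),
    show n + 1 - (i + 1) = n - i by omega]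
  rw [← neg_mul, show sg x (i + 1) * sg y (n - i) = -(-sg x (i + 1) * sg y (n - i)) by ring] at h
  have := (flip_algebra ht (by have := sg_mul_eq x y (i + 1) (n - i); grind) (sg_eq _ _) h).1
  linear_combination f x * this

lemma fa_tr (ht : t ^ 2 + 2 * t = 1) (hf : Even' n f) (hi : i < n) (y : Finset ℕ) :
    (1 + t) * fa n (n - 1 - i) (tr t n f) y = dd t n i f y + de t n (i + 1) f y := by
  unfold fa dd de
  have h2 := tr_shift t n (i + 1) f y (fun _ => 1)
  simp only [one_mul] at h2
  rw [hf.tr.apply_tl (by omega), h2, show n + 1 - (i + 1) = n - i by omega,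
    show n - 1 - i + 1 = n - i by omega]
  unfold tr
  rw [Finset.mul_sum, Finset.mul_sum, Finset.mul_sum, ← Finset.sum_add_distrib]
  refine Finset.sum_congr rfl fun x _ => ?_
  have h := tk_flip_odd t hi y x
  rw [← neg_mul, show sg x (i + 1) * sg y (n - i) = -(-sg x (i + 1) * sg y (n - i)) by ring] at h
  have := (flip_algebra ht (by have := sg_mul_eq x y (i + 1) (n - i); grind) (sg_eq _ _) h).2
  linear_combination f x * this

lemma tk_mul_sg_left (t : ℝ) (n : ℕ) (y x : Finset ℕ) :
    tk t n y x * sg x 0 = sg y (n + 1) * tk t n y x := by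
  unfold tk lk
  rcases sg_eq x 0 with h | h <;> rcases sg_eq y (n + 1) with h' | h' <;> rw [h, h'] <;> ring

lemma tk_mul_sg_right (t : ℝ) (n : ℕ) (y x : Finset ℕ) :
    tk t n y x * sg x (n + 1) = sg y 0 * tk t n y x := by
  unfold tk lk
  rcases sg_eq x (n + 1) with h | h <;> rcases sg_eq y 0 with h' | h' <;> rw [h, h'] <;> ring

lemma tr_fa_last (f : Finset ℕ → ℝ) (y : Finset ℕ) : tr t n (fa n n f) y = dd t n n f y := by
  unfold fa dd tr
  rw [Finset.mul_sum]
  refine Finset.sum_congr rfl fun x _ => ?_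
  rw [← mul_assoc, tk_mul_sg_right, Nat.sub_self, mul_assoc]

lemma fa_tr_last (hf : Even' n f) (y : Finset ℕ) : fa n n (tr t n f) y = de t n 0 f y := by
  unfold fa de
  rw [hf.tr.apply_tl (by omega)]
  unfold tr
  rw [Finset.mul_sum]
  refine Finset.sum_congr rfl fun x _ => ?_
  rw [← mul_assoc, ← mul_assoc, tk_mul_sg_left, sg_symmDiff_of_notMem y (by simp), Nat.sub_zero]

end Relations

/-- The general element of the space of fermions. -/
def fer (n : ℕ) (B A : ℕ → ℝ) (f : Finset ℕ → ℝ) (x : Finset ℕ) : ℝ :=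
  ∑ i ∈ Finset.range (n + 1), (B i * fb n i f x + A i * fa n i f x)

/-- Coefficients of the mode with angle `θ`. -/
def mB (θ : ℝ) (i : ℕ) : ℝ := (-1) ^ i * Real.sin ((2 * i + 1) * θ)

/-- Coefficients of the mode with angle `θ`. -/
def mA (t : ℝ) (n : ℕ) (θ : ℝ) (i : ℕ) : ℝ :=
  (-1) ^ i * (Real.sin ((2 * i + 2) * θ) / if i = n then 1 + t else 1)

lemma mode_trig {θ σ : ℝ} {m : ℝ} (hc : Real.cos (m * θ) = 0) (hs : Real.sin (m * θ) = σ)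
    (h0 : Real.sin (θ / 2) ≠ 0) (a : ℝ) (hσ : σ * σ = 1) :
    Real.sin (a * θ) + Real.sin ((a + 1) * θ) =
      σ * (Real.cos (θ / 2) / Real.sin (θ / 2)) *
        (Real.sin ((m - a) * θ) - Real.sin ((m - a - 1) * θ)) := by
  have e1 : Real.sin ((m - a) * θ) = σ * Real.cos (a * θ) := by
    rw [sub_mul, Real.sin_sub, hc, hs]; ring
  have e2 : Real.sin ((m - a - 1) * θ) = σ * Real.cos ((a + 1) * θ) := by
    rw [show (m - a - 1) * θ = m * θ - (a + 1) * θ by ring, Real.sin_sub, hc, hs]; ring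
  rw [e1, e2]
  have h1 : a * θ = (a + 1 / 2) * θ - θ / 2 := by ring
  have h2 : (a + 1) * θ = (a + 1 / 2) * θ + θ / 2 := by ring
  rw [h1, h2, Real.sin_sub, Real.sin_add, Real.cos_sub, Real.cos_add]
  generalize (a + 1 / 2) * θ = X
  generalize θ / 2 = Y at h0 ⊢
  field_simp
  linear_combination (-2 * Real.sin X * Real.cos Y * Real.sin Y) * hσ

lemma mode_sum {t θ σ : ℝ} {n : ℕ} (h1t : 1 + t ≠ 0)
    (hc : Real.cos ((2 * n + 2) * θ) = 0) (hs : Real.sin ((2 * n + 2) * θ) = σ)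
    (h0 : Real.sin (θ / 2) ≠ 0) (hσ : σ * σ = 1) {Eb Ea Gb Ga Dd De : ℕ → ℝ}
    (r1 : ∀ i ≤ n, (1 + t) * Eb i = Dd i + De i)
    (r2 : ∀ i ≤ n, (1 + t) * Gb (n - i) = Dd i - De i)
    (r3 : ∀ i < n, (1 + t) * Ea i = Dd i - De (i + 1))
    (r4 : ∀ i < n, (1 + t) * Ga (n - 1 - i) = Dd i + De (i + 1))
    (r5 : Ea n = Dd n) (r6 : Ga n = De 0) :
    ∑ i ∈ Finset.range (n + 1), (mB θ i * Eb i + mA t n θ i * Ea i) =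
      (-1) ^ n * σ * (Real.cos (θ / 2) / Real.sin (θ / 2)) *
        ∑ i ∈ Finset.range (n + 1), (mB θ i * Gb i + mA t n θ i * Ga i) := by
  set S : ℝ → ℝ := fun k => Real.sin (k * θ) with hS
  have S0 : S 0 = 0 := by simp [hS]
  have hn1 : ((-1 : ℝ)) ^ n * (-1) ^ n = 1 := by rw [← mul_pow]; norm_num
  have L : (1 + t) * ∑ i ∈ Finset.range (n + 1), (mB θ i * Eb i + mA t n θ i * Ea i) =
      ∑ i ∈ Finset.range (n + 1), (-1) ^ i * (Dd i * (S (2 * i + 1) + S (2 * i + 1 + 1)) +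
        De i * (S (2 * i) + S (2 * i + 1))) := by
    have a1 : ∑ i ∈ Finset.range (n + 1), (1 + t) * (mB θ i * Eb i) =
        ∑ i ∈ Finset.range (n + 1), (-1) ^ i * S (2 * i + 1) * (Dd i + De i) :=
      Finset.sum_congr rfl fun i hi => by
        rw [← r1 i (by simpa [Nat.lt_succ_iff] using hi)]; simp only [mB, hS]; ring
    have a2 : ∑ i ∈ Finset.range (n + 1), (1 + t) * (mA t n θ i * Ea i) =
        (∑ i ∈ Finset.range n, (-1) ^ i * S (2 * i + 2) * (Dd i - De (i + 1))) +
          (-1) ^ n * S (2 * n + 2) * Dd n := by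
      rw [Finset.sum_range_succ]
      congr 1
      · refine Finset.sum_congr rfl fun i hi => ?_
        rw [Finset.mem_range] at hi
        rw [← r3 i hi]; simp only [mA, hS, if_neg hi.ne]; ring
      · rw [r5]; simp only [mA, hS, if_true]; field_simp
    have a3 : ∑ i ∈ Finset.range (n + 1), (-1) ^ i * S (2 * i) * De i =
        ∑ i ∈ Finset.range n, -((-1) ^ i * S (2 * i + 2) * De (i + 1)) := by
      rw [Finset.sum_range_succ']
      simp only [Nat.cast_zero, mul_zero, S0, zero_mul, add_zero]
      refine Finset.sum_congr rfl fun i _ => ?_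
      push_cast; rw [show (2 : ℝ) * (i + 1) = 2 * i + 2 by ring]; ring
    have a4 : ∑ i ∈ Finset.range (n + 1), (-1) ^ i * S (2 * i + 2) * Dd i =
        (∑ i ∈ Finset.range n, (-1) ^ i * S (2 * i + 2) * Dd i) +
          (-1) ^ n * S (2 * n + 2) * Dd n := Finset.sum_range_succ _ _
    rw [Finset.mul_sum]
    simp only [mul_add (1 + t)]
    rw [Finset.sum_add_distrib, a1, a2]
    simp only [mul_sub, mul_add, Finset.sum_sub_distrib, Finset.sum_add_distrib,
      Finset.sum_neg_distrib] at a3 a4 ⊢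
    simp only [show ∀ i : ℕ, (2 : ℝ) * i + 1 + 1 = 2 * i + 2 from fun i => by ring]
    have c1 : ∀ g : ℕ → ℝ, ∀ h : ℕ → ℝ, ∑ i ∈ Finset.range (n + 1), (-1 : ℝ) ^ i * (g i * h i) =
      ∑ i ∈ Finset.range (n + 1), (-1 : ℝ) ^ i * h i * g i := fun g h =>
        Finset.sum_congr rfl fun i _ => by ring
    rw [c1 Dd, c1 Dd, c1 De, c1 De]
    linarith
  have R : (1 + t) * ∑ i ∈ Finset.range (n + 1), (mB θ i * Gb i + mA t n θ i * Ga i) =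
      (-1) ^ n * ∑ i ∈ Finset.range (n + 1), (-1) ^ i *
        (Dd i * (S (2 * n + 1 - 2 * i) - S (2 * n - 2 * i)) +
        De i * (S (2 * n + 2 - 2 * i) - S (2 * n + 1 - 2 * i))) := by
    have a1 : ∑ i ∈ Finset.range (n + 1), (1 + t) * (mB θ i * Gb i) =
        ∑ i ∈ Finset.range (n + 1), (-1) ^ n * (-1) ^ i * S (2 * n + 1 - 2 * i) *
          (Dd i - De i) := by
      rw [← Finset.sum_range_reflect]
      refine Finset.sum_congr rfl fun i hi => ?_
      have hi' : i ≤ n := by simpa [Nat.lt_succ_iff] using hi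
      rw [← r2 i hi', show n + 1 - 1 - i = n - i by omega]
      obtain ⟨k, rfl⟩ := Nat.exists_eq_add_of_le hi'
      rw [show i + k - i = k by omega]
      have : (-1 : ℝ) ^ (i + k) * (-1) ^ i = (-1) ^ k := by
        rw [pow_add]; have : (-1 : ℝ) ^ i * (-1) ^ i = 1 := by rw [← mul_pow]; norm_num
        linear_combination (-1 : ℝ) ^ k * this
      rw [this]; simp only [mB, hS]; push_cast
      rw [show (2 : ℝ) * (i + k) + 1 - 2 * i = 2 * k + 1 by ring]; ring
    have a2 : ∑ i ∈ Finset.range (n + 1), (1 + t) * (mA t n θ i * Ga i) =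
        (∑ i ∈ Finset.range n, -((-1) ^ n * (-1) ^ i * S (2 * n - 2 * i) *
          (Dd i + De (i + 1)))) + (-1) ^ n * S (2 * n + 2) * De 0 := by
      rw [Finset.sum_range_succ]
      congr 1
      · rw [← Finset.sum_range_reflect]
        refine Finset.sum_congr rfl fun i hi => ?_
        have hi' : i + 1 ≤ n := by simpa using hi
        rw [← r4 i (by omega)]
        obtain ⟨k, rfl⟩ := Nat.exists_eq_add_of_le hi'
        rw [show i + 1 + k - 1 - i = k by omega]
        have : (-1 : ℝ) ^ (i + 1 + k) * (-1) ^ i = -(-1) ^ k := by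
          rw [pow_add, pow_succ]
          have : (-1 : ℝ) ^ i * (-1) ^ i = 1 := by rw [← mul_pow]; norm_num
          linear_combination -(-1 : ℝ) ^ k * this
        rw [this]; simp only [mA, hS, if_neg (show k ≠ i + 1 + k by omega)]; push_cast
        rw [show (2 : ℝ) * (i + 1 + k) - 2 * i = 2 * k + 2 by ring]; ring
      · rw [r6]; simp only [mA, hS, if_true]; field_simp
    have a3 : ∑ i ∈ Finset.range (n + 1), (-1) ^ n * (-1) ^ i * S (2 * n + 2 - 2 * i) * De i =
        (∑ i ∈ Finset.range n, -((-1) ^ n * (-1) ^ i * S (2 * n - 2 * i) * De (i + 1))) +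
          (-1) ^ n * S (2 * n + 2) * De 0 := by
      rw [Finset.sum_range_succ']
      congr 1
      · refine Finset.sum_congr rfl fun i _ => ?_
        push_cast
        rw [show (2 : ℝ) * n + 2 - 2 * (i + 1) = 2 * n - 2 * i by ring]; ring
      · simp
    have a4 : ∑ i ∈ Finset.range (n + 1), (-1) ^ n * (-1) ^ i * S (2 * n - 2 * i) * Dd i =
        ∑ i ∈ Finset.range n, (-1) ^ n * (-1) ^ i * S (2 * n - 2 * i) * Dd i := by
      rw [Finset.sum_range_succ]; simp [S0]
    rw [Finset.mul_sum, Finset.mul_sum]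
    simp only [mul_add (1 + t)]
    rw [Finset.sum_add_distrib, a1, a2]
    simp only [mul_sub, mul_add, Finset.sum_sub_distrib, Finset.sum_add_distrib,
      Finset.sum_neg_distrib, neg_add] at a3 a4 ⊢
    have c1 : ∀ g : ℕ → ℝ, ∀ h : ℕ → ℝ,
      ∑ i ∈ Finset.range (n + 1), (-1 : ℝ) ^ n * ((-1 : ℝ) ^ i * (g i * h i)) =
      ∑ i ∈ Finset.range (n + 1), (-1 : ℝ) ^ n * (-1) ^ i * h i * g i := fun g h =>
        Finset.sum_congr rfl fun i _ => by ring
    rw [c1 Dd, c1 Dd, c1 De, c1 De]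
    linarith
  refine mul_left_cancel₀ h1t ?_
  rw [L, mul_left_comm, R, ← mul_assoc, Finset.mul_sum]
  refine Finset.sum_congr rfl fun i _ => ?_
  have t1 := mode_trig hc hs h0 (2 * i + 1) hσ
  have t2 := mode_trig hc hs h0 (2 * i) hσ
  simp only [show (2 : ℝ) * n + 2 - (2 * i + 1) = 2 * n + 1 - 2 * i by ring,
    show (2 : ℝ) * n + 1 - 2 * i - 1 = 2 * n - 2 * i by ring,
    show (2 : ℝ) * n + 2 - 2 * i - 1 = 2 * n + 1 - 2 * i by ring] at t1 t2
  simp only [hS]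
  rw [t1, t2]
  linear_combination (-((-1) ^ i * σ * (Real.cos (θ / 2) / Real.sin (θ / 2)) *
    (Dd i * (Real.sin ((2 * n + 1 - 2 * i) * θ) - Real.sin ((2 * n - 2 * i) * θ)) +
      De i * (Real.sin ((2 * n + 2 - 2 * i) * θ) - Real.sin ((2 * n + 1 - 2 * i) * θ))))) * hn1

lemma tr_add (t : ℝ) (n : ℕ) (f g : Finset ℕ → ℝ) (y : Finset ℕ) :
    tr t n (fun x => f x + g x) y = tr t n f y + tr t n g y := by
  simp [tr, mul_add, Finset.sum_add_distrib]

lemma tr_smul (t : ℝ) (n : ℕ) (c : ℝ) (f : Finset ℕ → ℝ) (y : Finset ℕ) :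
    tr t n (fun x => c * f x) y = c * tr t n f y := by
  simp only [tr, Finset.mul_sum]; exact Finset.sum_congr rfl fun x _ => by ring

lemma tr_sum {κ : Type*} (t : ℝ) (n : ℕ) (s : Finset κ) (f : κ → Finset ℕ → ℝ) (y : Finset ℕ) :
    tr t n (fun x => ∑ i ∈ s, f i x) y = ∑ i ∈ s, tr t n (f i) y := by
  simp only [tr, Finset.mul_sum]; exact Finset.sum_comm

/-- The modes diagonalise the conjugation by the transfer operator. -/
lemma tr_mode {t θ σ : ℝ} (h0t : 0 < t) (ht : t ^ 2 + 2 * t = 1) {n : ℕ}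
    (hc : Real.cos ((2 * n + 2) * θ) = 0) (hs : Real.sin ((2 * n + 2) * θ) = σ)
    (h0 : Real.sin (θ / 2) ≠ 0) {f : Finset ℕ → ℝ} (hf : Even' n f) (y : Finset ℕ) :
    tr t n (fer n (mB θ) (mA t n θ) f) y =
      (-1) ^ n * σ * (Real.cos (θ / 2) / Real.sin (θ / 2)) *
        fer n (mB θ) (mA t n θ) (tr t n f) y := by
  have hσ : σ * σ = 1 := by
    have := Real.sin_sq_add_cos_sq ((2 * n + 2) * θ)
    rw [hc, hs] at this; linarith
  have := mode_sum (t := t) (by linarith) hc hs h0 hσ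
    (Eb := fun i => tr t n (fb n i f) y) (Ea := fun i => tr t n (fa n i f) y)
    (Gb := fun i => fb n i (tr t n f) y) (Ga := fun i => fa n i (tr t n f) y)
    (Dd := fun i => dd t n i f y) (De := fun i => de t n i f y)
    (fun i hi => tr_fb ht hi f y) (fun i hi => fb_tr ht hf hi y)
    (fun i hi => tr_fa ht hi f y) (fun i hi => fa_tr ht hf hi y)
    (tr_fa_last f y) (fa_tr_last hf y)
  unfold fer
  rw [← this, tr_sum]
  refine Finset.sum_congr rfl fun i _ => ?_
  rw [tr_add, tr_smul, tr_smul]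

section PosSum
variable {α β : Type*} [DecidableEq α] [DecidableEq β]

lemma sg_disjSum_inl (y : Finset α) (x : Finset β) (i : α) :
    sg (y.disjSum x) (Sum.inl i) = sg y i := by simp [sg]

lemma sg_disjSum_inr (y : Finset α) (x : Finset β) (i : β) :
    sg (y.disjSum x) (Sum.inr i) = sg x i := by simp [sg]

lemma chi_disjSum (B : Finset (α ⊕ β)) (y : Finset α) (x : Finset β) :
    chi B (y.disjSum x) = chi B.toLeft y * chi B.toRight x := by
  unfold chi
  rw [← Finset.toLeft_disjSum_toRight (u := B), Finset.prod_disjSum]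
  simp [sg_disjSum_inl, sg_disjSum_inr]

lemma Pos.sum_disjSum {G : Finset (α ⊕ β) → ℝ} (hG : Pos G) (U : Finset β) :
    Pos (fun y : Finset α => ∑ x ∈ U.powerset, G (y.disjSum x)) := by
  induction hG with
  | chi B =>
    simp only [chi_disjSum, ← Finset.mul_sum]
    have := Pos.smul _ _ (sum_chi_nonneg U B.toRight) (Pos.chi B.toLeft)
    convert this using 2; ring
  | smul c f hc _ ih =>
    simp only [← Finset.mul_sum]
    exact Pos.smul _ _ hc ih
  | add f g _ _ ih ih' =>
    simp only [Finset.sum_add_distrib]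
    exact Pos.add _ _ ih ih'

lemma Pos.comp_toRight {f : Finset β → ℝ} (hf : Pos f) :
    Pos (fun A : Finset (α ⊕ β) => f A.toRight) := by
  induction hf with
  | chi B =>
    have : (fun A : Finset (α ⊕ β) => Ising.chi B A.toRight) =
        Ising.chi (B.map Function.Embedding.inr) := by
      funext A
      unfold Ising.chi
      rw [Finset.prod_map]
      refine Finset.prod_congr rfl fun i _ => ?_
      simp [Ising.sg]
    rw [this]; exact Pos.chi _
  | smul c f hc _ ih => exact Pos.smul _ _ hc ih
  | add f g _ _ ih ih' => exact Pos.add _ _ ih ih'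

end PosSum

lemma Pos.lk {α : Type*} [DecidableEq α] {t : ℝ} (h0 : 0 ≤ t) (h1 : t ≤ 1) (u v : α) :
    Pos (fun A : Finset α => Ising.lk t (Ising.sg A u * Ising.sg A v)) := by
  have := (Pos.const (α := α) (c := (1 + t) / 2) (by linarith)).add _ _
    (((Pos.sg u).mul (Pos.sg v)).smul ((1 - t) / 2) _ (by linarith))
  convert this using 2
  unfold Ising.lk; ring

lemma Pos.tr {t : ℝ} (h0 : 0 ≤ t) (h1 : t ≤ 1) {n : ℕ} {f : Finset ℕ → ℝ} (hf : Pos f) :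
    Pos (tr t n f) := by
  have hL : ∀ {t : ℝ}, 0 ≤ t → t ≤ 1 → ∀ i j : ℕ, Pos (fun A : Finset (ℕ ⊕ ℕ) =>
      Ising.lk t (Ising.sg A (Sum.inr i) * Ising.sg A (Sum.inl j))) :=
    fun h0 h1 i j => Pos.lk h0 h1 _ _
  have := Pos.sum_disjSum ((((hL le_rfl zero_le_one 0 (n + 1)).mul
    (hL le_rfl zero_le_one (n + 1) 0)).mul
    ((Pos.prod (Finset.range (n + 1)) _ fun i _ => hL h0 h1 i (n - i)).mul
    (Pos.prod (Finset.range n) _ fun i _ => hL h0 h1 (i + 1) (n - i)))).mul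
    (Pos.comp_toRight (α := ℕ) hf)) (Finset.range (n + 2))
  simp only [sg_disjSum_inl, sg_disjSum_inr, Finset.toRight_disjSum] at this
  exact this

lemma lk_nonneg {t z : ℝ} (h0 : 0 ≤ t) (hz : z = 1 ∨ z = -1) : 0 ≤ lk t z := by
  rcases lk_sg (t := t) hz with ⟨_, h, _⟩ | ⟨_, h, _⟩ <;> rw [h] <;> linarith

lemma tk_nonneg {t : ℝ} (h0 : 0 ≤ t) (n : ℕ) (y x : Finset ℕ) : 0 ≤ tk t n y x :=
  mul_nonneg (mul_nonneg (lk_nonneg le_rfl (sg_mul_eq _ _ _ _))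
    (lk_nonneg le_rfl (sg_mul_eq _ _ _ _)))
    (mul_nonneg (Finset.prod_nonneg fun _ _ => lk_nonneg h0 (sg_mul_eq _ _ _ _))
      (Finset.prod_nonneg fun _ _ => lk_nonneg h0 (sg_mul_eq _ _ _ _)))

lemma abs_tr_le {t : ℝ} (h0 : 0 ≤ t) (n : ℕ) {f g : Finset ℕ → ℝ} (h : ∀ x, |f x| ≤ g x)
    (y : Finset ℕ) : |tr t n f y| ≤ tr t n g y := by
  unfold tr
  refine (Finset.abs_sum_le_sum_abs _ _).trans (Finset.sum_le_sum fun x _ => ?_)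
  rw [abs_mul, abs_of_nonneg (tk_nonneg h0 n y x)]
  exact mul_le_mul_of_nonneg_left (h x) (tk_nonneg h0 n y x)

/-- Iterates of the transfer operator. -/
def itr (t : ℝ) (n h : ℕ) (f : Finset ℕ → ℝ) : Finset ℕ → ℝ := (tr t n)^[h] f

lemma itr_zero (t : ℝ) (n : ℕ) (f : Finset ℕ → ℝ) : itr t n 0 f = f := rfl

lemma itr_succ (t : ℝ) (n h : ℕ) (f : Finset ℕ → ℝ) :
    itr t n (h + 1) f = itr t n h (tr t n f) := Function.iterate_succ_apply _ _ _

lemma itr_succ' (t : ℝ) (n h : ℕ) (f : Finset ℕ → ℝ) :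
    itr t n (h + 1) f = tr t n (itr t n h f) := Function.iterate_succ_apply' _ _ _

lemma Even'.itr {t : ℝ} {n : ℕ} {f : Finset ℕ → ℝ} (hf : Even' n f) (h : ℕ) :
    Even' n (itr t n h f) := by
  induction h with
  | zero => exact hf
  | succ h ih => rw [itr_succ']; exact ih.tr

lemma Pos.itr {t : ℝ} (h0 : 0 ≤ t) (h1 : t ≤ 1) {n : ℕ} {f : Finset ℕ → ℝ} (hf : Pos f) (h : ℕ) :
    Pos (itr t n h f) := by
  induction h with
  | zero => exact hf
  | succ h ih => rw [itr_succ']; exact ih.tr h0 h1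

lemma abs_itr_le {t : ℝ} (h0 : 0 ≤ t) (n h : ℕ) {f g : Finset ℕ → ℝ} (hfg : ∀ x, |f x| ≤ g x) :
    ∀ y, |itr t n h f y| ≤ itr t n h g y := by
  induction h with
  | zero => exact hfg
  | succ h ih => rw [itr_succ', itr_succ']; exact abs_tr_le h0 n ih

lemma itr_add (t : ℝ) (n h : ℕ) (f g : Finset ℕ → ℝ) :
    itr t n h (fun x => f x + g x) = fun x => itr t n h f x + itr t n h g x := by
  induction h with
  | zero => rfl
  | succ h ih => rw [itr_succ', itr_succ', itr_succ', ih]; funext y; exact tr_add _ _ _ _ _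

lemma itr_smul (t : ℝ) (n h : ℕ) (c : ℝ) (f : Finset ℕ → ℝ) :
    itr t n h (fun x => c * f x) = fun x => c * itr t n h f x := by
  induction h with
  | zero => rfl
  | succ h ih => rw [itr_succ', itr_succ', ih]; funext y; exact tr_smul _ _ _ _ _

/-- The indicator of equal wall spins. -/
def bc0 (n : ℕ) (x : Finset ℕ) : ℝ := lk 0 (sg x 0 * sg x (n + 1))

/-- The indicator of opposite wall spins. -/
def bc1 (n : ℕ) (x : Finset ℕ) : ℝ := lk 0 (-(sg x 0 * sg x (n + 1)))

lemma bc0_even (n : ℕ) : Even' n (bc0 n) := by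
  intro x
  unfold bc0
  rw [sg_symmDiff_of_mem x (by simp), sg_symmDiff_of_mem x (by simp), neg_mul_neg]

lemma bc1_nonneg (n : ℕ) (x : Finset ℕ) : 0 ≤ bc1 n x :=
  lk_nonneg le_rfl (by rcases sg_mul_eq x x 0 (n + 1) with h | h <;> rw [h] <;> simp)

lemma bc0_symmDiff_tl {n i : ℕ} (hi : i ≤ n) (x : Finset ℕ) :
    bc0 n (symmDiff x (tl n (i + 1))) = bc1 n x := by
  unfold bc0 bc1
  rw [sg_symmDiff_of_notMem x (by simp [mem_tl]),
    sg_symmDiff_of_mem x (by rw [mem_tl]; omega), mul_neg]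

lemma itr_bc1_nonneg {t : ℝ} (h0 : 0 ≤ t) (n h : ℕ) (x : Finset ℕ) : 0 ≤ itr t n h (bc1 n) x :=
  (abs_nonneg _).trans (abs_itr_le h0 n h (f := fun _ => 0) (by simpa using bc1_nonneg n) x)

/-- The squared norm of the iterates with opposite walls is dominated by that with equal walls. -/
lemma sq_itr_bc1_le {t : ℝ} (h0 : 0 ≤ t) (h1 : t ≤ 1) (n h : ℕ) :
    ∑ x ∈ (Finset.range (n + 2)).powerset, itr t n h (bc1 n) x ^ 2 ≤
      ∑ x ∈ (Finset.range (n + 2)).powerset, itr t n h (bc0 n) x ^ 2 := by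
  have p1 : Pos (itr t n h (fun x => bc0 n x + (-1) * bc1 n x)) := by
    refine Pos.itr h0 h1 ?_ h
    have := (Pos.sg 0).mul (Pos.sg (n + 1))
    convert this using 2
    unfold bc0 bc1 lk; ring
  have p2 : Pos (itr t n h (fun x => bc0 n x + bc1 n x)) := by
    refine Pos.itr h0 h1 ?_ h
    have := Pos.const (α := ℕ) zero_le_one
    convert this using 2
    unfold bc0 bc1 lk; ring
  have := (p1.mul p2).sum_nonneg (Finset.range (n + 2))
  rw [itr_add, itr_add, itr_smul] at this
  rw [← sub_nonneg, ← Finset.sum_sub_distrib]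
  refine this.trans_eq (Finset.sum_congr rfl fun x _ => by ring)

/-- A fermion combination whose action on the iterates decays relative to the iterates. -/
def Small (t : ℝ) (n : ℕ) (B A : ℕ → ℝ) : Prop :=
  ∃ C μ : ℝ, 0 ≤ C ∧ 0 ≤ μ ∧ μ < 1 ∧ ∀ h x,
    |fer n B A (itr t n h (bc0 n)) x| ≤ C * μ ^ h * itr t n h (bc1 n) x

lemma fer_add (n : ℕ) (B A B' A' : ℕ → ℝ) (f : Finset ℕ → ℝ) (x : Finset ℕ) :
    fer n (fun i => B i + B' i) (fun i => A i + A' i) f x = fer n B A f x + fer n B' A' f x := by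
  unfold fer
  rw [← Finset.sum_add_distrib]
  exact Finset.sum_congr rfl fun i _ => by ring

lemma fer_smul (n : ℕ) (c : ℝ) (B A : ℕ → ℝ) (f : Finset ℕ → ℝ) (x : Finset ℕ) :
    fer n (fun i => c * B i) (fun i => c * A i) f x = c * fer n B A f x := by
  unfold fer
  rw [Finset.mul_sum]
  exact Finset.sum_congr rfl fun i _ => by ring

lemma Small.sum {t : ℝ} (h0 : 0 ≤ t) {n : ℕ} {κ : Type*} (s : Finset κ) (z : κ → ℝ)
    (B A : κ → ℕ → ℝ) (hs : ∀ p ∈ s, Small t n (B p) (A p)) :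
    Small t n (fun i => ∑ p ∈ s, z p * B p i) (fun i => ∑ p ∈ s, z p * A p i) := by
  induction s using Finset.induction_on with
  | empty => exact ⟨0, 0, le_rfl, le_rfl, one_pos, fun h x => by simp [fer]⟩
  | insert p s hp ih =>
    obtain ⟨C, μ, hC, hμ, hμ1, hb⟩ := ih fun q hq => hs q (Finset.mem_insert_of_mem hq)
    obtain ⟨C', μ', hC', hμ', hμ1', hb'⟩ := hs p (Finset.mem_insert_self _ _)
    refine ⟨|z p| * C' + C, max μ' μ, by positivity, le_max_of_le_left hμ', max_lt hμ1' hμ1,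
      fun h x => ?_⟩
    simp only [Finset.sum_insert hp]
    rw [fer_add, fer_smul]
    refine (abs_add_le _ _).trans ?_
    rw [abs_mul]
    have hw := itr_bc1_nonneg h0 n h x
    have e1 : C' * μ' ^ h * itr t n h (bc1 n) x ≤ C' * max μ' μ ^ h * itr t n h (bc1 n) x := by
      gcongr; exact le_max_left _ _
    have e2 : C * μ ^ h * itr t n h (bc1 n) x ≤ C * max μ' μ ^ h * itr t n h (bc1 n) x := by
      gcongr; exact le_max_right _ _
    have := mul_le_mul_of_nonneg_left ((hb' h x).trans e1) (abs_nonneg (z p))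
    nlinarith [hb h x]

lemma abs_fer_bc0_le (n : ℕ) (B A : ℕ → ℝ) (x : Finset ℕ) :
    |fer n B A (bc0 n) x| ≤ (∑ i ∈ Finset.range (n + 1), (|B i| + |A i|)) * bc1 n x := by
  unfold fer
  rw [Finset.sum_mul]
  refine (Finset.abs_sum_le_sum_abs _ _).trans (Finset.sum_le_sum fun i hi => ?_)
  have hi' : i ≤ n := by simpa [Nat.lt_succ_iff] using hi
  unfold fb fa
  rw [bc0_symmDiff_tl hi', add_mul]
  have hb := bc1_nonneg n x
  have hs : ∀ j, |sg x j| = 1 := fun j => by rcases sg_eq x j with h | h <;> simp [h]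
  refine (abs_add_le _ _).trans_eq ?_
  rw [abs_mul, abs_mul, abs_mul, abs_mul, hs, hs, abs_of_nonneg hb, one_mul]

lemma itr_fer {t c : ℝ} {n : ℕ} {B A : ℕ → ℝ}
    (hv : ∀ f, Even' n f → ∀ y, tr t n (fer n B A f) y = c * fer n B A (tr t n f) y) (h : ℕ) :
    ∀ f, Even' n f → ∀ y, itr t n h (fer n B A f) y = c ^ h * fer n B A (itr t n h f) y := by
  induction h with
  | zero => intro f _ y; simp [itr_zero]
  | succ h ih =>
    intro f hf y
    rw [itr_succ, itr_succ, show tr t n (fer n B A f) = fun y => c * fer n B A (tr t n f) y from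
      funext (hv f hf), itr_smul]
    simp only
    rw [ih _ hf.tr, pow_succ]; ring

lemma small_of_eigen {t c : ℝ} (h0 : 0 ≤ t) {n : ℕ} {B A : ℕ → ℝ} (hc : 1 < |c|)
    (hv : ∀ f, Even' n f → ∀ y, tr t n (fer n B A f) y = c * fer n B A (tr t n f) y) :
    Small t n B A := by
  have hc0 : 0 < |c| := one_pos.trans hc
  refine ⟨∑ i ∈ Finset.range (n + 1), (|B i| + |A i|), |c|⁻¹,
    Finset.sum_nonneg fun i _ => by positivity, by positivity, inv_lt_one_of_one_lt₀ hc,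
    fun h x => ?_⟩
  have h1 := itr_fer hv h _ (bc0_even n) x
  have h2 := abs_itr_le h0 n h (abs_fer_bc0_le n B A) x
  rw [h1, itr_smul, abs_mul, abs_pow] at h2
  have hp : 0 < |c| ^ h := pow_pos hc0 h
  rw [inv_pow, mul_assoc, mul_left_comm, inv_mul_eq_div, le_div_iff₀ hp]
  linarith

lemma sum_swap_eq_zero {n : ℕ} {a b : ℕ} {c u : Finset ℕ → ℝ}
    (hc : ∀ x, c (symmDiff x (symmDiff (tl n a) (tl n b))) = - c x) :
    ∑ x ∈ (Finset.range (n + 2)).powerset,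
      c x * (u (symmDiff x (tl n a)) * u (symmDiff x (tl n b))) = 0 := by
  have hB : symmDiff (tl n a) (tl n b) ⊆ Finset.range (n + 2) := by
    intro j hj
    simp only [Finset.mem_symmDiff, mem_tl] at hj
    simp; omega
  have h := tr_reindex (n := n) hB fun x =>
    c x * (u (symmDiff x (tl n a)) * u (symmDiff x (tl n b)))
  have h2 : ∀ x, symmDiff (symmDiff x (symmDiff (tl n a) (tl n b))) (tl n a) =
      symmDiff x (tl n b) := by
    intro x; rw [symmDiff_comm (tl n a), ← symmDiff_assoc, symmDiff_symmDiff_cancel_right]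
  have h3 : ∀ x, symmDiff (symmDiff x (symmDiff (tl n a) (tl n b))) (tl n b) =
      symmDiff x (tl n a) := by
    intro x; rw [← symmDiff_assoc, symmDiff_symmDiff_cancel_right]
  simp only [hc, h2, h3, neg_mul, Finset.sum_neg_distrib] at h
  simp only [mul_comm (u (symmDiff _ (tl n b)))] at h
  linarith

/-- The fermionic recursion for the correlation with the wall. -/
lemma fer_corr {n q : ℕ} (hq : q < n) {B A : ℕ → ℝ} (hB : ∀ j, q < j → j ≤ n → B j = 0)
    (hA : ∀ j < q, A j = 0) (hAq : A q = 1) (u : Finset ℕ → ℝ) :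
    ∑ x ∈ (Finset.range (n + 2)).powerset,
        sg x 0 * sg x (q + 1) * sg x q * u (symmDiff x (tl n (q + 1))) * fer n B A u x =
      (∑ x ∈ (Finset.range (n + 2)).powerset, sg x 0 * sg x q * u x ^ 2) -
        B q * ∑ x ∈ (Finset.range (n + 2)).powerset, sg x 0 * sg x (q + 1) * u x ^ 2 := by
  have key : ∀ j ∈ Finset.range (n + 1), ∑ x ∈ (Finset.range (n + 2)).powerset,
      sg x 0 * sg x (q + 1) * sg x q * u (symmDiff x (tl n (q + 1))) *
        (B j * fb n j u x + A j * fa n j u x) =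
      if j = q then (∑ x ∈ (Finset.range (n + 2)).powerset, sg x 0 * sg x q * u x ^ 2) -
        B q * ∑ x ∈ (Finset.range (n + 2)).powerset, sg x 0 * sg x (q + 1) * u x ^ 2 else 0 := by
    intro j hj
    have hj' : j ≤ n := by simpa [Nat.lt_succ_iff] using hj
    unfold fb fa
    rcases lt_trichotomy j q with h | h | h
    · rw [if_neg h.ne, hA j h]
      refine Eq.trans ?_ (sum_swap_eq_zero (n := n) (a := q + 1) (b := j + 1) (u := u)
        (c := fun x => sg x 0 * sg x (q + 1) * sg x q * (B j * sg x j)) fun x => ?_)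
      · exact Finset.sum_congr rfl fun x _ => by ring
      · rw [sg_symmDiff_of_notMem x, sg_symmDiff_of_notMem x, sg_symmDiff_of_mem x,
          sg_symmDiff_of_notMem x]
        · ring
        all_goals simp only [Finset.mem_symmDiff, mem_tl]; omega
    · subst h
      rw [if_pos rfl, hAq]
      have h1 := tr_reindex (n := n) (tl_subset n (j + 1)) fun x => sg x 0 * sg x j * u x ^ 2
      have h2 := tr_reindex (n := n) (tl_subset n (j + 1)) fun x => sg x 0 * sg x (j + 1) * u x ^ 2
      rw [← h1, ← h2, Finset.mul_sum, ← Finset.sum_sub_distrib]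
      refine Finset.sum_congr rfl fun x _ => ?_
      rw [sg_symmDiff_of_notMem x (by simp [mem_tl]), sg_symmDiff_of_notMem x (by simp [mem_tl]),
        sg_symmDiff_of_mem x (by rw [mem_tl]; omega)]
      have e1 := sg_sq x j
      have e2 := sg_sq x (j + 1)
      linear_combination (sg x 0 * sg x (j + 1) * u (symmDiff x (tl n (j + 1))) ^ 2 * B j) * e1 +
        (sg x 0 * sg x j * u (symmDiff x (tl n (j + 1))) ^ 2) * e2
    · rw [if_neg h.ne', hB j h hj']
      refine Eq.trans ?_ (sum_swap_eq_zero (n := n) (a := q + 1) (b := j + 1) (u := u)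
        (c := fun x => sg x 0 * sg x (q + 1) * sg x q * (A j * sg x (j + 1))) fun x => ?_)
      · exact Finset.sum_congr rfl fun x _ => by ring
      · rw [sg_symmDiff_of_notMem x, sg_symmDiff_of_mem x, sg_symmDiff_of_notMem x,
          sg_symmDiff_of_notMem x]
        · ring
        all_goals simp only [Finset.mem_symmDiff, mem_tl]; omega
  simp only [fer, Finset.mul_sum _ _ (_ * u _)]
  rw [Finset.sum_comm, Finset.sum_congr rfl key, Finset.sum_ite_eq', if_pos (by simp; omega)]

/-- Correlation of site `m` with the wall. -/
def corr (t : ℝ) (n h m : ℕ) : ℝ :=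
  ∑ x ∈ (Finset.range (n + 2)).powerset, sg x 0 * sg x m * itr t n h (bc0 n) x ^ 2

lemma corr_zero (t : ℝ) (n h : ℕ) :
    corr t n h 0 = ∑ x ∈ (Finset.range (n + 2)).powerset, itr t n h (bc0 n) x ^ 2 :=
  Finset.sum_congr rfl fun x _ => by rw [sg_sq, one_mul]

lemma itr_bc0_pos {t : ℝ} (h0 : 0 ≤ t) (n h : ℕ) :
    (∀ x, 0 ≤ itr t n h (bc0 n) x) ∧ 1 ≤ itr t n h (bc0 n) ∅ := by
  induction h with
  | zero =>
    refine ⟨fun x => lk_nonneg le_rfl (sg_mul_eq _ _ _ _), ?_⟩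
    simp [itr_zero, bc0, lk, sg]
  | succ h ih =>
    rw [itr_succ']
    refine ⟨fun x => Finset.sum_nonneg fun y _ => mul_nonneg (tk_nonneg h0 n _ _) (ih.1 y), ?_⟩
    refine le_trans ?_ (Finset.single_le_sum (f := fun x => tk t n ∅ x * itr t n h (bc0 n) x)
      (fun y _ => mul_nonneg (tk_nonneg h0 n _ _) (ih.1 y)) (Finset.empty_mem_powerset _))
    have : tk t n ∅ ∅ = 1 := by simp [tk, lk, sg]
    simp only [this, one_mul]
    exact ih.2

lemma corr_zero_pos {t : ℝ} (h0 : 0 ≤ t) (n h : ℕ) : 0 < corr t n h 0 := by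
  rw [corr_zero]
  refine Finset.sum_pos' (fun x _ => sq_nonneg _) ⟨∅, Finset.empty_mem_powerset _, ?_⟩
  have := (itr_bc0_pos h0 n h).2
  positivity

lemma Small.corr_bound {t : ℝ} (h0 : 0 ≤ t) (h1 : t ≤ 1) {n q : ℕ} (hq : q < n) {B A : ℕ → ℝ}
    (hB : ∀ j, q < j → j ≤ n → B j = 0) (hA : ∀ j < q, A j = 0) (hAq : A q = 1)
    (hs : Small t n B A) : ∃ C μ : ℝ, 0 ≤ μ ∧ μ < 1 ∧ ∀ h,
      |corr t n h q - B q * corr t n h (q + 1)| ≤ C * μ ^ h * corr t n h 0 := by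
  obtain ⟨C, μ, hC, hμ, hμ1, hb⟩ := hs
  refine ⟨C, μ, hμ, hμ1, fun h => ?_⟩
  unfold corr
  rw [← fer_corr hq hB hA hAq]
  have hu := (itr_bc0_pos h0 n h).1
  have hw := itr_bc1_nonneg h0 n h
  have hs : ∀ (x : Finset ℕ) (j : ℕ), |sg x j| = 1 := fun x j => by rcases sg_eq x j with h | h <;> simp [h]
  have b1 := sq_itr_bc1_le h0 h1 n h
  have b2 := tr_reindex (n := n) (tl_subset n (q + 1)) fun x => itr t n h (bc0 n) x ^ 2
  have b0 : ∑ x ∈ (Finset.range (n + 2)).powerset, sg x 0 * sg x 0 * itr t n h (bc0 n) x ^ 2 =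
    ∑ x ∈ (Finset.range (n + 2)).powerset, itr t n h (bc0 n) x ^ 2 := corr_zero t n h
  rw [b0]
  calc _ ≤ ∑ x ∈ (Finset.range (n + 2)).powerset, (C * μ ^ h) *
        ((itr t n h (bc0 n) (symmDiff x (tl n (q + 1))) ^ 2 + itr t n h (bc1 n) x ^ 2) / 2) := by
        refine (Finset.abs_sum_le_sum_abs _ _).trans (Finset.sum_le_sum fun x _ => ?_)
        rw [abs_mul, abs_mul, abs_mul, abs_mul, hs, hs, hs, abs_of_nonneg (hu _)]
        have hk := hb h x
        have hcm : 0 ≤ C * μ ^ h := by positivity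
        have h1 := mul_le_mul_of_nonneg_left hk (hu (symmDiff x (tl n (q + 1))))
        have h2 := two_mul_le_add_sq (itr t n h (bc0 n) (symmDiff x (tl n (q + 1))))
          (itr t n h (bc1 n) x)
        nlinarith [mul_le_mul_of_nonneg_left h2 hcm]
    _ = (C * μ ^ h) * ((∑ x ∈ (Finset.range (n + 2)).powerset, itr t n h (bc0 n) x ^ 2 +
        ∑ x ∈ (Finset.range (n + 2)).powerset, itr t n h (bc1 n) x ^ 2) / 2) := by
        rw [← Finset.mul_sum, ← Finset.sum_div, Finset.sum_add_distrib, b2]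
    _ ≤ _ := by
        refine mul_le_mul_of_nonneg_left ?_ (by positivity)
        linarith

/-- Convergence of the correlation with the wall. -/
lemma tendsto_corr {t : ℝ} (h0 : 0 ≤ t) (h1 : t ≤ 1) {n : ℕ} {Q : ℕ → ℝ} {m : ℕ} (hm : m ≤ n)
    (hQ : ∀ q < m, ∃ B A : ℕ → ℝ, Small t n B A ∧ (∀ j, q < j → j ≤ n → B j = 0) ∧
      (∀ j < q, A j = 0) ∧ A q = 1 ∧ B q ≠ 0 ∧ (B q)⁻¹ = Q q) :
    Filter.Tendsto (fun h => corr t n h m / corr t n h 0) Filter.atTop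
      (nhds (∏ q ∈ Finset.range m, Q q)) := by
  induction m with
  | zero =>
    simp only [Finset.range_zero, Finset.prod_empty]
    refine tendsto_const_nhds.congr fun h => ?_
    rw [div_self (corr_zero_pos h0 n h).ne']
  | succ m ih =>
    have ih := ih (by omega) fun q hq => hQ q (by omega)
    obtain ⟨B, A, hs, hB, hA, hAq, hB0, hBQ⟩ := hQ m (by omega)
    obtain ⟨C, μ, hμ, hμ1, hb⟩ := hs.corr_bound h0 h1 (by omega) hB hA hAq
    have hz : Filter.Tendsto (fun h => corr t n h m / corr t n h 0 -
        B m * (corr t n h (m + 1) / corr t n h 0)) Filter.atTop (nhds 0) := by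
      refine squeeze_zero_norm (a := fun h => C * μ ^ h) (fun h => ?_) ?_
      · have hp := corr_zero_pos h0 n h
        rw [Real.norm_eq_abs, mul_div_assoc', ← sub_div, abs_div, abs_of_pos hp, div_le_iff₀ hp]
        exact hb h
      · simpa using (tendsto_pow_atTop_nhds_zero_of_lt_one hμ hμ1).const_mul C
    have := (ih.sub hz).const_mul (B m)⁻¹
    rw [sub_zero, hBQ, mul_comm, ← Finset.prod_range_succ, ← hBQ] at this
    refine this.congr fun h => ?_
    field_simp
    ring

lemma two_sin_mul_sum_cos (r h : ℝ) (N : ℕ) :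
    2 * Real.sin (r * h) * ∑ p ∈ Finset.range N, Real.cos (r * ((2 * p + 1) * h)) =
      Real.sin (2 * N * r * h) := by
  induction N with
  | zero => simp
  | succ N ih =>
    rw [Finset.sum_range_succ, mul_add, ih]
    push_cast
    rw [show 2 * ((N : ℝ) + 1) * r * h = r * ((2 * N + 1) * h) + r * h by ring,
      show 2 * (N : ℝ) * r * h = r * ((2 * N + 1) * h) - r * h by ring, Real.sin_add, Real.sin_sub]
    ring

/-- The angle unit. -/
def hn (n : ℕ) : ℝ := Real.pi / (4 * (n + 1))

lemma hn_pos (n : ℕ) : 0 < hn n := by unfold hn; positivity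

lemma mul_hn (n : ℕ) : (n + 1) * hn n = Real.pi / 4 := by unfold hn; field_simp

lemma sin_hn_pos {n : ℕ} {k : ℝ} (h0 : 0 < k) (h1 : k < 4 * (n + 1)) : 0 < Real.sin (k * hn n) := by
  refine Real.sin_pos_of_pos_of_lt_pi (mul_pos h0 (hn_pos n)) ?_
  have := mul_hn n
  have := hn_pos n
  nlinarith

lemma sin_hn_ne_zero {n : ℕ} {k : ℝ} (h0 : k ≠ 0) (h1 : |k| < 4 * (n + 1)) :
    Real.sin (k * hn n) ≠ 0 := by
  rcases lt_or_gt_of_ne h0 with h | h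
  · rw [abs_of_neg h] at h1
    have := sin_hn_pos (n := n) (neg_pos.mpr h) h1
    rw [neg_mul, Real.sin_neg] at this
    linarith
  · rw [abs_of_pos h] at h1
    exact (sin_hn_pos h h1).ne'

/-- Orthogonality for the discrete sine transform. -/
lemma sum_sin_sin {n i j : ℕ} (hi : i ≤ n) (hj : j ≤ n) :
    ∑ p ∈ Finset.range (n + 1), Real.sin ((2 * j + 1) * ((2 * p + 1) * hn n)) *
      Real.sin ((2 * i + 1) * ((2 * p + 1) * hn n)) = if i = j then ((n : ℝ) + 1) / 2 else 0 := by
  have hi' : (i : ℝ) ≤ n := by exact_mod_cast hi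
  have hj' : (j : ℝ) ≤ n := by exact_mod_cast hj
  have i0 : (0 : ℝ) ≤ i := by positivity
  have j0 : (0 : ℝ) ≤ j := by positivity
  have hz : ∀ k : ℤ, Real.sin (2 * ((n + 1 : ℕ) : ℝ) * (2 * k) * hn n) = 0 := by
    intro k
    push_cast
    rw [show 2 * ((n : ℝ) + 1) * (2 * k) * hn n = k * Real.pi by
      linear_combination (4 * (k : ℝ)) * mul_hn n]
    exact Real.sin_int_mul_pi k
  have hv : ∀ k : ℤ, k ≠ 0 → |(2 * k : ℝ)| < 4 * (n + 1) →
      ∑ p ∈ Finset.range (n + 1), Real.cos (2 * k * ((2 * p + 1) * hn n)) = 0 := by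
    intro k hk hk'
    have h1 := two_sin_mul_sum_cos (2 * k) (hn n) (n + 1)
    rw [hz] at h1
    have h2 := sin_hn_ne_zero (n := n) (k := 2 * k) (by simpa using hk) hk'
    simpa [h2] using h1
  have hprod : ∀ p : ℕ, Real.sin ((2 * j + 1) * ((2 * p + 1) * hn n)) *
      Real.sin ((2 * i + 1) * ((2 * p + 1) * hn n)) =
      (1 / 2) * Real.cos (2 * ((j - i : ℤ) : ℝ) * ((2 * p + 1) * hn n)) -
      (1 / 2) * Real.cos (2 * ((j + i + 1 : ℤ) : ℝ) * ((2 * p + 1) * hn n)) := by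
    intro p
    push_cast
    generalize (2 * (p : ℝ) + 1) * hn n = φ
    rw [show 2 * ((j : ℝ) - i) * φ = (2 * j + 1) * φ - (2 * i + 1) * φ by ring,
      show 2 * ((j : ℝ) + i + 1) * φ = (2 * j + 1) * φ + (2 * i + 1) * φ by ring,
      Real.cos_sub, Real.cos_add]
    ring
  simp only [hprod]
  rw [Finset.sum_sub_distrib, ← Finset.mul_sum, ← Finset.mul_sum, hv (j + i + 1) (by omega) (by
    push_cast; rw [abs_of_pos (by positivity)]; linarith)]
  split_ifs with h
  · subst h
    simp; ring
  · rw [hv (j - i) (by omega) (by push_cast; rw [abs_lt]; constructor <;> linarith)]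
    simp

lemma sum_sin_sin_cross {n i j : ℕ} (hi : i < n) (hj : j ≤ n) :
    (-1) ^ i * (-1) ^ j * ∑ p ∈ Finset.range (n + 1),
      Real.sin ((2 * j + 1) * ((2 * p + 1) * hn n)) *
      Real.sin ((2 * i + 2) * ((2 * p + 1) * hn n)) =
    Real.cos ((2 * j + 1) * hn n) * Real.sin ((2 * i + 2) * hn n) /
      (2 * (Real.sin ((2 * i + 2) * hn n) ^ 2 - Real.sin ((2 * j + 1) * hn n) ^ 2)) ∧
    Real.sin ((2 * i + 2) * hn n) ^ 2 - Real.sin ((2 * j + 1) * hn n) ^ 2 ≠ 0 := by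
  have hi' : (i : ℝ) + 1 ≤ n := by exact_mod_cast hi
  have hj' : (j : ℝ) ≤ n := by exact_mod_cast hj
  have i0 : (0 : ℝ) ≤ i := by positivity
  have j0 : (0 : ℝ) ≤ j := by positivity
  have hz : ∀ k : ℤ, Real.sin (2 * ((n + 1 : ℕ) : ℝ) * (2 * k + 1) * hn n) = (-1) ^ k := by
    intro k
    push_cast
    rw [show 2 * ((n : ℝ) + 1) * (2 * k + 1) * hn n = k * Real.pi + Real.pi / 2 by
      linear_combination (4 * (k : ℝ) + 2) * mul_hn n, Real.sin_add_pi_div_two]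
    exact Real.cos_int_mul_pi k
  have e1 := two_sin_mul_sum_cos (2 * ((j - i - 1 : ℤ) : ℝ) + 1) (hn n) (n + 1)
  have e2 := two_sin_mul_sum_cos (2 * ((j + i + 1 : ℤ) : ℝ) + 1) (hn n) (n + 1)
  rw [hz] at e1 e2
  have s1 : ((-1 : ℝ)) ^ ((j : ℤ) - i - 1) = -((-1) ^ i * (-1) ^ j) := by
    rw [zpow_sub₀ (by norm_num), zpow_sub₀ (by norm_num)]
    simp only [zpow_natCast, zpow_one]
    rcases neg_one_pow_eq_or ℝ i with h | h <;> rw [h] <;> ring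
  have s2 : ((-1 : ℝ)) ^ ((j : ℤ) + i + 1) = -((-1) ^ i * (-1) ^ j) := by
    rw [zpow_add₀ (by norm_num), zpow_add₀ (by norm_num)]
    simp only [zpow_natCast, zpow_one]
    ring
  rw [s1] at e1
  rw [s2] at e2
  have n1 : Real.sin ((2 * ((j - i - 1 : ℤ) : ℝ) + 1) * hn n) ≠ 0 := by
    refine sin_hn_ne_zero ?_ ?_
    · exact_mod_cast (by omega : 2 * ((j : ℤ) - i - 1) + 1 ≠ 0)
    · push_cast; rw [abs_lt]; constructor <;> linarith
  have n2 : Real.sin ((2 * ((j + i + 1 : ℤ) : ℝ) + 1) * hn n) ≠ 0 := by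
    refine sin_hn_ne_zero ?_ ?_
    · exact_mod_cast (by omega : 2 * ((j : ℤ) + i + 1) + 1 ≠ 0)
    · push_cast; rw [abs_lt]; constructor <;> linarith
  have hprod : ∀ p : ℕ, Real.sin ((2 * j + 1) * ((2 * p + 1) * hn n)) *
      Real.sin ((2 * i + 2) * ((2 * p + 1) * hn n)) =
      (1 / 2) * Real.cos ((2 * ((j - i - 1 : ℤ) : ℝ) + 1) * ((2 * p + 1) * hn n)) -
      (1 / 2) * Real.cos ((2 * ((j + i + 1 : ℤ) : ℝ) + 1) * ((2 * p + 1) * hn n)) := by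
    intro p
    push_cast
    generalize (2 * (p : ℝ) + 1) * hn n = φ
    rw [show (2 * ((j : ℝ) - i - 1) + 1) * φ = (2 * j + 1) * φ - (2 * i + 2) * φ by ring,
      show (2 * ((j : ℝ) + i + 1) + 1) * φ = (2 * j + 1) * φ + (2 * i + 2) * φ by ring,
      Real.cos_sub, Real.cos_add]
    ring
  simp only [hprod]
  rw [Finset.sum_sub_distrib, ← Finset.mul_sum, ← Finset.mul_sum]
  generalize ∑ p ∈ Finset.range (n + 1),
    Real.cos ((2 * ((j - i - 1 : ℤ) : ℝ) + 1) * ((2 * p + 1) * hn n)) = X at e1 ⊢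
  generalize ∑ p ∈ Finset.range (n + 1),
    Real.cos ((2 * ((j + i + 1 : ℤ) : ℝ) + 1) * ((2 * p + 1) * hn n)) = Y at e2 ⊢
  have hs : ((-1 : ℝ)) ^ i * (-1) ^ j * ((-1) ^ i * (-1) ^ j) = 1 := by
    rcases neg_one_pow_eq_or ℝ i with h | h <;> rcases neg_one_pow_eq_or ℝ j with h' | h' <;>
      rw [h, h'] <;> norm_num
  generalize ((-1 : ℝ)) ^ i * (-1) ^ j = s at hs e1 e2 ⊢
  have m1 : (2 * ((j - i - 1 : ℤ) : ℝ) + 1) * hn n = (2 * j + 1) * hn n - (2 * i + 2) * hn n := by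
    push_cast; ring
  have m2 : (2 * ((j + i + 1 : ℤ) : ℝ) + 1) * hn n = (2 * j + 1) * hn n + (2 * i + 2) * hn n := by
    push_cast; ring
  rw [m1] at e1 n1
  rw [m2] at e2 n2
  generalize (2 * (j : ℝ) + 1) * hn n = y at *
  generalize (2 * (i : ℝ) + 2) * hn n = x at *
  have hd : Real.sin x ^ 2 - Real.sin y ^ 2 = - (Real.sin (y - x) * Real.sin (y + x)) := by
    rw [Real.sin_sub, Real.sin_add]
    have h1 := Real.sin_sq_add_cos_sq x
    have h2 := Real.sin_sq_add_cos_sq y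
    linear_combination (Real.sin y ^ 2) * h1 - (Real.sin x ^ 2) * h2
  have hne : Real.sin x ^ 2 - Real.sin y ^ 2 ≠ 0 := by
    rw [hd]; exact neg_ne_zero.mpr (mul_ne_zero n1 n2)
  refine ⟨?_, hne⟩
  rw [eq_div_iff (mul_ne_zero two_ne_zero hne), hd]
  have hc : Real.sin (y + x) - Real.sin (y - x) = 2 * (Real.cos y * Real.sin x) := by
    rw [Real.sin_sub, Real.sin_add]; ring
  linear_combination (-(s / 2) * Real.sin (y + x)) * e1 + (s / 2 * Real.sin (y - x)) * e2 +
    (1 / 2) * (Real.sin (y + x) - Real.sin (y - x)) * hs + (1 / 2) * hc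

lemma mode_small {t : ℝ} (h0t : 0 < t) (ht : t ^ 2 + 2 * t = 1) {n p : ℕ} (hp : p ≤ n) :
    Small t n (mB ((2 * p + 1) * hn n)) (mA t n ((2 * p + 1) * hn n)) := by
  have hp' : (p : ℝ) ≤ n := by exact_mod_cast hp
  have hh := hn_pos n
  have hm := mul_hn n
  have p0 : (0 : ℝ) ≤ p := by positivity
  have hang : (2 * (n : ℝ) + 2) * ((2 * p + 1) * hn n) = p * Real.pi + Real.pi / 2 := by
    linear_combination (2 * (2 * (p : ℝ) + 1)) * hm
  set θ := (2 * (p : ℝ) + 1) * hn n with hθ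
  have hθ0 : 0 < θ / 2 := by positivity
  have hθ1 : θ / 2 < Real.pi / 4 := by nlinarith
  have hc : Real.cos ((2 * n + 2) * θ) = 0 := by
    rw [hang, Real.cos_add_pi_div_two, Real.sin_nat_mul_pi, neg_zero]
  have hs : Real.sin ((2 * n + 2) * θ) = (-1) ^ p := by
    rw [hang, Real.sin_add_pi_div_two, Real.cos_nat_mul_pi]
  have hsin : 0 < Real.sin (θ / 2) :=
    Real.sin_pos_of_pos_of_lt_pi hθ0 (by linarith [Real.pi_pos])
  have hlt : Real.sin (θ / 2) < Real.cos (θ / 2) := by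
    rw [← Real.sin_pi_div_two_sub]
    exact Real.sin_lt_sin_of_lt_of_le_pi_div_two (by linarith) (by linarith) (by linarith)
  refine small_of_eigen h0t.le (c := (-1) ^ n * (-1) ^ p * (Real.cos (θ / 2) / Real.sin (θ / 2)))
    ?_ fun f hf y => tr_mode h0t ht hc hs hsin.ne' hf y
  rw [abs_mul, abs_mul, abs_pow, abs_pow, abs_neg, abs_one, one_pow, one_pow, one_mul, one_mul,
    abs_of_pos (div_pos (hsin.trans hlt) hsin), one_lt_div hsin]
  exact hlt

lemma sum_nodalWeight_div {q : ℕ} {u s : ℕ → ℝ} (hu : Set.InjOn u (Finset.range (q + 1)))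
    {x : ℝ} (hx : ∀ j ∈ Finset.range (q + 1), x ≠ u j) :
    ∑ j ∈ Finset.range (q + 1), Lagrange.nodalWeight (Finset.range (q + 1)) u j * (x - u j)⁻¹ *
      ∏ i ∈ Finset.range q, (u j - s i) =
    (∏ i ∈ Finset.range q, (x - s i)) / ∏ j ∈ Finset.range (q + 1), (x - u j) := by
  obtain ⟨P, hP⟩ : ∃ P, P = Lagrange.nodal (Finset.range q) s := ⟨_, rfl⟩
  have he : ∀ y, P.eval y = ∏ i ∈ Finset.range q, (y - s i) := fun y => hP ▸ Lagrange.eval_nodal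
  have hdeg : P.degree < (Finset.range (q + 1)).card := by
    rw [hP, Lagrange.degree_nodal]; simp; exact_mod_cast Nat.lt_succ_self q
  have h1 := Lagrange.eq_interpolate hu hdeg
  have h2 := congrArg (Polynomial.eval x) h1
  rw [Lagrange.eval_interpolate_not_at_node _ hx, Lagrange.eval_nodal, he] at h2
  simp only [he] at h2
  rw [h2, mul_div_cancel_left₀]
  exact Finset.prod_ne_zero_iff.mpr fun j hj => sub_ne_zero.mpr (hx j hj)

lemma sin_sq_sub_sin_sq (x y : ℝ) :
    Real.sin x ^ 2 - Real.sin y ^ 2 = Real.sin (x - y) * Real.sin (x + y) := by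
  rw [Real.sin_sub, Real.sin_add]
  have h1 := Real.sin_sq_add_cos_sq x
  have h2 := Real.sin_sq_add_cos_sq y
  linear_combination (-Real.sin x ^ 2) * h2 + (Real.sin y ^ 2) * h1

/-- Product of the sines at the even multiples of the angle unit. -/
def Ev (n K : ℕ) : ℝ := ∏ k ∈ Finset.range K, Real.sin ((2 * k + 2) * hn n)

/-- Product of the sines at the odd multiples of the angle unit. -/
def Od (n K : ℕ) : ℝ := ∏ k ∈ Finset.range K, Real.sin ((2 * k + 1) * hn n)

/-- The ratio of consecutive wall correlations. -/
def wf (n K : ℕ) : ℝ := (Ev n K / Od n K) ^ 2 / (2 * (n + 1) * Real.sin ((2 * K + 1) * hn n))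

lemma Ev_pos {n K : ℕ} (h : K ≤ 2 * n + 1) : 0 < Ev n K := by
  refine Finset.prod_pos fun k hk => sin_hn_pos (by positivity) ?_
  have : (k : ℝ) + 1 ≤ K := by exact_mod_cast Finset.mem_range.mp hk
  have : (K : ℝ) ≤ 2 * n + 1 := by exact_mod_cast h
  linarith

lemma Od_pos {n K : ℕ} (h : K ≤ 2 * n + 2) : 0 < Od n K := by
  refine Finset.prod_pos fun k hk => sin_hn_pos (by positivity) ?_
  have : (k : ℝ) + 1 ≤ K := by exact_mod_cast Finset.mem_range.mp hk
  have : (K : ℝ) ≤ 2 * n + 2 := by exact_mod_cast h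
  linarith

lemma prod_range_double (f : ℕ → ℝ) (q r : ℕ) :
    (∏ k ∈ Finset.range q, f (q - 1 - k)) * ∏ k ∈ Finset.range r, f (q + k) =
      ∏ k ∈ Finset.range (q + r), f k := by
  rw [Finset.prod_range_add, Finset.prod_range_reflect]

lemma prod_odd_sub_odd (n q : ℕ) : ∏ j ∈ Finset.range q, (Real.sin ((2 * q + 1) * hn n) ^ 2 -
    Real.sin ((2 * j + 1) * hn n) ^ 2) = Ev n (2 * q) := by
  unfold Ev
  rw [two_mul q, ← prod_range_double, ← Finset.prod_mul_distrib]
  refine Finset.prod_congr rfl fun j hj => ?_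
  have hj := Finset.mem_range.mp hj
  rw [sin_sq_sub_sin_sq]
  congr 2
  · rw [show q - 1 - j = q - (j + 1) by omega, Nat.cast_sub (by omega)]; push_cast; ring
  · push_cast; ring

lemma prod_odd_sub_even (n q : ℕ) : (∏ j ∈ Finset.range q, (Real.sin ((2 * q + 1) * hn n) ^ 2 -
    Real.sin ((2 * j + 2) * hn n) ^ 2)) * Real.sin ((2 * q + 1) * hn n) = Od n (2 * q + 1) := by
  unfold Od
  rw [two_mul q, add_assoc, ← prod_range_double, Finset.prod_range_succ', ← mul_assoc,
    ← Finset.prod_mul_distrib]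
  congr 1
  refine Finset.prod_congr rfl fun j hj => ?_
  have hj := Finset.mem_range.mp hj
  rw [sin_sq_sub_sin_sq]
  congr 2
  · rw [show q - 1 - j = q - (j + 1) by omega, Nat.cast_sub (by omega)]; push_cast; ring
  · push_cast; ring

lemma prod_even_sub_odd (n q : ℕ) : ∏ j ∈ Finset.range (q + 1),
    (Real.sin ((2 * q + 2) * hn n) ^ 2 - Real.sin ((2 * j + 1) * hn n) ^ 2) =
      Od n (2 * q + 2) := by
  unfold Od
  rw [show 2 * q + 2 = (q + 1) + (q + 1) by ring, ← prod_range_double _ (q + 1) (q + 1),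
    ← Finset.prod_mul_distrib]
  refine Finset.prod_congr rfl fun j hj => ?_
  have hj := Finset.mem_range.mp hj
  rw [sin_sq_sub_sin_sq]
  congr 2
  · rw [show q + 1 - 1 - j = q - j by omega, Nat.cast_sub (by omega)]; ring
  · push_cast; ring

lemma prod_even_sub_even (n q : ℕ) : (∏ j ∈ Finset.range q, (Real.sin ((2 * q + 2) * hn n) ^ 2 -
    Real.sin ((2 * j + 2) * hn n) ^ 2)) * Real.sin ((2 * q + 2) * hn n) = Ev n (2 * q + 1) := by
  unfold Ev
  rw [two_mul q, add_assoc, ← prod_range_double, Finset.prod_range_succ', ← mul_assoc,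
    ← Finset.prod_mul_distrib]
  congr 1
  refine Finset.prod_congr rfl fun j hj => ?_
  have hj := Finset.mem_range.mp hj
  rw [sin_sq_sub_sin_sq]
  congr 2
  · rw [show q - 1 - j = q - (j + 1) by omega, Nat.cast_sub (by omega)]; push_cast; ring
  · push_cast; ring

lemma exists_small {t : ℝ} (h0t : 0 < t) (ht : t ^ 2 + 2 * t = 1) {n q : ℕ} (hq : q < n) :
    ∃ B A : ℕ → ℝ, Small t n B A ∧ (∀ j, q < j → j ≤ n → B j = 0) ∧
      (∀ j < q, A j = 0) ∧ A q = 1 ∧ B q ≠ 0 ∧ (B q)⁻¹ = wf n (2 * q + 1) := by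
  have hq' : (q : ℝ) + 1 ≤ n := by exact_mod_cast hq
  set u : ℕ → ℝ := fun j => Real.sin ((2 * j + 1) * hn n) ^ 2 with hu
  set s : ℕ → ℝ := fun j => Real.sin ((2 * j + 2) * hn n) ^ 2 with hs
  have hcos : ∀ j ≤ n, 0 < Real.cos ((2 * j + 1) * hn n) := by
    intro j hj
    have hj' : (j : ℝ) ≤ n := by exact_mod_cast hj
    have := mul_hn n
    have := hn_pos n
    apply Real.cos_pos_of_mem_Ioo
    constructor
    · have : 0 < (2 * j + 1) * hn n := by positivity
      linarith [Real.pi_pos]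
    · nlinarith
  have hinj : Set.InjOn u (Finset.range (q + 1)) := by
    intro i hi j hj hij
    by_contra hne
    have hi : i < q + 1 := by simpa using hi
    have hj : j < q + 1 := by simpa using hj
    have hi' : (i : ℝ) ≤ q := by exact_mod_cast Nat.lt_succ_iff.mp hi
    have hj' : (j : ℝ) ≤ q := by exact_mod_cast Nat.lt_succ_iff.mp hj
    have i0 : (0 : ℝ) ≤ i := by positivity
    have j0 : (0 : ℝ) ≤ j := by positivity
    have h := sin_sq_sub_sin_sq ((2 * i + 1) * hn n) ((2 * j + 1) * hn n)
    rw [show Real.sin ((2 * i + 1) * hn n) ^ 2 = Real.sin ((2 * j + 1) * hn n) ^ 2 from hij,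
      sub_self, ← sub_mul, ← add_mul] at h
    have h1 : Real.sin ((2 * (i : ℝ) + 1 - (2 * j + 1)) * hn n) ≠ 0 := by
      refine sin_hn_ne_zero ?_ ?_
      · exact_mod_cast (by omega : 2 * (i : ℤ) + 1 - (2 * j + 1) ≠ 0)
      · rw [abs_lt]; constructor <;> linarith
    have h2 : Real.sin ((2 * (i : ℝ) + 1 + (2 * j + 1)) * hn n) ≠ 0 :=
      (sin_hn_pos (by positivity) (by linarith)).ne'
    exact mul_ne_zero h1 h2 h.symm
  have hsu : ∀ i < n, ∀ j ≤ n, s i - u j ≠ 0 := fun i hi j hj => (sum_sin_sin_cross hi hj).2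
  set w : ℕ → ℝ := Lagrange.nodalWeight (Finset.range (q + 1)) u with hw
  set Qf : ℝ → ℝ := fun x => ∏ i ∈ Finset.range q, (x - s i) with hQf
  set Pf : ℝ → ℝ := fun x => ∏ j ∈ Finset.range (q + 1), (x - u j) with hPf
  have e1 : ∏ j ∈ Finset.range q, (u q - u j) = Ev n (2 * q) := prod_odd_sub_odd n q
  have e2 : Qf (u q) * Real.sin ((2 * q + 1) * hn n) = Od n (2 * q + 1) := prod_odd_sub_even n q
  have e3 : Pf (s q) = Od n (2 * q + 2) := prod_even_sub_odd n q
  have e4 : Qf (s q) * Real.sin ((2 * q + 2) * hn n) = Ev n (2 * q + 1) := prod_even_sub_even n q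
  have p1 : 0 < Ev n (2 * q) := Ev_pos (by omega)
  have p1' : 0 < Ev n (2 * q + 1) := Ev_pos (by omega)
  have p2 : 0 < Od n (2 * q + 1) := Od_pos (by omega)
  have p3 : 0 < Od n (2 * q + 2) := Od_pos (by omega)
  have f1 : Ev n (2 * q + 1) = Ev n (2 * q) *
      (2 * Real.sin ((2 * q + 1) * hn n) * Real.cos ((2 * q + 1) * hn n)) := by
    rw [← Real.sin_two_mul]
    unfold Ev
    rw [Finset.prod_range_succ]
    congr 2; push_cast; ring
  have f2 : Od n (2 * q + 2) = Od n (2 * q + 1) * Real.sin ((2 * ((2 * q + 1 : ℕ) : ℝ) + 1) * hn n) := by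
    unfold Od
    rw [Finset.prod_range_succ]
  have hwq : w q = (Ev n (2 * q))⁻¹ := by
    rw [hw, Lagrange.nodalWeight, Finset.prod_inv_distrib, ← e1, Finset.range_add_one,
      Finset.erase_insert (by simp)]
  set κ : ℝ := (n + 1) * Pf (s q) / (Real.sin ((2 * q + 2) * hn n) * Qf (s q)) with hκ
  set β : ℕ → ℝ := fun j => κ * (w j * Qf (u j)) / Real.cos ((2 * j + 1) * hn n) with hβ
  set z : ℕ → ℝ := fun p => 2 / (n + 1) * ∑ j ∈ Finset.range (q + 1),
    (-1) ^ j * β j * Real.sin ((2 * j + 1) * ((2 * p + 1) * hn n)) with hz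
  have n0 : (0 : ℝ) < n + 1 := by positivity
  have hB : ∀ i ≤ n, ∑ p ∈ Finset.range (n + 1), z p * mB ((2 * p + 1) * hn n) i =
      if i ≤ q then β i else 0 := by
    intro i hi
    have : ∀ p ∈ Finset.range (n + 1), z p * mB ((2 * p + 1) * hn n) i =
        ∑ j ∈ Finset.range (q + 1), 2 / (n + 1) * ((-1) ^ j * (-1) ^ i) * β j *
          (Real.sin ((2 * j + 1) * ((2 * p + 1) * hn n)) *
            Real.sin ((2 * i + 1) * ((2 * p + 1) * hn n))) := by
      intro p _
      simp only [hz, mB]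
      rw [Finset.mul_sum, Finset.sum_mul]
      exact Finset.sum_congr rfl fun j _ => by ring
    rw [Finset.sum_congr rfl this, Finset.sum_comm]
    simp only [← Finset.mul_sum]
    rw [Finset.sum_congr rfl fun j hj => by
      rw [sum_sin_sin hi (by have := Finset.mem_range.mp hj; omega)]]
    simp only [mul_ite, mul_zero]
    rw [Finset.sum_ite_eq]
    simp only [Finset.mem_range, Nat.lt_succ_iff]
    split_ifs
    · rw [← mul_pow]; norm_num; field_simp
    · rfl
  have hA : ∀ i < n, ∑ p ∈ Finset.range (n + 1), z p * mA t n ((2 * p + 1) * hn n) i =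
      κ * Real.sin ((2 * i + 2) * hn n) / (n + 1) * (Qf (s i) / Pf (s i)) := by
    intro i hi
    have : ∀ p ∈ Finset.range (n + 1), z p * mA t n ((2 * p + 1) * hn n) i =
        ∑ j ∈ Finset.range (q + 1), 2 / (n + 1) * β j * ((-1) ^ i * (-1) ^ j *
          (Real.sin ((2 * j + 1) * ((2 * p + 1) * hn n)) *
            Real.sin ((2 * i + 2) * ((2 * p + 1) * hn n)))) := by
      intro p _
      simp only [hz, mA, if_neg hi.ne, div_one]
      rw [Finset.mul_sum, Finset.sum_mul]
      exact Finset.sum_congr rfl fun j _ => by ring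
    rw [Finset.sum_congr rfl this, Finset.sum_comm]
    simp only [← Finset.mul_sum]
    rw [← sum_nodalWeight_div (s := s) hinj fun j hj => sub_ne_zero.mp
      (hsu i hi j (by have := Finset.mem_range.mp hj; omega)), Finset.mul_sum]
    refine Finset.sum_congr rfl fun j hj => ?_
    have hj : j ≤ n := by have := Finset.mem_range.mp hj; omega
    rw [(sum_sin_sin_cross hi hj).1]
    have h1 := hsu i hi j hj
    have h2 := (hcos j hj).ne'
    change 2 / (n + 1) * (κ * (w j * Qf (u j)) / Real.cos ((2 * j + 1) * hn n)) *
      (Real.cos ((2 * j + 1) * hn n) * Real.sin ((2 * i + 2) * hn n) / (2 * (s i - u j))) =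
      κ * Real.sin ((2 * i + 2) * hn n) / (n + 1) * (w j * (s i - u j)⁻¹ * Qf (u j))
    generalize Real.cos ((2 * j + 1) * hn n) = c at h2 ⊢
    generalize s i - u j = d at h1 ⊢
    field_simp
  have hsin : Real.sin ((2 * q + 2) * hn n) ≠ 0 := (sin_hn_pos (by positivity) (by linarith)).ne'
  have hsin1 : Real.sin ((2 * q + 1) * hn n) ≠ 0 := (sin_hn_pos (by positivity) (by linarith)).ne'
  have hQs : Qf (s q) ≠ 0 := fun h => by rw [h, zero_mul] at e4; exact p1'.ne e4
  have hQu : Qf (u q) ≠ 0 := fun h => by rw [h, zero_mul] at e2; exact p2.ne e2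
  have hPs : Pf (s q) ≠ 0 := by rw [e3]; exact p3.ne'
  have hcq := (hcos q hq.le).ne'
  have hκ0 : κ ≠ 0 := div_ne_zero (mul_ne_zero n0.ne' hPs) (mul_ne_zero hsin hQs)
  refine ⟨_, _, Small.sum h0t.le (Finset.range (n + 1)) z
    (fun p => mB ((2 * p + 1) * hn n)) (fun p => mA t n ((2 * p + 1) * hn n))
    fun p hp => mode_small h0t ht (Nat.lt_succ_iff.mp (Finset.mem_range.mp hp)),
    fun j h1 h2 => ?_, fun j hj => ?_, ?_, ?_, ?_⟩
  · rw [hB j h2, if_neg (by omega)]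
  · have : Qf (s j) = 0 := Finset.prod_eq_zero (Finset.mem_range.mpr hj) (sub_self _)
    rw [hA j (hj.trans hq), this]; simp
  · rw [hA q hq, hκ]
    generalize Real.sin ((2 * q + 2) * hn n) = S at hsin ⊢
    field_simp
  · rw [hB q hq.le, if_pos le_rfl]
    simp only [hβ, hwq]
    exact div_ne_zero (mul_ne_zero hκ0 (mul_ne_zero (inv_ne_zero p1.ne') hQu)) hcq
  · rw [hB q hq.le, if_pos le_rfl]
    simp only [hβ, hwq, wf]
    rw [f2] at e3 p3
    have h3 := ((mul_pos_iff_of_pos_left p2).mp p3).ne'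
    rw [hκ, e3, f1]
    rw [f1] at e4
    have e2' : Qf (u q) = Od n (2 * q + 1) / Real.sin ((2 * q + 1) * hn n) := by
      rw [← e2]; field_simp
    rw [e2', mul_comm (Real.sin ((2 * q + 2) * hn n)), e4]
    have := p1.ne'
    have := p2.ne'
    field_simp

section Rows
variable (n : ℕ)

/-- The `j`-th site of the row `v`. -/
def site (v : ℤ) (j : ℕ) : ℤ × ℤ := if Even v then (2 * j, v) else (2 * n + 1 - 2 * j, v)

/-- The configuration in the row `v`. -/
def rw' (v : ℤ) (A : Finset (ℤ × ℤ)) : Finset ℕ := (Finset.Icc 1 n).filter fun j => site n v j ∈ A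

variable {n}

lemma site_even {v : ℤ} (h : Even v) (j : ℕ) : site n v j = (2 * (j : ℤ), v) := if_pos h

lemma site_odd {v : ℤ} (h : ¬ Even v) (j : ℕ) : site n v j = (2 * n + 1 - 2 * (j : ℤ), v) := if_neg h

lemma site_snd (v : ℤ) (j : ℕ) : (site n v j).2 = v := by unfold site; split_ifs <;> rfl

lemma site_inj {v : ℤ} {j k : ℕ} (h : site n v j = site n v k) : j = k := by
  unfold site at h
  split_ifs at h <;> simp only [Prod.mk.injEq] at h <;> omega

lemma site_mem {lo hi v : ℤ} {j : ℕ} :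
    site n v j ∈ stripF (2 * n + 1) lo hi ↔ (1 ≤ j ∧ j ≤ n) ∧ lo ≤ v ∧ v ≤ hi := by
  rw [mem_stripF]
  by_cases h : Even v
  · rw [site_even h]; simp only; have : Even (2 * (j : ℤ) + v) := by grind
    simp only [this, and_true]; omega
  · rw [site_odd h]; simp only; have : Even (2 * (n : ℤ) + 1 - 2 * j + v) := by grind
    simp only [this, and_true]; omega

lemma exists_site {lo hi : ℤ} {p : ℤ × ℤ} (hp : p ∈ stripF (2 * n + 1) lo hi) :
    ∃ j, (1 ≤ j ∧ j ≤ n) ∧ site n p.2 j = p := by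
  rw [mem_stripF] at hp
  obtain ⟨⟨h1, h2⟩, -, h3⟩ := hp
  by_cases h : Even p.2
  · have : Even p.1 := by grind
    obtain ⟨k, hk⟩ := this
    refine ⟨k.toNat, by omega, ?_⟩
    rw [site_even h]; ext <;> simp only; omega
  · have : ¬ Even p.1 := by grind
    obtain ⟨k, hk⟩ := Int.not_even_iff_odd.mp this
    refine ⟨(n - k).toNat, by omega, ?_⟩
    rw [site_odd h]; ext <;> simp only; omega

lemma mem_rw {v : ℤ} {A : Finset (ℤ × ℤ)} {j : ℕ} :
    j ∈ rw' n v A ↔ (1 ≤ j ∧ j ≤ n) ∧ site n v j ∈ A := by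
  simp [rw']

lemma sg_rw {lo hi v : ℤ} {A : Finset (ℤ × ℤ)} (hA : A ⊆ stripF (2 * n + 1) lo hi) (j : ℕ) :
    sg A (site n v j) = sg (rw' n v A) j := by
  by_cases h : site n v j ∈ A
  · rw [sg_of_mem h, sg_of_mem (mem_rw.mpr ⟨(site_mem.mp (hA h)).1, h⟩)]
  · rw [sg_of_notMem h, sg_of_notMem fun h' => h (mem_rw.mp h').2]

lemma bond_eq_lk {α : Type*} [DecidableEq α] (t : ℝ) (A : Finset α) (u v : α) :
    bond t A u v = lk t (sg A u * sg A v) := by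
  unfold bond sg lk
  split_ifs <;> first | (exfalso; tauto) | ring

lemma prod_range_two_mul_add_one (f : ℕ → ℝ) (n : ℕ) : ∏ u ∈ Finset.range (2 * n + 1), f u =
    (∏ i ∈ Finset.range (n + 1), f (2 * i)) * ∏ i ∈ Finset.range n, f (2 * i + 1) := by
  induction n with
  | zero => simp
  | succ n ih =>
    rw [show 2 * (n + 1) + 1 = 2 * n + 1 + 1 + 1 by ring, Finset.prod_range_succ,
      Finset.prod_range_succ, ih, Finset.prod_range_succ _ (n + 1),
      Finset.prod_range_succ (fun i => f (2 * i + 1)) n]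
    rw [show 2 * n + 1 + 1 = 2 * (n + 1) by ring]; ring

/-- The weight of the bonds between two neighbouring rows. -/
lemma wt_band (t : ℝ) {lo hi v : ℤ} {A : Finset (ℤ × ℤ)} (hA : A ⊆ stripF (2 * n + 1) lo hi) :
    wt t (Finset.Ico 0 (2 * (n : ℤ) + 1) ×ˢ {v}) ea eb A =
      tk t n (rw' n (v + 1) A) (rw' n v A) := by
  have hw : ∀ v, sg (rw' n v A) 0 = 1 ∧ sg (rw' n v A) (n + 1) = 1 := fun v =>
    ⟨sg_of_notMem fun h => by have := (mem_rw.mp h).1; omega,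
      sg_of_notMem fun h => by have := (mem_rw.mp h).1; omega⟩
  have h1 : wt t (Finset.Ico 0 (2 * (n : ℤ) + 1) ×ˢ {v}) ea eb A =
      ∏ u ∈ Finset.range (2 * n + 1), bond t A (ea ((u : ℤ), v)) (eb ((u : ℤ), v)) := by
    unfold wt
    rw [Finset.prod_product]
    simp only [Finset.prod_singleton]
    refine (Finset.prod_bij (fun (u : ℕ) _ => (u : ℤ)) ?_ ?_ ?_ ?_).symm
    · intro u hu; have := Finset.mem_range.mp hu; rw [Finset.mem_Ico]; omega
    · intro u _ u' _ h; exact_mod_cast h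
    · intro u hu
      rw [Finset.mem_Ico] at hu
      exact ⟨u.toNat, by rw [Finset.mem_range]; omega, by omega⟩
    · intro u _; rfl
  rw [h1, prod_range_two_mul_add_one]
  have hsite : ∀ (v u : ℤ) (j : ℕ), site n v j = (u, v) → sg A (u, v) = sg (rw' n v A) j :=
    fun v u j h => by rw [← h, sg_rw hA]
  have h0 : lk 0 (1 * 1) = 1 := by unfold lk; norm_num
  by_cases hv : Even v
  · have hv' : ¬ Even (v + 1) := by grind
    unfold tk
    rw [(hw v).1, (hw (v + 1)).1, (hw v).2, (hw (v + 1)).2, h0, one_mul, one_mul]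
    congr 1
    · refine Finset.prod_congr rfl fun i hi => ?_
      have hi := Finset.mem_range.mp hi
      push_cast
      rw [ea_of_even (by grind), eb_of_even (by grind), bond_eq_lk,
        hsite v _ i (site_even hv i), hsite (v + 1) _ (n - i)
          (by rw [site_odd hv', Nat.cast_sub (by omega)]; ext <;> simp only; ring)]
    · refine Finset.prod_congr rfl fun i hi => ?_
      have hi := Finset.mem_range.mp hi
      push_cast
      rw [ea_of_not_even (by grind), eb_of_not_even (by grind), bond_eq_lk,
        hsite v _ (i + 1) (by rw [site_even hv]; ext <;> push_cast <;> ring),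
        hsite (v + 1) _ (n - i)
          (by rw [site_odd hv', Nat.cast_sub (by omega)]; ext <;> simp only; ring)]
  · have hv' : Even (v + 1) := by grind
    rw [tk_comm]
    unfold tk
    rw [(hw v).1, (hw (v + 1)).1, (hw v).2, (hw (v + 1)).2, h0, one_mul, one_mul]
    congr 1
    · refine Finset.prod_congr rfl fun i hi => ?_
      have hi := Finset.mem_range.mp hi
      push_cast
      rw [ea_of_not_even (by grind), eb_of_not_even (by grind), bond_eq_lk, mul_comm,
        hsite (v + 1) _ i (site_even hv' i), hsite v _ (n - i)
          (by rw [site_odd hv, Nat.cast_sub (by omega)]; ext <;> simp only; ring)]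
    · refine Finset.prod_congr rfl fun i hi => ?_
      have hi := Finset.mem_range.mp hi
      push_cast
      rw [ea_of_even (by grind), eb_of_even (by grind), bond_eq_lk, mul_comm,
        hsite (v + 1) _ (i + 1) (by rw [site_even hv']; ext <;> push_cast <;> ring),
        hsite v _ (n - i)
          (by rw [site_odd hv, Nat.cast_sub (by omega)]; ext <;> simp only; ring)]

/-- The sites of the row `v`. -/
def rowS (n : ℕ) (v : ℤ) : Finset (ℤ × ℤ) := (Finset.Icc 1 n).image (site n v)

lemma mem_rowS {v : ℤ} {p : ℤ × ℤ} :
    p ∈ rowS n v ↔ ∃ j, (1 ≤ j ∧ j ≤ n) ∧ site n v j = p := by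
  simp [rowS, and_assoc]

lemma rowS_snd {v : ℤ} {p : ℤ × ℤ} (h : p ∈ rowS n v) : p.2 = v := by
  obtain ⟨j, -, rfl⟩ := mem_rowS.mp h
  exact site_snd v j

lemma mem_strip_iff {lo hi : ℤ} {p : ℤ × ℤ} :
    p ∈ stripF (2 * n + 1) lo hi ↔ p ∈ rowS n p.2 ∧ lo ≤ p.2 ∧ p.2 ≤ hi := by
  constructor
  · intro h
    exact ⟨mem_rowS.mpr (exists_site h), (mem_stripF.mp h).2.1⟩
  · rintro ⟨h, h1⟩
    obtain ⟨j, hj, he⟩ := mem_rowS.mp h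
    rw [← he, site_mem]
    exact ⟨hj, h1⟩

/-- Summing out the configuration in a single row. -/
lemma sum_row {U : Finset (ℤ × ℤ)} {r : ℤ} (hU : ∀ p ∈ U, p.2 ≠ r)
    (G : Finset (ℤ × ℤ) → Finset ℕ → ℝ) :
    ∑ A ∈ (U ∪ rowS n r).powerset, G (A.filter fun p => p.2 ≠ r) (rw' n r A) =
      ∑ A ∈ U.powerset, ∑ x ∈ (Finset.Icc 1 n).powerset, G A x := by
  have hd : Disjoint U (rowS n r) := Finset.disjoint_left.mpr fun p hp hp' => hU p hp (rowS_snd hp')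
  rw [sum_powerset_union hd]
  refine Finset.sum_congr rfl fun A hA => ?_
  rw [Finset.mem_powerset] at hA
  refine Finset.sum_bij' (fun B _ => rw' n r B) (fun x _ => x.image (site n r)) ?_ ?_ ?_ ?_ ?_
  · intro B _; exact Finset.mem_powerset.mpr (Finset.filter_subset _ _)
  · intro x hx
    exact Finset.mem_powerset.mpr (Finset.image_subset_image (Finset.mem_powerset.mp hx))
  · intro B hB
    ext p
    simp only [Finset.mem_image, mem_rw]
    constructor
    · rintro ⟨j, ⟨-, h⟩, rfl⟩; exact h
    · intro hp
      obtain ⟨j, hj, he⟩ := mem_rowS.mp (Finset.mem_powerset.mp hB hp)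
      exact ⟨j, ⟨hj, by rwa [he]⟩, he⟩
  · intro x hx
    ext j
    simp only [Finset.mem_image, mem_rw]
    constructor
    · rintro ⟨-, k, hk, he⟩; rwa [← site_inj he]
    · intro hj
      exact ⟨Finset.mem_Icc.mp (Finset.mem_powerset.mp hx hj), j, hj, rfl⟩
  · intro B hB
    rw [Finset.mem_powerset] at hB
    congr 1
    · ext p
      simp only [Finset.mem_filter, Finset.mem_union]
      constructor
      · rintro ⟨h | h, h'⟩
        · exact h
        · exact absurd (rowS_snd (hB h)) h'
      · intro h; exact ⟨Or.inl h, hU p (hA h)⟩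
    · ext j
      simp only [mem_rw, Finset.mem_union]
      constructor
      · rintro ⟨h, h' | h'⟩
        · exact absurd (site_snd r j) (hU _ (hA h'))
        · exact ⟨h, h'⟩
      · rintro ⟨h, h'⟩; exact ⟨h, Or.inr h'⟩

lemma tr_eq_sum (t : ℝ) (f : Finset ℕ → ℝ) {y : Finset ℕ} (hy : y ⊆ Finset.Icc 1 n) :
    tr t n f y = ∑ x ∈ (Finset.Icc 1 n).powerset, tk t n y x * f x := by
  have h0 : sg y 0 = 1 := sg_of_notMem fun h => by have := Finset.mem_Icc.mp (hy h); omega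
  have h1 : sg y (n + 1) = 1 := sg_of_notMem fun h => by have := Finset.mem_Icc.mp (hy h); omega
  unfold tr
  symm
  refine Finset.sum_subset ?_ ?_
  · refine Finset.powerset_mono.mpr fun j hj => ?_
    rw [Finset.mem_Icc] at hj; rw [Finset.mem_range]; omega
  · intro x hx hx'
    have : 0 ∈ x ∨ n + 1 ∈ x := by
      by_contra hcon
      push Not at hcon
      refine hx' (Finset.mem_powerset.mpr fun j hj => ?_)
      have := Finset.mem_range.mp (Finset.mem_powerset.mp hx hj)
      rw [Finset.mem_Icc]
      have a : j ≠ 0 := fun h => hcon.1 (h ▸ hj)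
      have b : j ≠ n + 1 := fun h => hcon.2 (h ▸ hj)
      omega
    have : tk t n y x = 0 := by
      unfold tk
      rw [h0, h1]
      rcases this with h | h
      · rw [sg_of_mem h]; simp [lk]
      · rw [sg_of_mem (v := n + 1) h]; simp [lk]
    rw [this, zero_mul]

lemma rw_filter {v r : ℤ} (h : v ≠ r) (A : Finset (ℤ × ℤ)) :
    rw' n v (A.filter fun p => p.2 ≠ r) = rw' n v A := by
  ext j; simp [mem_rw, site_snd, h]

lemma rw_subset (v : ℤ) (A : Finset (ℤ × ℤ)) : rw' n v A ⊆ Finset.Icc 1 n :=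
  Finset.filter_subset _ _

lemma wt_filter_ne (t : ℝ) {s : Finset (ℤ × ℤ)} {r : ℤ} (hs : ∀ i ∈ s, i.2 ≠ r ∧ i.2 + 1 ≠ r)
    (A : Finset (ℤ × ℤ)) : wt t s ea eb (A.filter fun p => p.2 ≠ r) = wt t s ea eb A := by
  refine Finset.prod_congr rfl fun i hi => ?_
  have := hs i hi
  apply bond_congr
  simp [ea_snd, eb_snd, this]

lemma peel_top (t : ℝ) {lo hi v : ℤ} (h1 : lo ≤ v) (h2 : v ≤ hi) (f g : Finset ℕ → ℝ) :
    ∑ A ∈ (stripF (2 * n + 1) lo (hi + 1)).powerset, wt t (sqF (2 * n + 1) lo (hi + 1)) ea eb A *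
      (f (rw' n (hi + 1) A) * g (rw' n v A)) =
    ∑ A ∈ (stripF (2 * n + 1) lo hi).powerset, wt t (sqF (2 * n + 1) lo hi) ea eb A *
      (tr t n f (rw' n hi A) * g (rw' n v A)) := by
  have hU : stripF (2 * n + 1) lo (hi + 1) = stripF (2 * n + 1) lo hi ∪ rowS n (hi + 1) := by
    ext p
    rw [Finset.mem_union, mem_strip_iff, mem_strip_iff]
    constructor
    · rintro ⟨a, b, c⟩
      rcases eq_or_lt_of_le c with h | h
      · right; rwa [← h]
      · left; exact ⟨a, b, by omega⟩
    · rintro (⟨a, b, c⟩ | h)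
      · exact ⟨a, b, by omega⟩
      · have := rowS_snd h; rw [this]; exact ⟨h, by omega, le_rfl⟩
  have hS : sqF (2 * n + 1) lo (hi + 1) =
      sqF (2 * n + 1) lo hi ∪ Finset.Ico 0 (2 * (n : ℤ) + 1) ×ˢ {hi} := by
    ext ⟨a, b⟩
    simp only [mem_sqF, Finset.mem_union, Finset.mem_product, Finset.mem_Ico, Finset.mem_singleton]
    omega
  have hdS : Disjoint (sqF (2 * n + 1) lo hi) (Finset.Ico 0 (2 * (n : ℤ) + 1) ×ˢ {hi}) := by
    rw [Finset.disjoint_left]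
    rintro ⟨a, b⟩ h h'
    simp only [mem_sqF, Finset.mem_product, Finset.mem_singleton] at h h'
    omega
  have := sum_row (n := n) (U := stripF (2 * n + 1) lo hi) (r := hi + 1)
    (fun p hp => by have := mem_stripF.mp hp; omega)
    (fun A x => wt t (sqF (2 * n + 1) lo hi) ea eb A *
      (tk t n (rw' n hi A) x * f x * g (rw' n v A)))
  rw [← hU] at this
  refine Eq.trans (Finset.sum_congr rfl fun A hA => ?_) (this.trans (Finset.sum_congr rfl
    fun A _ => ?_))
  · rw [Finset.mem_powerset] at hA
    rw [wt_filter_ne, rw_filter (by omega), rw_filter (by omega), hS, wt, Finset.prod_union hdS,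
      ← wt, ← wt, wt_band t hA, tk_comm]
    · ring
    · intro i hi; have := mem_sqF.mp hi; omega
  · rw [tr_eq_sum t f (rw_subset _ _), Finset.sum_mul, Finset.mul_sum]

lemma peel_bot (t : ℝ) {lo hi v : ℤ} (h1 : lo ≤ v) (h2 : v ≤ hi) (f g : Finset ℕ → ℝ) :
    ∑ A ∈ (stripF (2 * n + 1) (lo - 1) hi).powerset, wt t (sqF (2 * n + 1) (lo - 1) hi) ea eb A *
      (f (rw' n (lo - 1) A) * g (rw' n v A)) =
    ∑ A ∈ (stripF (2 * n + 1) lo hi).powerset, wt t (sqF (2 * n + 1) lo hi) ea eb A *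
      (tr t n f (rw' n lo A) * g (rw' n v A)) := by
  have hU : stripF (2 * n + 1) (lo - 1) hi = stripF (2 * n + 1) lo hi ∪ rowS n (lo - 1) := by
    ext p
    rw [Finset.mem_union, mem_strip_iff, mem_strip_iff]
    constructor
    · rintro ⟨a, b, c⟩
      rcases eq_or_lt_of_le b with h | h
      · right; rwa [h]
      · left; exact ⟨a, by omega, c⟩
    · rintro (⟨a, b, c⟩ | h)
      · exact ⟨a, by omega, c⟩
      · have := rowS_snd h; rw [this]; exact ⟨h, le_rfl, by omega⟩
  have hS : sqF (2 * n + 1) (lo - 1) hi =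
      sqF (2 * n + 1) lo hi ∪ Finset.Ico 0 (2 * (n : ℤ) + 1) ×ˢ {lo - 1} := by
    ext ⟨a, b⟩
    simp only [mem_sqF, Finset.mem_union, Finset.mem_product, Finset.mem_Ico, Finset.mem_singleton]
    omega
  have hdS : Disjoint (sqF (2 * n + 1) lo hi) (Finset.Ico 0 (2 * (n : ℤ) + 1) ×ˢ {lo - 1}) := by
    rw [Finset.disjoint_left]
    rintro ⟨a, b⟩ h h'
    simp only [mem_sqF, Finset.mem_product, Finset.mem_singleton] at h h'
    omega
  have := sum_row (n := n) (U := stripF (2 * n + 1) lo hi) (r := lo - 1)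
    (fun p hp => by have := mem_stripF.mp hp; omega)
    (fun A x => wt t (sqF (2 * n + 1) lo hi) ea eb A *
      (tk t n (rw' n lo A) x * f x * g (rw' n v A)))
  rw [← hU] at this
  refine Eq.trans (Finset.sum_congr rfl fun A hA => ?_) (this.trans (Finset.sum_congr rfl
    fun A _ => ?_))
  · rw [Finset.mem_powerset] at hA
    rw [wt_filter_ne, rw_filter (by omega), rw_filter (by omega), hS, wt, Finset.prod_union hdS,
      ← wt, ← wt, wt_band t hA, sub_add_cancel]
    · ring
    · intro i hi; have := mem_sqF.mp hi; omega
  · rw [tr_eq_sum t f (rw_subset _ _), Finset.sum_mul, Finset.mul_sum]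

lemma peel_tops (t : ℝ) {lo : ℤ} (h1 : lo ≤ 0) (g : Finset ℕ → ℝ) (h : ℕ) :
    ∀ f : Finset ℕ → ℝ, ∑ A ∈ (stripF (2 * n + 1) lo h).powerset,
      wt t (sqF (2 * n + 1) lo h) ea eb A * (f (rw' n h A) * g (rw' n 0 A)) =
    ∑ A ∈ (stripF (2 * n + 1) lo 0).powerset, wt t (sqF (2 * n + 1) lo 0) ea eb A *
      (itr t n h f (rw' n 0 A) * g (rw' n 0 A)) := by
  induction h with
  | zero => intro f; rfl
  | succ h ih =>
    intro f
    push_cast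
    rw [peel_top t h1 (by omega), ih, itr_succ]

lemma peel_bots (t : ℝ) (g : Finset ℕ → ℝ) (h : ℕ) :
    ∀ f : Finset ℕ → ℝ, ∑ A ∈ (stripF (2 * n + 1) (-h) 0).powerset,
      wt t (sqF (2 * n + 1) (-h) 0) ea eb A * (f (rw' n (-h) A) * g (rw' n 0 A)) =
    ∑ A ∈ (stripF (2 * n + 1) 0 0).powerset, wt t (sqF (2 * n + 1) 0 0) ea eb A *
      (itr t n h f (rw' n 0 A) * g (rw' n 0 A)) := by
  induction h with
  | zero => intro f; simp [itr_zero]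
  | succ h ih =>
    intro f
    rw [show -((h + 1 : ℕ) : ℤ) = -h - 1 by push_cast; ring]
    rw [peel_bot t (by omega) le_rfl, ih, itr_succ]

lemma itr_congr (t : ℝ) {f g : Finset ℕ → ℝ} (hfg : ∀ y ⊆ Finset.Icc 1 n, f y = g y) (h : ℕ) :
    ∀ y ⊆ Finset.Icc 1 n, itr t n h f y = itr t n h g y := by
  induction h with
  | zero => exact hfg
  | succ h ih =>
    intro y hy
    rw [itr_succ', itr_succ', tr_eq_sum t _ hy, tr_eq_sum t _ hy]
    exact Finset.sum_congr rfl fun x hx => by rw [ih x (Finset.mem_powerset.mp hx)]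

lemma bc0_eq_one {y : Finset ℕ} (hy : y ⊆ Finset.Icc 1 n) : bc0 n y = 1 := by
  unfold bc0
  rw [sg_of_notMem fun h => by have := Finset.mem_Icc.mp (hy h); omega,
    sg_of_notMem fun h => by have := Finset.mem_Icc.mp (hy h); omega]
  norm_num [lk]

lemma Zi_strip (t : ℝ) (h : ℕ) (g : Finset ℕ → ℝ) :
    Zi t (sqF (2 * n + 1) (-h) h) ea eb (stripF (2 * n + 1) (-h) h) (fun A => g (rw' n 0 A)) =
      ∑ y ∈ (Finset.Icc 1 n).powerset, itr t n h (bc0 n) y ^ 2 * g y := by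
  have e1 := peel_tops (n := n) t (lo := -h) (by omega) g h (fun _ => 1)
  have e2 := peel_bots (n := n) t (fun y => itr t n h (fun _ => 1) y * g y) h (fun _ => 1)
  simp only [one_mul] at e1 e2
  unfold Zi
  rw [e1, e2]
  have hU : stripF (2 * n + 1) 0 0 = ∅ ∪ rowS n 0 := by
    ext p
    rw [Finset.empty_union, mem_strip_iff]
    constructor
    · rintro ⟨a, b⟩; rwa [show p.2 = 0 by omega] at a
    · intro a; have := rowS_snd a; rw [this]; exact ⟨a, le_rfl, le_rfl⟩
  have := sum_row (n := n) (U := ∅) (r := 0) (by simp)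
    (fun _ x => itr t n h (bc0 n) x ^ 2 * g x)
  rw [← hU, Finset.powerset_empty, Finset.sum_singleton] at this
  rw [← this]
  refine Finset.sum_congr rfl fun A _ => ?_
  rw [itr_congr t (g := bc0 n) (fun y hy => (bc0_eq_one hy).symm) h _ (rw_subset _ _)]
  simp [wt, sqF]
  ring

lemma itr_bc0_support (t : ℝ) (h : ℕ) :
    ∀ y, ¬ (0 ∈ y ↔ n + 1 ∈ y) → itr t n h (bc0 n) y = 0 := by
  induction h with
  | zero =>
    intro y hy
    rw [itr_zero]
    unfold bc0 sg lk
    by_cases a : 0 ∈ y <;> by_cases b : n + 1 ∈ y <;> simp [a, b] at hy ⊢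
  | succ h ih =>
    intro y hy
    rw [itr_succ']
    unfold tr
    refine Finset.sum_eq_zero fun x _ => ?_
    by_cases hx : 0 ∈ x ↔ n + 1 ∈ x
    · have : tk t n y x = 0 := by
        unfold tk sg lk
        by_cases a : 0 ∈ y <;> by_cases b : n + 1 ∈ y <;> by_cases c : 0 ∈ x <;>
          by_cases d : n + 1 ∈ x <;> simp [a, b, c, d] at hy hx ⊢
      rw [this, zero_mul]
    · rw [ih x hx, mul_zero]

lemma corr_eq (t : ℝ) (h : ℕ) {m : ℕ} (hm : m ≤ n) :
    corr t n h m = 2 * ∑ y ∈ (Finset.Icc 1 n).powerset, itr t n h (bc0 n) y ^ 2 * sg y m := by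
  set F : Finset ℕ → ℝ := fun x => sg x 0 * sg x m * itr t n h (bc0 n) x ^ 2 with hF
  have hJ : ∀ x, F (symmDiff x (Finset.range (n + 2))) = F x := by
    intro x
    simp only [hF]
    rw [(bc0_even n).itr h, sg_symmDiff_of_mem x (by simp),
      sg_symmDiff_of_mem x (by simp; omega)]
    ring
  have hS : ∀ x, ¬ (0 ∈ x ↔ n + 1 ∈ x) → F x = 0 := by
    intro x hx; simp only [hF]; rw [itr_bc0_support t h x hx]; ring
  have h1 : corr t n h m = ∑ x ∈ (Finset.range (n + 2)).powerset, F x := rfl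
  have h2 : ∑ x ∈ (Finset.range (n + 2)).powerset, F x =
      ∑ x ∈ (Finset.range (n + 2)).powerset, (if 0 ∈ x then 0 else 2 * F x) := by
    have e := tr_reindex (n := n) subset_rfl (fun x => if 0 ∈ x then F x else 0)
    simp only [hJ] at e
    have e3 : ∀ x : Finset ℕ, 0 ∈ symmDiff x (Finset.range (n + 2)) ↔ ¬ 0 ∈ x := by
      intro x; simp [Finset.mem_symmDiff]
    simp only [e3, ite_not] at e
    have e4 : ∀ x, F x = (if 0 ∈ x then F x else 0) + (if 0 ∈ x then 0 else F x) := by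
      intro x; split_ifs <;> simp
    rw [Finset.sum_congr rfl fun x _ => e4 x, Finset.sum_add_distrib, ← e,
      ← Finset.sum_add_distrib]
    refine Finset.sum_congr rfl fun x _ => ?_
    split_ifs <;> ring
  rw [h1, h2, Finset.mul_sum]
  symm
  refine Finset.sum_subset_zero_on_sdiff ?_ ?_ ?_
  · refine Finset.powerset_mono.mpr fun j hj => ?_
    rw [Finset.mem_Icc] at hj; rw [Finset.mem_range]; omega
  · intro x hx
    rw [Finset.mem_sdiff, Finset.mem_powerset, Finset.mem_powerset] at hx
    split_ifs with h0
    · rfl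
    · rw [hS, mul_zero]
      intro hiff
      refine hx.2 fun j hj => ?_
      have := Finset.mem_range.mp (hx.1 hj)
      rw [Finset.mem_Icc]
      have a : j ≠ 0 := fun h => h0 (h ▸ hj)
      have b : j ≠ n + 1 := fun h => h0 (hiff.mpr (h ▸ hj))
      omega
  · intro x hx
    have h0 : 0 ∉ x := fun h => by
      have := Finset.mem_Icc.mp (Finset.mem_powerset.mp hx h); omega
    rw [if_neg h0]
    simp only [hF]
    rw [sg_of_notMem h0]; ring

lemma Ei_strip (t : ℝ) (h : ℕ) {m : ℕ} (hm : m ≤ n) :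
    Ei t (sqF (2 * n + 1) (-h) h) ea eb (stripF (2 * n + 1) (-h) h)
      (fun A => sg A (2 * (m : ℤ), 0)) = corr t n h m / corr t n h 0 := by
  have e0 := Zi_strip (n := n) t h (fun _ => 1)
  have e1 := Zi_strip (n := n) t h (fun y => sg y m)
  have e2 : Zi t (sqF (2 * n + 1) (-h) h) ea eb (stripF (2 * n + 1) (-h) h)
      (fun A => sg A (2 * (m : ℤ), 0)) = Zi t (sqF (2 * n + 1) (-h) h) ea eb
        (stripF (2 * n + 1) (-h) h) (fun A => sg (rw' n 0 A) m) := by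
    refine Finset.sum_congr rfl fun A hA => ?_
    change _ * sg A _ = _ * sg (rw' n 0 A) m
    rw [← sg_rw (Finset.mem_powerset.mp hA), site_even (by simp)]
  have e3 : ∑ y ∈ (Finset.Icc 1 n).powerset, itr t n h (bc0 n) y ^ 2 * sg y 0 =
      ∑ y ∈ (Finset.Icc 1 n).powerset, itr t n h (bc0 n) y ^ 2 * 1 := by
    refine Finset.sum_congr rfl fun y hy => ?_
    rw [sg_of_notMem fun h => by
      have := Finset.mem_Icc.mp (Finset.mem_powerset.mp hy h); omega]
  unfold Ei
  rw [e2, e1, e0, corr_eq t h hm, corr_eq t h (Nat.zero_le n), e3,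
    mul_div_mul_left _ _ two_ne_zero]

lemma Ei_congr_touching {α ι : Type*} [DecidableEq α] [DecidableEq ι] (t : ℝ) {s s' : Finset ι}
    (a b : ι → α) (U : Finset α) (f : Finset α → ℝ)
    (h : ∀ i, a i ∈ U ∨ b i ∈ U → (i ∈ s ↔ i ∈ s')) : Ei t s a b U f = Ei t s' a b U f := by
  have hf : (s.filter fun i => a i ∈ U ∨ b i ∈ U) = s'.filter fun i => a i ∈ U ∨ b i ∈ U := by
    ext i
    simp only [Finset.mem_filter]
    exact ⟨fun ⟨p, q⟩ => ⟨(h i q).mp p, q⟩, fun ⟨p, q⟩ => ⟨(h i q).mpr p, q⟩⟩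
  have hz : ∀ f, Zi t s a b U f = Zi t s' a b U f := fun f =>
    Finset.sum_congr rfl fun A hA => by
      rw [wt_filter_touching s a b (Finset.mem_powerset.mp hA),
        wt_filter_touching s' a b (Finset.mem_powerset.mp hA), hf]
  unfold Ei
  rw [hz, hz]

/-- A block of the strip, with plus boundary conditions. -/
lemma Ei_block_le {t : ℝ} (h0 : 0 < t) (h1 : t ≤ 1) (ht : t ^ 2 + 2 * t = 1) {m : ℕ}
    (hm : m ≤ n) :
    (1 - 2 * t) * Ei t (sqF (2 * n + 1) (-(2 * n + 1) - 1) (2 * n + 1)) ea eb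
      (stripF (2 * n + 1) (-(2 * n + 1)) (2 * n + 1 - 1)) (fun A => sg A (2 * (m : ℤ), 0)) ≤
      ∏ q ∈ Finset.range m, wf n (2 * q + 1) := by
  have hlim := tendsto_corr (n := n) h0.le h1 (Q := fun q => wf n (2 * q + 1)) hm
    fun q hq => exists_small h0 ht (hq.trans_le hm)
  refine ge_of_tendsto hlim ?_
  filter_upwards [Filter.eventually_ge_atTop (2 * n + 2)] with h hh
  rw [← Ei_strip t h hm]
  refine le_trans (le_of_eq ?_) (strip_compare h0 h1 ht n (N := 2 * n + 1) (H := h) rfl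
    (by omega) rfl)
  congr 1
  refine Ei_congr_touching t ea eb _ _ fun i hi => ?_
  rw [mem_sqF, mem_sqF]
  rw [mem_stripF, mem_stripF, ea_snd, eb_snd] at hi
  omega

end Rows

lemma prod_two_sin (N : ℕ) :
    ∏ k ∈ Finset.range N, (2 * Real.sin ((k + 1) * (Real.pi / (N + 1)))) = N + 1 := by
  have hN : (0 : ℝ) < N + 1 := by positivity
  have h := (Complex.isPrimitiveRoot_exp (N + 1) N.succ_ne_zero).prod_one_sub_pow_eq_order
  have h2 := congrArg norm h
  rw [norm_prod] at h2
  have h3 : ‖(N : ℂ) + 1‖ = N + 1 := by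
    have := Complex.norm_natCast (N + 1)
    push_cast at this
    exact this
  rw [h3] at h2
  refine Eq.trans ?_ h2
  refine Finset.prod_congr rfl fun k hk => ?_
  have hk' : (k : ℝ) + 1 < N + 1 := by
    have := Finset.mem_range.mp hk
    exact_mod_cast Nat.succ_lt_succ this
  have hpos : 0 < Real.sin ((k + 1) * (Real.pi / (N + 1))) := by
    apply Real.sin_pos_of_pos_of_lt_pi (by positivity)
    rw [← mul_div_assoc, div_lt_iff₀ hN, mul_comm]
    exact mul_lt_mul_of_pos_left hk' Real.pi_pos
  rw [← Complex.exp_nat_mul, norm_sub_rev]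
  have he : ((k + 1 : ℕ) : ℂ) * (2 * Real.pi * Complex.I / ((N + 1 : ℕ) : ℂ)) =
      Complex.I * ((2 * ((k + 1) * (Real.pi / (N + 1))) : ℝ) : ℂ) := by
    push_cast
    ring
  rw [he, Complex.norm_exp_I_mul_ofReal_sub_one, mul_div_cancel_left₀ _ two_ne_zero,
    Real.norm_of_nonneg (by positivity)]

lemma Ev_full (n : ℕ) : 2 ^ (2 * n + 1) * Ev n (2 * n + 1) = 2 * n + 2 := by
  have h := prod_two_sin (2 * n + 1)
  rw [Finset.prod_mul_distrib, Finset.prod_const, Finset.card_range] at h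
  push_cast at h
  rw [show (2 * (n : ℝ) + 2) = 2 * n + 1 + 1 by ring, ← h, Ev]
  congr 1
  refine Finset.prod_congr rfl fun k _ => ?_
  congr 1
  have : (n : ℝ) + 1 ≠ 0 := by positivity
  rw [hn]
  field_simp
  ring

lemma Od_full (n : ℕ) : 2 ^ (2 * n + 1) * Od n (2 * n + 2) = 1 := by
  have h := prod_two_sin (4 * n + 3)
  rw [Finset.prod_mul_distrib, Finset.prod_const, Finset.card_range] at h
  push_cast at h
  have h1 : ∏ k ∈ Finset.range (4 * n + 3), Real.sin ((k + 1) * (Real.pi / (4 * n + 3 + 1))) =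
      Od n (2 * n + 2) * Ev n (2 * n + 1) := by
    have hh : hn n = Real.pi / (4 * n + 3 + 1) := by rw [hn]; congr 1; ring
    rw [← hh]
    have key : ∀ m : ℕ, ∏ k ∈ Finset.range (2 * m + 1), Real.sin ((k + 1) * hn n) =
        Od n (m + 1) * Ev n m := by
      intro m
      induction m with
      | zero => simp [Od, Ev]
      | succ m ih =>
        rw [show 2 * (m + 1) + 1 = 2 * m + 1 + 1 + 1 by ring, Finset.prod_range_succ,
          Finset.prod_range_succ, ih]
        have ho : Od n (m + 1 + 1) = Od n (m + 1) * Real.sin ((2 * (m + 1 : ℕ) + 1) * hn n) :=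
          Finset.prod_range_succ _ _
        have hv : Ev n (m + 1) = Ev n m * Real.sin ((2 * m + 2) * hn n) :=
          Finset.prod_range_succ _ _
        rw [ho, hv]
        push_cast
        ring_nf
    have := key (2 * n + 1)
    rwa [show 2 * (2 * n + 1) + 1 = 4 * n + 3 by ring] at this
  rw [h1] at h
  have h2 := Ev_full n
  have h3 : (2 : ℝ) ^ (4 * n + 3) = 2 * 2 ^ (2 * n + 1) * 2 ^ (2 * n + 1) := by ring
  rw [h3] at h
  have h4 : (2 : ℝ) * n + 2 ≠ 0 := by positivity
  apply mul_right_cancel₀ h4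
  linear_combination (1 / 2) * h - (2 ^ (2 * n + 1) * Od n (2 * n + 2)) * h2

lemma Ev_symm (n : ℕ) : Ev n (2 * n + 1) = Ev n n ^ 2 := by
  have hm := mul_hn n
  unfold Ev
  rw [show 2 * n + 1 = (n + 1) + n by ring, Finset.prod_range_add, Finset.prod_range_succ, sq]
  have h1 : Real.sin ((2 * n + 2) * hn n) = 1 := by
    rw [← Real.sin_pi_div_two]; congr 1; linarith
  rw [h1, mul_one]
  congr 1
  rw [← Finset.prod_range_reflect]
  refine Finset.prod_congr rfl fun k hk => ?_
  have hk' := Finset.mem_range.mp hk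
  rw [← Real.sin_pi_sub]
  congr 1
  rw [show n - 1 - k = n - (k + 1) by omega, Nat.cast_add, Nat.cast_sub hk']
  push_cast
  linear_combination (-4) * hm

lemma Od_symm (n : ℕ) : Od n (2 * n + 2) = Od n (n + 1) ^ 2 := by
  have hm := mul_hn n
  unfold Od
  rw [show 2 * n + 2 = (n + 1) + (n + 1) by ring, Finset.prod_range_add, sq]
  congr 1
  rw [← Finset.prod_range_reflect]
  refine Finset.prod_congr rfl fun k hk => ?_
  have hk' := Finset.mem_range.mp hk
  rw [← Real.sin_pi_sub]
  congr 1
  rw [show n + 1 - 1 - k = (n + 1) - (k + 1) by omega, Nat.cast_add, Nat.cast_sub hk']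
  push_cast
  linear_combination (-4) * hm

lemma sin_last (n : ℕ) : Real.sin ((2 * n + 1) * hn n) = Real.cos (hn n) := by
  have hm := mul_hn n
  rw [← Real.sin_pi_div_two_sub]
  congr 1
  linarith

lemma wf_last (n : ℕ) : wf n n = Real.cos (hn n) := by
  have h1 := Ev_full n
  have h2 := Od_full n
  rw [Ev_symm] at h1
  rw [Od_symm] at h2
  have h3 : Od n (n + 1) = Od n n * Real.cos (hn n) := by
    rw [Od, Finset.prod_range_succ, sin_last]; rfl
  rw [h3] at h2
  rw [wf, sin_last]
  have hc : Real.cos (hn n) ≠ 0 := by intro h; simp [h] at h2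
  have ho : Od n n ≠ 0 := by intro h; simp [h] at h2
  have hn1 : (n : ℝ) + 1 ≠ 0 := by positivity
  have hp : (2 : ℝ) ^ (2 * n + 1) ≠ 0 := by positivity
  have h4 : Ev n n ^ 2 = (2 * n + 2) * (Od n n * Real.cos (hn n)) ^ 2 := by
    apply mul_left_cancel₀ hp
    linear_combination h1 - (2 * n + 2) * h2
  rw [div_pow, h4]
  field_simp

lemma wf_pos {n K : ℕ} (h : K ≤ 2 * n + 1) : 0 < wf n K := by
  unfold wf
  have h1 := Ev_pos h
  have h2 := Od_pos (h.trans (Nat.le_succ _))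
  have : (K : ℝ) ≤ 2 * n + 1 := by exact_mod_cast h
  have h3 : 0 < Real.sin ((2 * K + 1) * hn n) := sin_hn_pos (by positivity) (by linarith)
  positivity

lemma wf_succ {n K : ℕ} (h : K ≤ 2 * n) :
    wf n (K + 1) * (Real.sin ((2 * K + 1) * hn n) * Real.sin ((2 * K + 3) * hn n)) =
      wf n K * Real.sin ((2 * K + 2) * hn n) ^ 2 := by
  have : (K : ℝ) ≤ 2 * n := by exact_mod_cast h
  have h1 : 0 < Real.sin ((2 * K + 1) * hn n) := sin_hn_pos (by positivity) (by linarith)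
  have h2 : 0 < Real.sin ((2 * K + 3) * hn n) := sin_hn_pos (by positivity) (by linarith)
  have h3 := Od_pos (n := n) (K := K) (by omega)
  have ho : Od n (K + 1) = Od n K * Real.sin ((2 * K + 1) * hn n) :=
    Finset.prod_range_succ _ _
  have hv : Ev n (K + 1) = Ev n K * Real.sin ((2 * K + 2) * hn n) :=
    Finset.prod_range_succ _ _
  have hn1 : (n : ℝ) + 1 ≠ 0 := by positivity
  have hc : (2 * ((K + 1 : ℕ) : ℝ) + 1) * hn n = (2 * K + 3) * hn n := by push_cast; ring
  unfold wf
  rw [ho, hv, hc]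
  generalize Real.sin ((2 * K + 1) * hn n) = a at *
  generalize Real.sin ((2 * K + 2) * hn n) = b at *
  generalize Real.sin ((2 * K + 3) * hn n) = c at *
  field_simp

/-- Cotangent, as a quotient. -/
def ct (x : ℝ) : ℝ := Real.cos x / Real.sin x

lemma inv_wf_ge {n K : ℕ} (h : K ≤ n) :
    1 + Real.tan (hn n) / 2 * (ct ((2 * K + 1) * hn n) - Real.tan (hn n)) ≤ (wf n K)⁻¹ := by
  have hh := hn_pos n
  have hm := mul_hn n
  have hh4 : hn n ≤ Real.pi / 4 := by
    have : 0 ≤ (n : ℝ) * hn n := by positivity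
    linarith
  have hpi := Real.pi_pos
  have hcos : 0 < Real.cos (hn n) := Real.cos_pos_of_mem_Ioo ⟨by linarith, by linarith⟩
  have hsin : 0 < Real.sin (hn n) := Real.sin_pos_of_pos_of_lt_pi hh (by linarith)
  have htan : 0 < Real.tan (hn n) := by rw [Real.tan_eq_sin_div_cos]; positivity
  obtain ⟨d, rfl⟩ := Nat.exists_eq_add_of_le h
  clear h
  generalize hN : K + d = N at *
  induction d generalizing K with
  | zero =>
    obtain rfl : K = N := by omega
    have hct : ct ((2 * K + 1) * hn K) = Real.tan (hn K) := by
      rw [ct, sin_last, Real.tan_eq_sin_div_cos]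
      congr 1
      rw [← Real.cos_pi_div_two_sub]
      congr 1
      linarith
    rw [hct, wf_last]
    simp only [sub_self, mul_zero, add_zero]
    exact (one_le_inv₀ hcos).mpr (Real.cos_le_one _)
  | succ d ih =>
    have ih := ih (K := K + 1) (by omega)
    have hs := wf_succ (n := N) (K := K) (by omega)
    have p0 := wf_pos (n := N) (K := K) (by omega)
    have p1 := wf_pos (n := N) (K := K + 1) (by omega)
    have hK : (K : ℝ) + 1 ≤ N := by
      have : K + 1 ≤ N := by omega
      exact_mod_cast this
    have h1 : 0 < Real.sin ((2 * K + 1) * hn N) := sin_hn_pos (by positivity) (by linarith)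
    have h2 : 0 < Real.sin ((2 * K + 3) * hn N) := sin_hn_pos (by positivity) (by linarith)
    have hc : (2 * ((K + 1 : ℕ) : ℝ) + 1) * hn N = (2 * K + 3) * hn N := by push_cast; ring
    rw [hc] at ih
    have e1 := sin_sq_sub_sin_sq ((2 * K + 2) * hn N) (hn N)
    rw [show (2 * (K : ℝ) + 2) * hn N - hn N = (2 * K + 1) * hn N by ring,
      show (2 * (K : ℝ) + 2) * hn N + hn N = (2 * K + 3) * hn N by ring] at e1
    have e2 : Real.cos ((2 * K + 1) * hn N) * Real.sin ((2 * K + 3) * hn N) -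
        Real.cos ((2 * K + 3) * hn N) * Real.sin ((2 * K + 1) * hn N) =
        2 * Real.sin (hn N) * Real.cos (hn N) := by
      rw [← Real.sin_two_mul, show 2 * hn N = (2 * K + 3) * hn N - (2 * K + 1) * hn N by ring,
        Real.sin_sub]
      ring
    have hcp : 0 ≤ ct ((2 * K + 3) * hn N) - Real.tan (hn N) := by
      have l1 : 0 ≤ Real.cos ((2 * K + 4) * hn N) := by
        apply Real.cos_nonneg_of_mem_Icc
        constructor
        · have : 0 ≤ (2 * (K : ℝ) + 4) * hn N := by positivity
          linarith
        · have : (2 * (K : ℝ) + 4) * hn N ≤ (2 * (N + 1)) * hn N :=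
            mul_le_mul_of_nonneg_right (by linarith) hh.le
          linarith
      rw [show (2 * (K : ℝ) + 4) * hn N = (2 * K + 3) * hn N + hn N by ring, Real.cos_add] at l1
      rw [ct, Real.tan_eq_sin_div_cos, div_sub_div _ _ h2.ne' hcos.ne']
      exact div_nonneg (by linarith) (by positivity)
    have hr : (wf N K)⁻¹ = (wf N (K + 1))⁻¹ *
        (1 + Real.tan (hn N) / 2 * (ct ((2 * K + 1) * hn N) - ct ((2 * K + 3) * hn N))) := by
      have hx : Real.tan (hn N) / 2 * (ct ((2 * K + 1) * hn N) - ct ((2 * K + 3) * hn N)) =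
          Real.sin (hn N) ^ 2 / (Real.sin ((2 * K + 1) * hn N) * Real.sin ((2 * K + 3) * hn N)) := by
        rw [ct, ct, div_sub_div _ _ h1.ne' h2.ne', Real.tan_eq_sin_div_cos]
        rw [show Real.cos ((2 * K + 1) * hn N) * Real.sin ((2 * K + 3) * hn N) -
          Real.sin ((2 * K + 1) * hn N) * Real.cos ((2 * K + 3) * hn N) =
          2 * Real.sin (hn N) * Real.cos (hn N) by linarith]
        generalize Real.sin ((2 * K + 1) * hn N) = a at *
        generalize Real.sin ((2 * K + 3) * hn N) = c at *
        field_simp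
      rw [hx]
      generalize Real.sin ((2 * K + 1) * hn N) = a at *
      generalize Real.sin ((2 * K + 3) * hn N) = c at *
      generalize Real.sin ((2 * K + 2) * hn N) = b at *
      field_simp
      have : a * c + Real.sin (hn N) ^ 2 = b ^ 2 := by linarith
      rw [this]
      linarith
    have hd : 0 ≤ Real.tan (hn N) / 2 * (ct ((2 * K + 1) * hn N) - ct ((2 * K + 3) * hn N)) := by
      rw [ct, ct, div_sub_div _ _ h1.ne' h2.ne']
      refine mul_nonneg (by positivity) (div_nonneg ?_ (by positivity))
      rw [show Real.cos ((2 * K + 1) * hn N) * Real.sin ((2 * K + 3) * hn N) -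
          Real.sin ((2 * K + 1) * hn N) * Real.cos ((2 * K + 3) * hn N) =
          2 * Real.sin (hn N) * Real.cos (hn N) by linarith]
      positivity
    rw [hr]
    have hy : 0 ≤ Real.tan (hn N) / 2 * (ct ((2 * K + 3) * hn N) - Real.tan (hn N)) := by positivity
    refine le_trans ?_ (mul_le_mul_of_nonneg_right ih (by linarith))
    nlinarith [mul_nonneg hd hy]

lemma pow_eight_le {M q : ℕ} {w ε : ℝ} (hM : (1 : ℝ) ≤ M) (ε0 : 0 ≤ ε)
    (hεM : ε * M ≤ 3 / 8) (hlow : (1 + 1 / (2 * (4 * (q : ℝ) + 3))) * (1 - ε) ≤ w⁻¹) :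
    w ^ 8 ≤ Real.exp (6 / M) * ((q + 1) / (q + 2)) := by
  obtain ⟨a, ha⟩ : ∃ a : ℝ, a = 1 / (2 * (4 * q + 3)) := ⟨_, rfl⟩
  have a0 : 0 < a := by rw [ha]; positivity
  rw [← ha] at hlow
  have hε4 : ε ≤ 3 / 8 := by nlinarith
  have hexp : Real.exp (-(2 * ε)) ≤ 1 - ε := by
    rw [Real.exp_neg]
    have h1 := Real.add_one_le_exp (2 * ε)
    have h2 : (1 : ℝ) ≤ (1 - ε) * (2 * ε + 1) := by nlinarith
    rw [inv_le_iff_one_le_mul₀ (Real.exp_pos _)]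
    nlinarith
  have hb : ((q : ℝ) + 2) / (q + 1) ≤ (1 + a) ^ 8 := by
    refine le_trans ?_ (one_add_mul_le_pow (by linarith) 8)
    rw [ha, div_le_iff₀ (by positivity)]
    push_cast
    have : (1 + 8 * (1 / (2 * (4 * (q : ℝ) + 3)))) * (q + 1) = q + 1 + (4 * q + 4) / (4 * q + 3) := by
      field_simp
      ring
    rw [this]
    have : 1 ≤ (4 * (q : ℝ) + 4) / (4 * q + 3) := by
      rw [le_div_iff₀ (by positivity)]; linarith
    linarith
  have hfin : ((q : ℝ) + 2) / (q + 1) * Real.exp (-(6 / M)) ≤ (w ^ 8)⁻¹ := by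
    rw [← inv_pow]
    refine le_trans ?_ (pow_le_pow_left₀ (mul_nonneg (by linarith) (by linarith)) hlow 8)
    rw [mul_pow]
    refine mul_le_mul hb ?_ (Real.exp_pos _).le (by positivity)
    refine le_trans ?_ (pow_le_pow_left₀ (Real.exp_pos _).le hexp 8)
    rw [← Real.exp_nat_mul]
    apply Real.exp_le_exp.mpr
    have : ε ≤ 3 / 8 / M := by rwa [le_div_iff₀ (by linarith)]
    push_cast
    have e : 6 / (M : ℝ) = 16 * (3 / 8 / M) := by ring
    rw [e]
    linarith
  have := inv_anti₀ (by positivity) hfin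
  rw [inv_inv, mul_inv, ← Real.exp_neg, neg_neg, inv_div] at this
  linarith

lemma wf_pow_le {M q : ℕ} (hq : q < M) :
    wf (2 * M) (2 * q + 1) ^ 8 ≤ Real.exp (6 / M) * ((q + 1) / (q + 2)) := by
  have hM : (1 : ℝ) ≤ M := by exact_mod_cast (by omega : 1 ≤ M)
  have hqM : (q : ℝ) + 1 ≤ M := by exact_mod_cast hq
  have q0 : (0 : ℝ) ≤ q := by positivity
  have hw := wf_pos (n := 2 * M) (K := 2 * q + 1) (by omega)
  have h := inv_wf_ge (n := 2 * M) (K := 2 * q + 1) (by omega)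
  have hh := hn_pos (2 * M)
  have hm := mul_hn (2 * M)
  push_cast at h hm
  generalize hn (2 * M) = η at *
  generalize wf (2 * M) (2 * q + 1) = w at *
  rw [show (2 * (2 * (q : ℝ) + 1) + 1) * η = (4 * q + 3) * η by ring] at h
  have hpi := Real.pi_pos
  have hpi2 : Real.pi / 4 ≤ 4 / 5 := by linarith [Real.pi_lt_d2]
  have hx0 : 0 < (4 * (q : ℝ) + 3) * η := by positivity
  have hx1 : (4 * (q : ℝ) + 3) * η ≤ Real.pi / 2 := by nlinarith
  have hη : η ≤ 4 / 15 := by nlinarith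
  have hct : 1 / ((4 * (q : ℝ) + 3) * η) - (4 * (q : ℝ) + 3) * η / 2 ≤ ct ((4 * q + 3) * η) ∧
      0 ≤ ct ((4 * q + 3) * η) := by
    generalize (4 * (q : ℝ) + 3) * η = x at *
    have hc : 0 ≤ Real.cos x := Real.cos_nonneg_of_mem_Icc ⟨by linarith, hx1⟩
    have hs : 0 < Real.sin x := Real.sin_pos_of_pos_of_lt_pi hx0 (by linarith)
    refine ⟨?_, div_nonneg hc hs.le⟩
    have h1 := Real.one_sub_sq_div_two_le_cos (x := x)
    have h2 : Real.cos x / x ≤ ct x :=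
      div_le_div_of_nonneg_left hc hs (Real.sin_le hx0.le)
    refine le_trans ?_ h2
    rw [le_div_iff₀ hx0]
    have : (1 / x - x / 2) * x = 1 - x ^ 2 / 2 := by field_simp
    linarith
  have ht1 : η ≤ Real.tan η := Real.le_tan hh.le (by linarith [Real.pi_gt_three])
  have ht2 : Real.tan η ≤ 2 * η := by
    rw [Real.tan_eq_sin_div_cos]
    have h1 := Real.one_sub_sq_div_two_le_cos (x := η)
    have h2 : 1 / 2 ≤ Real.cos η := by nlinarith
    rw [div_le_iff₀ (by linarith)]
    nlinarith [Real.sin_le hh.le]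
  obtain ⟨ε, hε⟩ : ∃ ε, ε = (4 * (q : ℝ) + 3) * η ^ 2 / 4 + 2 * η ^ 2 := ⟨_, rfl⟩
  obtain ⟨a, ha⟩ : ∃ a : ℝ, a = 1 / (2 * (4 * q + 3)) := ⟨_, rfl⟩
  have a0 : 0 < a := by rw [ha]; positivity
  have ε0 : 0 ≤ ε := by rw [hε]; positivity
  have hεM : ε * M ≤ 3 / 8 := by
    have h1 : ε ≤ (2 * M + 1) * η ^ 2 / 2 + 2 * η ^ 2 := by
      rw [hε]; nlinarith [sq_nonneg η]
    have h2 : (2 * (M : ℝ) + 1) * η ≤ 4 / 5 := by linarith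
    have h3 : ((2 * (M : ℝ) + 1) * η) * ((2 * M + 1) * η) ≤ 4 / 5 * (4 / 5) :=
      mul_le_mul h2 h2 (by positivity) (by norm_num)
    have h4 : (M : ℝ) * η ≤ 2 / 5 := by linarith
    have h5 : η * ((M : ℝ) * η) ≤ 4 / 15 * (2 / 5) := mul_le_mul hη h4 (by positivity) (by norm_num)
    have h6 : ((2 * (M : ℝ) + 1) * η) * (M * η) ≤ 4 / 5 * (2 / 5) :=
      mul_le_mul h2 h4 (by positivity) (by norm_num)
    nlinarith
  have hlow : (1 + a) * (1 - ε) ≤ w⁻¹ := by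
    have e1 : η * (1 / ((4 * (q : ℝ) + 3) * η) - (4 * (q : ℝ) + 3) * η / 2) / 2 =
        a - (4 * (q : ℝ) + 3) * η ^ 2 / 4 := by
      rw [ha]; field_simp; ring
    have e2 : η * ct ((4 * q + 3) * η) ≤ Real.tan η * ct ((4 * q + 3) * η) :=
      mul_le_mul_of_nonneg_right ht1 hct.2
    have e3 := mul_le_mul_of_nonneg_left hct.1 hh.le
    have e4 : Real.tan η * Real.tan η ≤ (2 * η) * (2 * η) :=
      mul_le_mul ht2 ht2 (by linarith) (by linarith)
    have e5 : 0 ≤ a * ε := by positivity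
    nlinarith
  rw [ha] at hlow
  exact pow_eight_le hM ε0 hεM hlow

lemma prod_wf_pow_le (M : ℕ) :
    (∏ q ∈ Finset.range M, wf (2 * M) (2 * q + 1)) ^ 8 * (M + 1) ≤ Real.exp 6 := by
  have h : (∏ q ∈ Finset.range M, wf (2 * M) (2 * q + 1)) ^ 8 ≤
      ∏ q ∈ Finset.range M, (Real.exp (6 / M) * (((q : ℝ) + 1) / (q + 2))) := by
    rw [← Finset.prod_pow]
    refine Finset.prod_le_prod (fun q hq => ?_) fun q hq => wf_pow_le (Finset.mem_range.mp hq)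
    have := Finset.mem_range.mp hq
    exact pow_nonneg (wf_pos (by omega)).le _
  have hp : ∀ m : ℕ, (∏ q ∈ Finset.range m, (((q : ℝ) + 1) / (q + 2))) = 1 / (m + 1) := by
    intro m
    induction m with
    | zero => simp
    | succ m ih =>
      rw [Finset.prod_range_succ, ih]
      push_cast
      field_simp
      ring
  rw [Finset.prod_mul_distrib, hp, Finset.prod_const, Finset.card_range, ← Real.exp_nat_mul] at h
  have hM : (0 : ℝ) < M + 1 := by positivity
  refine (mul_le_mul_of_nonneg_right h hM.le).trans ?_
  rw [mul_assoc, one_div_mul_cancel hM.ne', mul_one]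
  apply Real.exp_le_exp.mpr
  rcases Nat.eq_zero_or_pos M with rfl | hM
  · simp
  · have : (M : ℝ) ≠ 0 := by positivity
    field_simp
    exact le_refl _

lemma mem_nbrs {v w : V2} : w ∈ nbrs v ↔ (w = (v.1 + 1, v.2) ∨ w = (v.1 - 1, v.2)) ∨
    (w = (v.1, v.2 + 1) ∨ w = (v.1, v.2 - 1)) := by
  simp [nbrs, or_assoc]

lemma mem_nbrs_comm {v w : V2} : w ∈ nbrs v ↔ v ∈ nbrs w := by
  obtain ⟨a, b⟩ := v
  obtain ⟨c, d⟩ := w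
  simp only [mem_nbrs, Prod.mk.injEq]
  omega

lemma mem_edgesV {V : Finset V2} {e : Sym2 V2} :
    e ∈ edgesV V ↔ ∃ v ∈ V, ∃ w ∈ nbrs v, s(v, w) = e := by
  simp [edgesV]

lemma exists_ends (e : Sym2 V2) : ∃ p : V2 × V2, s(p.1, p.2) = e := by
  induction e using Sym2.ind with
  | _ x y => exact ⟨(x, y), rfl⟩

/-- The first end of an edge. -/
def sa (e : Sym2 V2) : V2 := (Classical.choose (exists_ends e)).1

/-- The second end of an edge. -/
def sb (e : Sym2 V2) : V2 := (Classical.choose (exists_ends e)).2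

lemma sa_sb (e : Sym2 V2) : s(sa e, sb e) = e := Classical.choose_spec (exists_ends e)

lemma sb_mem_nbrs {V : Finset V2} {e : Sym2 V2} (h : e ∈ edgesV V) : sb e ∈ nbrs (sa e) := by
  obtain ⟨v, -, w, hw, rfl⟩ := mem_edgesV.mp h
  rcases Sym2.eq_iff.mp (sa_sb s(v, w)) with ⟨h1, h2⟩ | ⟨h1, h2⟩
  · rwa [h1, h2]
  · rw [h1, h2]; exact mem_nbrs_comm.mp hw

/-- The lattice rotated by `π/4`, with `p` placed on the axis of the strip of width `4 * M + 1`. -/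
def tilt (p : V2) (M : ℕ) (v : V2) : ℤ × ℤ :=
  ((v.1 - p.1) + (v.2 - p.2) + 2 * M, (v.1 - p.1) - (v.2 - p.2))

lemma tilt_injective (p : V2) (M : ℕ) : Function.Injective (tilt p M) := by
  rintro ⟨a, b⟩ ⟨c, d⟩ h
  simp only [tilt, Prod.mk.injEq] at h ⊢
  omega

lemma tilt_even (p : V2) (M : ℕ) (v : V2) : Even ((tilt p M v).1 + (tilt p M v).2) :=
  ⟨v.1 - p.1 + M, by simp only [tilt]; ring⟩

lemma exists_tilt (p : V2) (M : ℕ) {z : ℤ × ℤ} (h : Even (z.1 + z.2)) : ∃ v, tilt p M v = z := by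
  obtain ⟨r, hr⟩ := h
  refine ⟨(p.1 + (r - M), p.2 + (z.1 - r - M)), ?_⟩
  obtain ⟨x, y⟩ := z
  simp only [tilt, Prod.mk.injEq] at hr ⊢
  omega

/-- The unit square crossed by the image of an edge. -/
def crossSq (p : V2) (M : ℕ) (e : Sym2 V2) : ℤ × ℤ :=
  (min (tilt p M (sa e)).1 (tilt p M (sb e)).1, min (tilt p M (sa e)).2 (tilt p M (sb e)).2)

lemma cross_ends (z w : ℤ × ℤ) (hz : Even (z.1 + z.2)) (h1 : w.1 = z.1 + 1 ∨ w.1 = z.1 - 1)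
    (h2 : w.2 = z.2 + 1 ∨ w.2 = z.2 - 1) :
    (ea (min z.1 w.1, min z.2 w.2) = z ∧ eb (min z.1 w.1, min z.2 w.2) = w) ∨
    (ea (min z.1 w.1, min z.2 w.2) = w ∧ eb (min z.1 w.1, min z.2 w.2) = z) := by
  have hw : Even (w.1 + w.2) := by grind
  rw [ea_eq_iff hz, eb_eq_iff hz, ea_eq_iff hw, eb_eq_iff hw]
  dsimp only
  omega

lemma tilt_nbr {p : V2} {M : ℕ} {v w : V2} (h : w ∈ nbrs v) :
    ((tilt p M w).1 = (tilt p M v).1 + 1 ∨ (tilt p M w).1 = (tilt p M v).1 - 1) ∧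
    ((tilt p M w).2 = (tilt p M v).2 + 1 ∨ (tilt p M w).2 = (tilt p M v).2 - 1) := by
  obtain ⟨a, b⟩ := v
  obtain ⟨c, d⟩ := w
  simp only [mem_nbrs, Prod.mk.injEq] at h
  simp only [tilt]
  omega

lemma nbr_of_tilt {p : V2} {M : ℕ} {v w : V2}
    (h1 : (tilt p M w).1 = (tilt p M v).1 + 1 ∨ (tilt p M w).1 = (tilt p M v).1 - 1)
    (h2 : (tilt p M w).2 = (tilt p M v).2 + 1 ∨ (tilt p M w).2 = (tilt p M v).2 - 1) :
    w ∈ nbrs v := by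
  obtain ⟨a, b⟩ := v
  obtain ⟨c, d⟩ := w
  simp only [mem_nbrs, Prod.mk.injEq]
  simp only [tilt] at h1 h2
  omega

lemma crossSq_ends {V : Finset V2} {e : Sym2 V2} (h : e ∈ edgesV V) (p : V2) (M : ℕ) :
    (ea (crossSq p M e) = tilt p M (sa e) ∧ eb (crossSq p M e) = tilt p M (sb e)) ∨
    (ea (crossSq p M e) = tilt p M (sb e) ∧ eb (crossSq p M e) = tilt p M (sa e)) :=
  cross_ends _ _ (tilt_even _ _ _) (tilt_nbr (sb_mem_nbrs h)).1 (tilt_nbr (sb_mem_nbrs h)).2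

/-- The tilted box around `p`. -/
def boxDom (V : Finset V2) (p : V2) (M : ℕ) : Finset V2 :=
  V.filter fun v => tilt p M v ∈ stripF (4 * M + 1) (-(4 * M + 1)) (4 * M + 1 - 1)

lemma boxDom_subset (V : Finset V2) (p : V2) (M : ℕ) : boxDom V p M ⊆ V :=
  Finset.filter_subset _ _

lemma boxDom_near {p v : V2} {M : ℕ}
    (h : tilt p M v ∈ stripF (4 * M + 1) (-(4 * M + 1)) (4 * M + 1 - 1)) :
    0 < M ∧ |v.1 - p.1| ≤ 3 * M ∧ |v.2 - p.2| ≤ 3 * M := by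
  have h' := mem_stripF.mp h
  simp only [tilt] at h'
  rw [abs_le, abs_le]
  omega

lemma Ei_boxDom {t : ℝ} {V : Finset V2} {p : V2} {M : ℕ}
    (hV : ∀ v : V2, |v.1 - p.1| ≤ 3 * M → |v.2 - p.2| ≤ 3 * M → v ∈ V) :
    Ei t (edgesV V) sa sb (boxDom V p M) (fun A => sg A p) =
      Ei t (sqF (4 * M + 1) (-(4 * M + 1) - 1) (4 * M + 1)) ea eb
        (stripF (4 * M + 1) (-(4 * M + 1)) (4 * M + 1 - 1)) (fun A => sg A (2 * (M : ℤ), 0)) := by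
  have hp : tilt p M p = (2 * (M : ℤ), 0) := by simp [tilt]
  rw [← hp]
  have hmem : ∀ v, v ∈ boxDom V p M ↔
      tilt p M v ∈ stripF (4 * M + 1) (-(4 * M + 1)) (4 * M + 1 - 1) := fun v => by
    refine ⟨fun h => (Finset.mem_filter.mp h).2, fun h => Finset.mem_filter.mpr ⟨?_, h⟩⟩
    obtain ⟨-, h1, h2⟩ := boxDom_near h
    exact hV v h1 h2
  symm
  refine Ei_sg_iso (edgesV V) sa sb (boxDom V p M) _ ea eb _ (tilt p M) (crossSq p M)
    (tilt_injective p M) ?_ ?_ ?_ ?_ ?_ p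
  · ext z
    rw [Finset.mem_image]
    constructor
    · intro hz
      obtain ⟨v, rfl⟩ := exists_tilt p M (mem_stripF.mp hz).2.2
      exact ⟨v, (hmem v).mpr hz, rfl⟩
    · rintro ⟨v, hv, rfl⟩
      exact (hmem v).mp hv
  · intro i hi _ j hj _ hij
    rw [← sa_sb i, ← sa_sb j, Sym2.eq_iff]
    have hI := tilt_injective p M
    rcases crossSq_ends hi p M with ⟨h1, h2⟩ | ⟨h1, h2⟩ <;>
      rcases crossSq_ends hj p M with ⟨h3, h4⟩ | ⟨h3, h4⟩ <;>
      rw [hij, h3] at h1 <;> rw [hij, h4] at h2 <;> rw [hI h1, hI h2] <;> simp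
  · intro i hi hu
    rw [hmem, hmem] at hu
    have key : ∀ z : ℤ × ℤ, z ∈ stripF (4 * M + 1) (-(4 * M + 1)) (4 * M + 1 - 1) →
        ea (crossSq p M i) = z ∨ eb (crossSq p M i) = z →
        crossSq p M i ∈ sqF (4 * M + 1) (-(4 * M + 1) - 1) (4 * M + 1) := by
      intro z hz h
      rw [mem_stripF] at hz
      rw [ea_eq_iff hz.2.2, eb_eq_iff hz.2.2] at h
      rw [mem_sqF]
      omega
    rcases crossSq_ends hi p M with ⟨h1, h2⟩ | ⟨h1, h2⟩ <;> rcases hu with hu | hu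
    · exact key _ hu (Or.inl h1)
    · exact key _ hu (Or.inr h2)
    · exact key _ hu (Or.inr h2)
    · exact key _ hu (Or.inl h1)
  · intro z _ hu
    obtain ⟨v, hv⟩ := exists_tilt p M (ea_even z)
    obtain ⟨w, hw⟩ := exists_tilt p M (eb_even z)
    have hne : w ∈ nbrs v := by
      apply nbr_of_tilt (p := p) (M := M)
      · rw [hv, hw]; unfold ea eb; split_ifs <;> grind
      · rw [hv, hw, ea_snd, eb_snd]; exact Or.inl rfl
    rw [← hv, ← hw, ← hmem, ← hmem] at hu
    have hE : s(v, w) ∈ edgesV V := by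
      rw [mem_edgesV]
      rcases hu with hu | hu
      · exact ⟨v, boxDom_subset _ _ _ hu, w, hne, rfl⟩
      · exact ⟨w, boxDom_subset _ _ _ hu, v, mem_nbrs_comm.mp hne, Sym2.eq_swap⟩
    have hz : crossSq p M s(v, w) = z := by
      have hx : z = (min (ea z).1 (eb z).1, min (ea z).2 (eb z).2) := by
        unfold ea eb; split_ifs <;> ext <;> simp
      rw [hx, ← hv, ← hw]
      unfold crossSq
      rcases Sym2.eq_iff.mp (sa_sb s(v, w)) with ⟨h1, h2⟩ | ⟨h1, h2⟩
      · rw [h1, h2]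
      · rw [h1, h2, min_comm, min_comm (tilt p M w).2]
    refine ⟨_, hE, ?_, hz⟩
    rcases Sym2.eq_iff.mp (sa_sb s(v, w)) with ⟨h1, h2⟩ | ⟨h1, h2⟩
    · rwa [h1, h2]
    · rw [h1, h2]; exact hu.symm
  · intro i hi _
    exact crossSq_ends hi p M

/-- The weight ratio of an unsatisfied edge to a satisfied one at criticality. -/
def tc : ℝ := Real.exp (-(2 * betaC))

lemma tc_pos : 0 < tc := Real.exp_pos _

lemma tc_eq : tc = Real.sqrt 2 - 1 := by
  have h2 := Real.sq_sqrt (zero_le_two (α := ℝ))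
  have hs := Real.sqrt_nonneg 2
  have h : (0 : ℝ) < Real.sqrt 2 + 1 := by positivity
  rw [tc, betaC, Real.exp_neg, mul_div_cancel₀ _ two_ne_zero, Real.exp_log h]
  apply inv_eq_of_mul_eq_one_right
  nlinarith

lemma tc_quad : tc ^ 2 + 2 * tc = 1 := by
  rw [tc_eq]
  have h2 := Real.sq_sqrt (zero_le_two (α := ℝ))
  nlinarith

lemma tc_lt_half : tc < 1 / 2 := by
  have := tc_quad
  have := tc_pos
  nlinarith

lemma spin_eq_sg {V A : Finset V2} (hA : A ⊆ V) :
    spin V (fun x => decide ((x : V2) ∉ A)) = sg A := by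
  funext v
  unfold spin sg
  by_cases hv : v ∈ fullSet V
  · rw [dif_pos hv]
    by_cases h : v ∈ A <;> simp [h]
  · rw [dif_neg hv, if_neg]
    exact fun h => hv (Finset.mem_union_left _ (hA h))

lemma sum_spin (V : Finset V2) (F : (V2 → ℝ) → ℝ) :
    ∑ g : ↥(fullSet V) → Bool, (if ∀ w ∈ bdry V, spin V g w = 1 then 1 else 0) * F (spin V g) =
      ∑ A ∈ V.powerset, F (sg A) := by
  symm
  refine Finset.sum_of_injOn (fun A x => decide ((x : V2) ∉ A)) ?_ ?_ ?_ ?_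
  · intro A hA B hB h
    have hA' : A ⊆ V := Finset.mem_powerset.mp hA
    have hB' : B ⊆ V := Finset.mem_powerset.mp hB
    have h' : sg A = sg B := by
      rw [← spin_eq_sg hA', ← spin_eq_sg hB']
      exact congrArg (spin V) h
    ext v
    have := congrFun h' v
    unfold sg at this
    by_cases h1 : v ∈ A <;> by_cases h2 : v ∈ B <;> simp [h1, h2] at this ⊢ <;> norm_num at this
  · intro A _
    simp
  · intro g _ hg
    rw [if_neg, zero_mul]
    intro hb
    apply hg
    refine ⟨V.filter fun v => spin V g v ≠ 1,
      Finset.mem_coe.mpr (Finset.mem_powerset.mpr (Finset.filter_subset _ _)), ?_⟩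
    funext ⟨v, hv⟩
    have hs : spin V g v = if g ⟨v, hv⟩ then 1 else -1 := dif_pos hv
    by_cases hV : v ∈ V
    · cases hgv : g ⟨v, hv⟩
      · have : ((-1 : ℝ)) ≠ 1 := by norm_num
        simp [hs, hV, hgv, this]
      · simp [hs, hgv]
    · have h1 := hb v ((Finset.mem_union.mp hv).resolve_left hV)
      rw [hs] at h1
      cases hgv : g ⟨v, hv⟩
      · rw [hgv] at h1; norm_num at h1
      · simp [hV]
  · intro A hA
    have hA' : A ⊆ V := Finset.mem_powerset.mp hA
    rw [spin_eq_sg hA', if_pos, one_mul]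
    intro w hw
    exact sg_of_notMem fun h => (Finset.mem_sdiff.mp hw).2 (hA' h)

lemma exp_energy (V A : Finset V2) :
    Real.exp (betaC * ∑ e ∈ edgesV V, pairProd (sg A) e) =
      Real.exp betaC ^ (edgesV V).card * wt tc (edgesV V) sa sb A := by
  rw [Finset.mul_sum, Real.exp_sum, ← Finset.prod_const, wt, ← Finset.prod_mul_distrib]
  refine Finset.prod_congr rfl fun e _ => ?_
  have he : pairProd (sg A) e = sg A (sa e) * sg A (sb e) := by
    conv_lhs => rw [← sa_sb e]
    rfl
  rw [he]
  have hb : Real.exp (-betaC) = Real.exp betaC * tc := by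
    rw [tc, ← Real.exp_add]; congr 1; ring
  unfold sg bond
  by_cases h1 : sa e ∈ A <;> by_cases h2 : sb e ∈ A <;> simp [h1, h2, hb]

lemma ePlus_eq (V : Finset V2) (f : (V2 → ℝ) → ℝ) :
    ePlus betaC V f = Ei tc (edgesV V) sa sb V (fun A => f (sg A)) := by
  have h : ∀ f : (V2 → ℝ) → ℝ, ∑ g : ↥(fullSet V) → Bool, wPlus betaC V (spin V g) * f (spin V g) =
      Real.exp betaC ^ (edgesV V).card * Zi tc (edgesV V) sa sb V (fun A => f (sg A)) := by
    intro f
    have := sum_spin V fun σ => Real.exp (betaC * ∑ e ∈ edgesV V, pairProd σ e) * f σ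
    rw [Zi, Finset.mul_sum]
    refine Eq.trans ?_ (this.trans ?_)
    · refine Finset.sum_congr rfl fun g _ => ?_
      rw [wPlus]
      ring
    · refine Finset.sum_congr rfl fun A _ => ?_
      rw [exp_energy]
      ring
  have h1 := h fun _ => 1
  simp only [mul_one] at h1
  rw [ePlus, h, h1, Ei, mul_div_mul_left]
  exact pow_ne_zero _ (Real.exp_pos _).ne'

/-- The constant in the one-point bound. -/
def Kc : ℝ := (1 - 2 * tc)⁻¹ * Real.exp 6

lemma Kc_pos : 0 < Kc :=
  mul_pos (inv_pos.mpr (by linarith [tc_lt_half])) (Real.exp_pos _)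

lemma Ei_strip_le (M : ℕ) :
    Ei tc (sqF (4 * M + 1) (-(4 * M + 1) - 1) (4 * M + 1)) ea eb
        (stripF (4 * M + 1) (-(4 * M + 1)) (4 * M + 1 - 1)) (fun A => sg A (2 * (M : ℤ), 0)) ≤
      Kc * ((M : ℝ) + 1) ^ (-(1 / 8 : ℝ)) := by
  have ht := tc_lt_half
  have h := Ei_block_le tc_pos (by linarith) tc_quad (n := 2 * M) (m := M) (by omega)
  rw [show (2 * ((2 * M : ℕ) : ℤ) + 1) = 4 * M + 1 by push_cast; ring] at h
  have hP := prod_wf_pow_le M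
  have hP0 : 0 ≤ ∏ q ∈ Finset.range M, wf (2 * M) (2 * q + 1) :=
    Finset.prod_nonneg fun q hq => (wf_pos (by have := Finset.mem_range.mp hq; omega)).le
  generalize ∏ q ∈ Finset.range M, wf (2 * M) (2 * q + 1) = P at *
  have hM : (0 : ℝ) < M + 1 := by positivity
  have hQ : P ≤ Real.exp 6 * ((M : ℝ) + 1) ^ (-(1 / 8 : ℝ)) := by
    have hr : (0 : ℝ) ≤ ((M : ℝ) + 1) ^ (-(1 / 8 : ℝ)) := by positivity
    refine (pow_le_pow_iff_left₀ hP0 (by positivity) (by norm_num : (8 : ℕ) ≠ 0)).mp ?_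
    have h8 : (((M : ℝ) + 1) ^ (-(1 / 8 : ℝ))) ^ 8 = ((M : ℝ) + 1)⁻¹ := by
      rw [← Real.rpow_natCast, ← Real.rpow_mul hM.le, ← Real.rpow_neg_one]
      norm_num
    rw [mul_pow, h8, ← div_eq_mul_inv, le_div_iff₀ hM]
    refine hP.trans ?_
    exact le_self_pow₀ (Real.one_le_exp (by norm_num)) (by norm_num)
  rw [Kc, mul_assoc, ← div_eq_inv_mul, le_div_iff₀ (by linarith), mul_comm]
  exact h.trans hQ

lemma edist2_sq (δ : ℝ) (p q : V2) :
    edist2 δ p q ^ 2 = δ ^ 2 * (((p.1 - q.1 : ℤ) : ℝ) ^ 2 + ((p.2 - q.2 : ℤ) : ℝ) ^ 2) := by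
  rw [edist2, Real.sq_sqrt (by positivity)]
  push_cast
  ring

lemma edist2_nonneg (δ : ℝ) (p q : V2) : 0 ≤ edist2 δ p q := Real.sqrt_nonneg _

lemma le_edist2 (δ : ℝ) {p q : V2} (h : p ≠ q) : δ ≤ edist2 δ p q := by
  apply Real.le_sqrt_of_sq_le
  have h1 := edist2_sq δ p q
  have h2 : (1 : ℤ) ≤ (p.1 - q.1) ^ 2 + (p.2 - q.2) ^ 2 := by
    by_contra hc
    have h3 : (p.1 - q.1) ^ 2 = 0 := by nlinarith [sq_nonneg (p.1 - q.1), sq_nonneg (p.2 - q.2)]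
    have h4 : (p.2 - q.2) ^ 2 = 0 := by nlinarith [sq_nonneg (p.1 - q.1), sq_nonneg (p.2 - q.2)]
    apply h
    ext
    · have := pow_eq_zero_iff (two_ne_zero) |>.mp h3; omega
    · have := pow_eq_zero_iff (two_ne_zero) |>.mp h4; omega
  have h3 : (1 : ℝ) ≤ ((p.1 : ℝ) - q.1) ^ 2 + ((p.2 : ℝ) - q.2) ^ 2 := by exact_mod_cast h2
  nlinarith [sq_nonneg δ]

lemma sq_le_of_edist2 {δ : ℝ} (hδ : 0 < δ) {p q : V2} {R : ℕ} (h : δ * R ≤ edist2 δ p q) :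
    (R : ℤ) ^ 2 ≤ (p.1 - q.1) ^ 2 + (p.2 - q.2) ^ 2 := by
  have h1 := pow_le_pow_left₀ (by positivity) h 2
  rw [edist2_sq, mul_pow] at h1
  have h2 := le_of_mul_le_mul_left h1 (by positivity)
  exact_mod_cast h2

lemma bdry_nonempty {V : Finset V2} {v : V2} (hv : v ∈ V) : (bdry V).Nonempty := by
  obtain ⟨w, hw, hmax⟩ := V.exists_max_image (fun p => p.1) ⟨v, hv⟩
  refine ⟨(w.1 + 1, w.2), Finset.mem_sdiff.mpr ⟨Finset.mem_biUnion.mpr ⟨w, hw, ?_⟩, fun h => ?_⟩⟩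
  · exact mem_nbrs.mpr (Or.inl (Or.inl rfl))
  · have := hmax _ h
    simp only at this
    omega

lemma distToBdry_le (δ : ℝ) (p : V2) {V : Finset V2} {w : V2} (hw : w ∈ bdry V) :
    distToBdry δ p V ≤ edist2 δ p w :=
  csInf_le ⟨0, by rintro _ ⟨z, -, rfl⟩; exact edist2_nonneg _ _ _⟩ ⟨w, hw, rfl⟩

lemma le_distToBdry (δ : ℝ) {p : V2} {V : Finset V2} (hp : p ∈ V) :
    δ ≤ distToBdry δ p V := by
  obtain ⟨w, hw⟩ := bdry_nonempty hp
  refine le_csInf ⟨_, w, hw, rfl⟩ ?_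
  rintro _ ⟨z, hz, rfl⟩
  refine le_edist2 δ ?_
  rintro rfl
  exact (Finset.mem_sdiff.mp hz).2 hp

lemma mTerm_le_distToBdry (δ : ℝ) (V : Finset V2) (k : ℕ) (x : Fin k → V2) (j : Fin k) :
    mTerm δ V k x j ≤ distToBdry δ (x j) V := by
  unfold mTerm
  split_ifs
  · exact min_le_right _ _
  · exact le_refl _

lemma mTerm_le_edist2 (δ : ℝ) (V : Finset V2) {k : ℕ} (x : Fin k → V2) {i j : Fin k}
    (h : i ≠ j) : 2 * mTerm δ V k x j ≤ edist2 δ (x i) (x j) := by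
  have hk : 2 ≤ k := by
    have := i.2
    have := j.2
    have : (i : ℕ) ≠ j := fun e => h (Fin.ext e)
    omega
  rw [mTerm, if_pos hk]
  have h1 : (⨅ p : { p : Fin k // p ≠ j }, edist2 δ (x ↑p) (x j)) ≤ edist2 δ (x i) (x j) :=
    ciInf_le (f := fun p : { p : Fin k // p ≠ j } => edist2 δ (x ↑p) (x j))
      (Set.finite_range _).bddBelow ⟨i, h⟩
  have h2 := min_le_left ((1 / 2) * ⨅ p : { p : Fin k // p ≠ j }, edist2 δ (x ↑p) (x j))
    (distToBdry δ (x j) V)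
  linarith

lemma le_mTerm {δ : ℝ} (hδ : 0 < δ) {V : Finset V2} {k : ℕ} {x : Fin k → V2}
    (hx : ∀ j, x j ∈ V) (hinj : Function.Injective x) (j : Fin k) :
    δ / 2 ≤ mTerm δ V k x j := by
  have h1 := le_distToBdry δ (hx j)
  unfold mTerm
  split_ifs with hk
  · refine le_min ?_ (by linarith)
    have : Nontrivial (Fin k) := Fin.nontrivial_iff_two_le.mpr hk
    obtain ⟨i, hi⟩ := exists_ne j
    have : Nonempty { p : Fin k // p ≠ j } := ⟨⟨i, hi⟩⟩
    have : δ ≤ ⨅ p : { p : Fin k // p ≠ j }, edist2 δ (x ↑p) (x j) :=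
      le_ciInf fun p => le_edist2 δ fun e => p.2 (hinj e)
    linarith
  · linarith

lemma mem_of_box {V : Finset V2} {p : V2} (hp : p ∈ V) {R : ℤ}
    (hb : ∀ w ∈ bdry V, ¬ (|w.1 - p.1| ≤ R ∧ |w.2 - p.2| ≤ R)) (v : V2)
    (h1 : |v.1 - p.1| ≤ R) (h2 : |v.2 - p.2| ≤ R) : v ∈ V := by
  induction hn : (v.1 - p.1).natAbs + (v.2 - p.2).natAbs generalizing v with
  | zero =>
    obtain rfl : v = p := by ext <;> omega
    exact hp
  | succ n ih =>
    obtain ⟨w, hw, g1, g2, g3⟩ : ∃ w : V2, v ∈ nbrs w ∧ |w.1 - p.1| ≤ R ∧ |w.2 - p.2| ≤ R ∧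
        (w.1 - p.1).natAbs + (w.2 - p.2).natAbs = n := by
      obtain ⟨a, b⟩ := v
      rw [abs_le] at h1 h2
      simp only at h1 h2 hn
      rcases lt_trichotomy a p.1 with h | h | h
      · refine ⟨(a + 1, b), by simp [mem_nbrs], ?_, ?_, ?_⟩ <;> simp only [abs_le] <;> omega
      · rcases lt_trichotomy b p.2 with h' | h' | h'
        · refine ⟨(a, b + 1), by simp [mem_nbrs], ?_, ?_, ?_⟩ <;> simp only [abs_le] <;> omega
        · omega
        · refine ⟨(a, b - 1), by simp [mem_nbrs], ?_, ?_, ?_⟩ <;> simp only [abs_le] <;> omega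
      · refine ⟨(a - 1, b), by simp [mem_nbrs], ?_, ?_, ?_⟩ <;> simp only [abs_le] <;> omega
    by_contra hv
    exact hb v (Finset.mem_sdiff.mpr ⟨Finset.mem_biUnion.mpr ⟨w, ih w g1 g2 g3, hw⟩, hv⟩) ⟨h1, h2⟩

lemma sum_sq_le {a b R : ℤ} (h1 : |a| ≤ R) (h2 : |b| ≤ R) : a ^ 2 + b ^ 2 ≤ 2 * R ^ 2 := by
  have := sq_le_sq' (abs_le.mp h1).1 (abs_le.mp h1).2
  have := sq_le_sq' (abs_le.mp h2).1 (abs_le.mp h2).2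
  linarith

lemma box_subset {δ : ℝ} (hδ : 0 < δ) {V : Finset V2} {p : V2} (hp : p ∈ V) {M : ℕ}
    (h : δ * (8 * M : ℕ) ≤ distToBdry δ p V) (v : V2)
    (h1 : |v.1 - p.1| ≤ 3 * M) (h2 : |v.2 - p.2| ≤ 3 * M) : v ∈ V := by
  refine mem_of_box hp ?_ v h1 h2
  rintro w hw ⟨g1, g2⟩
  have e1 := sq_le_of_edist2 hδ (h.trans (distToBdry_le δ p hw))
  rw [abs_sub_comm] at g1 g2
  have e2 := sum_sq_le g1 g2
  push_cast at e1
  have hM : (M : ℤ) ^ 2 ≤ 0 := by nlinarith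
  have hM0 : (M : ℤ) = 0 := by
    have := le_antisymm hM (sq_nonneg _)
    exact pow_eq_zero_iff two_ne_zero |>.mp this
  rw [hM0, mul_zero, abs_le] at g1 g2
  have : w = p := by ext <;> omega
  exact (Finset.mem_sdiff.mp hw).2 (this ▸ hp)

/-- Two points near `p` and `q` respectively cannot be close if `p` and `q` are far apart. -/
lemma not_close {p q v w : V2} {M M' : ℕ} (hM : 0 < M) (hM' : 0 < M')
    (h : ((8 * (M + M') : ℕ) : ℤ) ^ 2 ≤ (p.1 - q.1) ^ 2 + (p.2 - q.2) ^ 2)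
    (h1 : |v.1 - p.1| ≤ 3 * M ∧ |v.2 - p.2| ≤ 3 * M)
    (h2 : |w.1 - q.1| ≤ 3 * M' ∧ |w.2 - q.2| ≤ 3 * M')
    (h3 : |v.1 - w.1| ≤ 1 ∧ |v.2 - w.2| ≤ 1) : False := by
  simp only [abs_le] at h1 h2 h3
  have e1 : |p.1 - q.1| ≤ 3 * (M + M') + 1 := by rw [abs_le]; omega
  have e2 : |p.2 - q.2| ≤ 3 * (M + M') + 1 := by rw [abs_le]; omega
  have e3 := sum_sq_le e1 e2
  push_cast at h
  have : (2 : ℤ) ≤ M + M' := by omega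
  nlinarith

lemma Ei_prod_le {δ : ℝ} (hδ : 0 < δ) {V : Finset V2} {k : ℕ} {x : Fin k → V2}
    (hx : ∀ j, x j ∈ V) (M : Fin k → ℕ) (hM : ∀ j, δ * (8 * M j) ≤ mTerm δ V k x j) :
    Ei tc (edgesV V) sa sb V (fun A => ∏ j, sg A (x j)) ≤
      ∏ j, (Kc * ((M j : ℝ) + 1) ^ (-(1 / 8 : ℝ))) := by
  have h1 : tc ≤ 1 := by linarith [tc_lt_half]
  have hsub : (Finset.univ.biUnion fun j => boxDom V (x j) (M j)) ⊆ V :=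
    Finset.biUnion_subset.mpr fun j _ => boxDom_subset _ _ _
  have hnear : ∀ {j : Fin k} {v : V2}, v ∈ boxDom V (x j) (M j) →
      0 < M j ∧ |v.1 - (x j).1| ≤ 3 * M j ∧ |v.2 - (x j).2| ≤ 3 * M j := fun hv =>
    boxDom_near (Finset.mem_filter.mp hv).2
  have hsep : ∀ i j : Fin k, i ≠ j → ((8 * (M i + M j) : ℕ) : ℤ) ^ 2 ≤
      ((x i).1 - (x j).1) ^ 2 + ((x i).2 - (x j).2) ^ 2 := by
    intro i j hij
    apply sq_le_of_edist2 hδ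
    have e1 := mTerm_le_edist2 δ V x hij
    have e2 := mTerm_le_edist2 δ V x hij.symm
    have e3 : edist2 δ (x j) (x i) = edist2 δ (x i) (x j) := by
      unfold edist2; congr 1; ring
    have := hM i
    have := hM j
    push_cast
    nlinarith
  have hcl : ∀ i j : Fin k, i ≠ j → ∀ v ∈ boxDom V (x i) (M i), ∀ w ∈ boxDom V (x j) (M j),
      |v.1 - w.1| ≤ 1 ∧ |v.2 - w.2| ≤ 1 → False := fun i j hij v hv w hw h =>
    not_close (hnear hv).1 (hnear hw).1 (hsep i j hij) (hnear hv).2 (hnear hw).2 h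
  refine (Ei_mono tc_pos h1 (edgesV V) sa sb hsub
    (Pos.prod Finset.univ (fun j A => sg A (x j)) fun j _ => Pos.sg _)).trans ?_
  rw [Ei_biUnion]
  · refine Finset.prod_le_prod (fun j _ => Pos.ei_nonneg tc_pos h1 _ _ _ _ (Pos.sg _)) fun j _ => ?_
    rw [Ei_boxDom]
    · exact Ei_strip_le (M j)
    · refine box_subset hδ (hx j) ?_
      push_cast
      exact (hM j).trans (mTerm_le_distToBdry δ V k x j)
  · intro i _ j _ hij
    rw [Finset.disjoint_left]
    exact fun v hv hv' => hcl i j hij v hv v hv' (by simp)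
  · rintro e he i - j - hij ⟨ha, hb⟩
    refine hcl i j hij _ ha _ hb ?_
    have hn := mem_nbrs.mp (sb_mem_nbrs he)
    rw [abs_le, abs_le]
    rcases hn with (h | h) | (h | h) <;> rw [h] <;> simp
  · intro i _ j _ hij hv
    have e1 := hsep i j hij
    obtain ⟨hp, e2, e3⟩ := hnear hv
    have e4 := sum_sq_le e2 e3
    push_cast at e1
    have : (1 : ℤ) ≤ M j := by omega
    have : (0 : ℤ) ≤ M i := by omega
    nlinarith

lemma factor_le {δ m : ℝ} (hδ : 0 < δ) (hm : 0 < m) :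
    Kc * ((⌊m / (8 * δ)⌋₊ : ℝ) + 1) ^ (-(1 / 8 : ℝ)) ≤
      (Kc * 8 ^ (1 / 8 : ℝ)) * δ ^ (1 / 8 : ℝ) * m ^ (-(1 / 8 : ℝ)) := by
  have h1 : m / (8 * δ) ≤ (⌊m / (8 * δ)⌋₊ : ℝ) + 1 := (Nat.lt_floor_add_one _).le
  have h2 : 0 < m / (8 * δ) := by positivity
  have h3 := Real.rpow_le_rpow_of_nonpos h2 h1 (by norm_num : (-(1 / 8 : ℝ)) ≤ 0)
  refine (mul_le_mul_of_nonneg_left h3 Kc_pos.le).trans (le_of_eq ?_)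
  rw [Real.div_rpow hm.le (by positivity), Real.mul_rpow (by norm_num) hδ.le,
    Real.rpow_neg (by norm_num : (0 : ℝ) ≤ 8), Real.rpow_neg hδ.le, div_eq_mul_inv, mul_inv,
    inv_inv, inv_inv]
  ring

end Ising

/-- There is a constant `C > 0` such that for every `δ > 0`, every
finite subgraph of `δℤ²`, every `k ≥ 1` and all pairwise distinct `x_1, …, x_k ∈ V`,
`E⁺[σ_{x_1}⋯σ_{x_k}] ≤ C^k δ^{k/8} ∏_j (min((1/2)L(x_j), d(x_j,∂Ω)))^{-1/8}`. -/
theorem plus_correlations_upper_bound :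
    ∃ C : ℝ, 0 < C ∧
      ∀ (δ : ℝ), 0 < δ → ∀ (V : Finset V2) (k : ℕ), 1 ≤ k →
        ∀ (x : Fin k → V2), (∀ j, x j ∈ V) → Function.Injective x →
          ePlus betaC V (fun σ => ∏ j, σ (x j)) ≤
            C ^ k * δ ^ ((k : ℝ) / 8) *
              ∏ j, (mTerm δ V k x j) ^ (-(1 / 8 : ℝ)) := by
  refine ⟨Ising.Kc * 8 ^ (1 / 8 : ℝ), mul_pos Ising.Kc_pos (by positivity), ?_⟩
  intro δ hδ V k _ x hx hinj
  have hm : ∀ j, 0 < mTerm δ V k x j := fun j =>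
    (half_pos hδ).trans_le (Ising.le_mTerm hδ hx hinj j)
  rw [Ising.ePlus_eq]
  refine (Ising.Ei_prod_le hδ hx (fun j => ⌊mTerm δ V k x j / (8 * δ)⌋₊) fun j => ?_).trans ?_
  · have h := Nat.floor_le (a := mTerm δ V k x j / (8 * δ)) (by have := hm j; positivity)
    rw [le_div_iff₀ (by positivity)] at h
    linarith
  · refine (Finset.prod_le_prod (fun j _ => mul_nonneg Ising.Kc_pos.le (by positivity))
      fun j _ => Ising.factor_le hδ (hm j)).trans (le_of_eq ?_)
    rw [Finset.prod_mul_distrib, Finset.prod_const, Finset.card_univ, Fintype.card_fin, mul_pow,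
      ← Real.rpow_mul_natCast hδ.le]
    congr 3
    ring

end
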